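/- Let n ∈ ℕ, E a complex Banach space, s ∈ ℝ, 0 < p ≤ ∞, 0 < q ≤ ∞, d > 0, and let S ∈ ℤ with S ≥ −1 and S ≥ ⌊s⌋. Let ε > 0 and Ψ, ψ ∈ S(ℝ^n) satisfy |Ψ(x)| > 0 for |x| < 2ε, |ψ(x)| > 0 for ε/2 < |x| < 2ε, and D^α ψ(0) = 0 for all multi-indices |α| ≤ S. Then both ‖f‖^I := ‖(Ψ f̂)ˇ|L_p(E)‖ + (∫₀¹ t^{−sq} ‖(ψ(t·) f̂)ˇ|L_p(E)‖^q dt/t)^{1/q} and ‖f‖^{sup} := ‖ sup_{|x−y|≤d} ‖(Ψ f̂)ˇ(y)‖_E |L_p(dx)‖ + (∫₀¹ t^{−sq} ‖ sup_{|x−y|≤dt, t≤τ≤2t} ‖(ψ(τ·) f̂)ˇ(y)‖_E |L_p(dx)‖^q dt/t)^{1/q} are equivalent quasi-norms on B^s_{p,q}(E), i.e. each is bounded above and below by constant multiples of ‖f|B^s_{p,q}(E)‖ for f ∈ B^s_{p,q}(E). Moreover, an f ∈ S'(ℝ^n,E) belongs to B^s_{p,q}(E) if and only if ‖f‖^I <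 ∞, and if and only if ‖f‖^{sup} < ∞. -/

import Mathlib

noncomputable section

open MeasureTheory Filter Metric Real Set SchwartzMap
open scoped ENNReal NNReal Topology FourierTransform

/-- Euclidean space ℝⁿ. -/
abbrev Rn (n : ℕ) : Type := EuclideanSpace ℝ (Fin n)

/-- The Schwartz space 𝓢(ℝⁿ, ℂ). -/
abbrev Sch (n : ℕ) : Type := SchwartzMap (Rn n) ℂ

/-- Partial derivative in the `i`-th coordinate direction. -/
def pd {F : Type*} [NormedAddCommGroup F] [NormedSpace ℝ F] {n : ℕ} (i : Fin n)
    (g : Rn n → F) : Rn n → F :=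
  fun x => lineDeriv ℝ g x (EuclideanSpace.single i (1 : ℝ))

/-- Multi-index derivative `D^α = ∂₁^{α₁} ⋯ ∂ₙ^{αₙ}`. -/
def mderiv {F : Type*} [NormedAddCommGroup F] [NormedSpace ℝ F] {n : ℕ} (α : Fin n → ℕ)
    (g : Rn n → F) : Rn n → F :=
  (List.finRange n).foldr (fun i h => (pd i)^[α i] h) g

/-- The order `|α|` of a multi-index. -/
def mdeg {n : ℕ} (α : Fin n → ℕ) : ℕ := ∑ i, α i

/-- The Schwartz seminorm `‖φ‖_{K,L} = sup_x (1+|x|²)^{K/2} ∑_{|α| ≤ L} |D^α φ(x)|`. -/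
def schSemi {n : ℕ} (K L : ℕ) (φ : Sch n) : ℝ :=
  ⨆ x : Rn n, (1 + ‖x‖ ^ 2) ^ ((K : ℝ) / 2) *
    ∑ α : Fin n → Fin (L + 1), if mdeg (fun i => (α i : ℕ)) ≤ L
      then ‖mderiv (fun i => (α i : ℕ)) (fun y => φ y) x‖ else 0

/-- `E`-valued tempered distributions: linear maps `𝓢(ℝⁿ) → E` bounded by some
Schwartz seminorm. -/
structure TDist (n : ℕ) (E : Type*) [NormedAddCommGroup E] [NormedSpace ℂ E] where
  toFun : Sch n →ₗ[ℂ] E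
  bound : ∃ (c : ℝ) (K L : ℕ), ∀ φ : Sch n, ‖toFun φ‖ ≤ c * schSemi K L φ

namespace Aux

lemma hasTemperateGrowth_sub_left {n : ℕ} (x : Rn n) :
    Function.HasTemperateGrowth (fun y : Rn n => x - y) := by
  apply Function.HasTemperateGrowth.of_fderiv (k := 1) (C := ‖x‖ + 1)
  · have h : (fderiv ℝ (fun y : Rn n => x - y)) =
        fun _ : Rn n => -(ContinuousLinearMap.id ℝ (Rn n)) := by
      ext1 y
      rw [fderiv_const_sub]
      simp
    rw [h]
    exact .const _
  · exact (differentiable_const x).sub differentiable_id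
  · intro y
    have h1 : ‖x - y‖ ≤ ‖x‖ + ‖y‖ := norm_sub_le x y
    have h2 : (0:ℝ) ≤ ‖y‖ := norm_nonneg y
    have h3 : (0:ℝ) ≤ ‖x‖ := norm_nonneg x
    calc ‖x - y‖ ≤ ‖x‖ + ‖y‖ := h1
      _ ≤ (‖x‖ + 1) * (1 + ‖y‖) ^ 1 := by nlinarith

lemma antilipschitz_sub_left {n : ℕ} (x : Rn n) :
    AntilipschitzWith 1 (fun y : Rn n => x - y) := by
  refine (Isometry.antilipschitz ?_)
  intro y z
  simp only [edist_dist, dist_eq_norm, sub_sub_sub_cancel_left, norm_sub_rev]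

end Aux

/-- The Schwartz function `y ↦ ψ(x - y)`. -/
def shiftReflect {n : ℕ} (ψ : Sch n) (x : Rn n) : Sch n :=
  SchwartzMap.compCLMOfAntilipschitz (𝕜 := ℝ)
    (Aux.hasTemperateGrowth_sub_left x) (Aux.antilipschitz_sub_left x) ψ

/-- The dilated Schwartz function `ψ(t ·)` (junk value `0` when `t = 0`). -/
def dilate {n : ℕ} (ψ : Sch n) (t : ℝ) : Sch n :=
  if h : t = 0 then 0 else
    SchwartzMap.compCLM (𝕜 := ℝ) (g := fun y : Rn n => t • y)
      (by
        have := (t • ContinuousLinearMap.id ℝ (Rn n)).hasTemperateGrowth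
        exact this)
      (⟨1, |t|⁻¹, fun y => by
        have ht : 0 < |t| := abs_pos.mpr h
        have : ‖t • y‖ = |t| * ‖y‖ := by rw [norm_smul]; simp [Real.norm_eq_abs]
        rw [pow_one, this]
        rw [mul_add, mul_one]
        have : |t|⁻¹ * (|t| * ‖y‖) = ‖y‖ := by field_simp
        nlinarith [norm_nonneg y, inv_pos.mpr ht]⟩) ψ

/-- Fourier transform on Schwartz space. -/
def fourierS {n : ℕ} (φ : Sch n) : Sch n := FourierTransform.fourierCLE ℂ (Sch n) φ

/-- Inverse Fourier transform on Schwartz space. -/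
def invFourierS {n : ℕ} (φ : Sch n) : Sch n := (FourierTransform.fourierCLE ℂ (Sch n)).symm φ

variable {n : ℕ} {E : Type*} [NormedAddCommGroup E] [NormedSpace ℂ E]

/-- Convolution `(ψ * f)(x) := (2π)^{-n/2} f(ψ(x - ·))` of a Schwartz function with an
`E`-valued tempered distribution. -/
def tdConv (ψ : Sch n) (f : TDist n E) : Rn n → E :=
  fun x => ((2 * π) ^ (-(n : ℝ) / 2) : ℝ) • f.toFun (shiftReflect ψ x)

/-- The operator `f ↦ (φ f̂)ˇ = φ̌ * f`. -/
def mOp (φ : Sch n) (f : TDist n E) : Rn n → E := tdConv (invFourierS φ) f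

/-- `L_p`-norm (in `[0,∞]`) of an `ℝ≥0∞`-valued function. -/
def lpNormENN {n : ℕ} (p : ℝ≥0∞) (g : Rn n → ℝ≥0∞) : ℝ≥0∞ :=
  if p = ∞ then essSup g volume else (∫⁻ x, (g x) ^ p.toReal) ^ (1 / p.toReal)

/-- `ℓ_q`-norm (in `[0,∞]`) of a sequence, with the usual modification for `q = ∞`. -/
def lqSum (q : ℝ≥0∞) (a : ℕ → ℝ≥0∞) : ℝ≥0∞ :=
  if q = ∞ then ⨆ j, a j else (∑' j, (a j) ^ q.toReal) ^ (1 / q.toReal)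

/-- A smooth dyadic resolution of unity. -/
structure SmoothResolution (n : ℕ) (φ : ℕ → Sch n) : Prop where
  supp0 : Function.support (φ 0) ⊆ {ξ : Rn n | ‖ξ‖ ≤ 2}
  suppj : ∀ j : ℕ, 0 < j →
    Function.support (φ j) ⊆ {ξ : Rn n | 2 ^ ((j : ℝ) - 1) ≤ ‖ξ‖ ∧ ‖ξ‖ ≤ 2 ^ ((j : ℝ) + 1)}
  sum_eq : ∀ ξ : Rn n, ∑' j : ℕ, φ j ξ = 1
  deriv_bound : ∀ α : Fin n → ℕ, ∃ c : ℝ, ∀ (j : ℕ) (ξ : Rn n),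
    ‖mderiv α (fun y => φ j y) ξ‖ ≤ c * 2 ^ (-(j : ℝ) * (mdeg α : ℝ))

/-- The Besov quasi-norm `‖f | B^s_{p,q}(E)‖` w.r.t. the resolution of unity `φ`. -/
def besovNorm (s : ℝ) (p q : ℝ≥0∞) (φ : ℕ → Sch n) (f : TDist n E) : ℝ≥0∞ :=
  lqSum q fun j => (2 : ℝ≥0∞) ^ ((j : ℝ) * s) * eLpNorm (mOp (φ j) f) p volume

/-- The Triebel–Lizorkin quasi-norm `‖f | F^s_{p,q}(E)‖` w.r.t. the resolution of unity `φ`. -/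
def triebelNorm (s : ℝ) (p q : ℝ≥0∞) (φ : ℕ → Sch n) (f : TDist n E) : ℝ≥0∞ :=
  lpNormENN p fun x =>
    lqSum q fun j => (2 : ℝ≥0∞) ^ ((j : ℝ) * s) * (‖mOp (φ j) f x‖₊ : ℝ≥0∞)

variable {n : ℕ} {E : Type*} [NormedAddCommGroup E] [NormedSpace ℂ E]

/-- `‖(Ψf̂)ˇ|L_p(E)‖ + (∫₀¹ t^{-sq}‖(ψ(t·)f̂)ˇ|L_p(E)‖^q dt/t)^{1/q}`. -/
def besovContNormI (s : ℝ) (p q : ℝ≥0∞) (Ψ ψ : Sch n) (f : TDist n E) : ℝ≥0∞ :=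
  eLpNorm (mOp Ψ f) p volume +
    (if q = ∞ then
      essSup (fun t : ℝ => ENNReal.ofReal (t ^ (-s)) * eLpNorm (mOp (dilate ψ t) f) p volume)
        (volume.restrict (Ioc (0 : ℝ) 1))
    else
      (∫⁻ t in Ioc (0 : ℝ) 1,
        (ENNReal.ofReal (t ^ (-s)) * eLpNorm (mOp (dilate ψ t) f) p volume) ^ q.toReal *
          ENNReal.ofReal t⁻¹) ^ (1 / q.toReal))

/-- `x ↦ sup_{|x-y| ≤ d} ‖g(y)‖`. -/
def supBall (d : ℝ) (g : Rn n → E) : Rn n → ℝ≥0∞ :=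
  fun x => ⨆ (y : Rn n) (_ : dist x y ≤ d), (‖g y‖₊ : ℝ≥0∞)

/-- `x ↦ sup_{|x-y| ≤ dt, t ≤ τ ≤ 2t} ‖(ψ(τ·)f̂)ˇ(y)‖`. -/
def supLocal (d : ℝ) (ψ : Sch n) (f : TDist n E) (t : ℝ) : Rn n → ℝ≥0∞ :=
  fun x => ⨆ (y : Rn n) (_ : dist x y ≤ d * t) (τ : ℝ) (_ : τ ∈ Icc t (2 * t)),
    (‖mOp (dilate ψ τ) f y‖₊ : ℝ≥0∞)

/-- `‖sup_{|·-y|≤d}‖(Ψf̂)ˇ(y)‖|L_p‖ + (∫₀¹ t^{-sq}‖sup‖(ψ(τ·)f̂)ˇ‖|L_p‖^q dt/t)^{1/q}`. -/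
def besovContNormSup (s : ℝ) (p q : ℝ≥0∞) (d : ℝ) (Ψ ψ : Sch n) (f : TDist n E) : ℝ≥0∞ :=
  lpNormENN p (supBall d (mOp Ψ f)) +
    (if q = ∞ then
      essSup (fun t : ℝ => ENNReal.ofReal (t ^ (-s)) * lpNormENN p (supLocal d ψ f t))
        (volume.restrict (Ioc (0 : ℝ) 1))
    else
      (∫⁻ t in Ioc (0 : ℝ) 1,
        (ENNReal.ofReal (t ^ (-s)) * lpNormENN p (supLocal d ψ f t)) ^ q.toReal *
          ENNReal.ofReal t⁻¹) ^ (1 / q.toReal))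

/-- `‖(Ψf̂)ˇ|L_p(E)‖ + ‖(∫₀¹ t^{-sq}‖(ψ(t·)f̂)ˇ(·)‖^q dt/t)^{1/q}|L_p‖`. -/
def triebelContNormI (s : ℝ) (p q : ℝ≥0∞) (Ψ ψ : Sch n) (f : TDist n E) : ℝ≥0∞ :=
  eLpNorm (mOp Ψ f) p volume +
    lpNormENN p fun x =>
      if q = ∞ then
        essSup (fun t : ℝ =>
            ENNReal.ofReal (t ^ (-s)) * (‖mOp (dilate ψ t) f x‖₊ : ℝ≥0∞))
          (volume.restrict (Ioc (0 : ℝ) 1))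
      else
        (∫⁻ t in Ioc (0 : ℝ) 1,
          (ENNReal.ofReal (t ^ (-s)) * (‖mOp (dilate ψ t) f x‖₊ : ℝ≥0∞)) ^ q.toReal *
            ENNReal.ofReal t⁻¹) ^ (1 / q.toReal)

/-- `‖sup_{|·-y|≤d}‖(Ψf̂)ˇ(y)‖|L_p‖ + ‖(∫₀¹ t^{-sq} sup‖(ψ(τ·)f̂)ˇ(y)‖^q dt/t)^{1/q}|L_p‖`. -/
def triebelContNormSup (s : ℝ) (p q : ℝ≥0∞) (d : ℝ) (Ψ ψ : Sch n) (f : TDist n E) : ℝ≥0∞ :=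
  lpNormENN p (supBall d (mOp Ψ f)) +
    lpNormENN p fun x =>
      if q = ∞ then
        essSup (fun t : ℝ => ENNReal.ofReal (t ^ (-s)) * supLocal d ψ f t x)
          (volume.restrict (Ioc (0 : ℝ) 1))
      else
        (∫⁻ t in Ioc (0 : ℝ) 1,
          (ENNReal.ofReal (t ^ (-s)) * supLocal d ψ f t x) ^ q.toReal *
            ENNReal.ofReal t⁻¹) ^ (1 / q.toReal)

namespace BV
open LineDeriv

/-- basis vector -/
abbrev eb (i : Fin n) : Rn n := EuclideanSpace.single i (1 : ℝ)

/-- Schwartz version of `mderiv` over a list. -/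
def mdL (L : List (Fin n)) (α : Fin n → ℕ) (g : Sch n) : Sch n :=
  L.foldr (fun i h => (lineDerivOp (eb i))^[α i] h) g

lemma pd_coe (i : Fin n) (g : Sch n) : pd i (g : Rn n → ℂ) = (∂_{eb i} g : Sch n) := by
  ext x
  rw [SchwartzMap.lineDerivOp_apply]; rfl

lemma pd_iter_coe (i : Fin n) (k : ℕ) (g : Sch n) :
    (pd i)^[k] (g : Rn n → ℂ) = ((lineDerivOp (eb i))^[k] g : Sch n) := by
  induction k generalizing g with
  | zero => rfl
  | succ k ih => rw [Function.iterate_succ_apply, Function.iterate_succ_apply, pd_coe, ih]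

lemma mderiv_coe_L (L : List (Fin n)) (α : Fin n → ℕ) (g : Sch n) :
    L.foldr (fun i h => (pd i)^[α i] h) (g : Rn n → ℂ) = (mdL L α g : Sch n) := by
  induction L with
  | nil => rfl
  | cons i L ih => simp only [List.foldr_cons, ih, pd_iter_coe, mdL]

lemma mderiv_coe (α : Fin n → ℕ) (g : Sch n) :
    mderiv α (fun y => g y) = (mdL (List.finRange n) α g : Sch n) := mderiv_coe_L _ _ _

lemma iFD_lineDeriv (v : Rn n) (hv : ‖v‖ ≤ 1) (g : Sch n) (l : ℕ) (x : Rn n) :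
    ‖iteratedFDeriv ℝ l (∂_{v} g : Sch n) x‖ ≤ ‖iteratedFDeriv ℝ (l+1) g x‖ := by
  refine ContinuousMultilinearMap.opNorm_le_bound (by positivity) fun m => ?_
  rw [← SchwartzMap.iteratedLineDerivOp_eq_iteratedFDeriv]
  have : (∂^{m} (∂_{v} g) : Sch n) = ∂^{Fin.snoc m v} g := by
    rw [iteratedLineDerivOp_succ_right]; simp
  rw [this, SchwartzMap.iteratedLineDerivOp_eq_iteratedFDeriv]
  refine (ContinuousMultilinearMap.le_opNorm _ _).trans ?_
  gcongr
  rw [Fin.prod_univ_castSucc]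
  simp only [Fin.snoc_castSucc, Fin.snoc_last]
  exact mul_le_of_le_one_right (by positivity) hv

lemma norm_eb (i : Fin n) : ‖eb i‖ ≤ 1 := by simp [eb]

lemma iFD_lineDeriv_iter (i : Fin n) (k : ℕ) (g : Sch n) (l : ℕ) (x : Rn n) :
    ‖iteratedFDeriv ℝ l ((lineDerivOp (eb i))^[k] g : Sch n) x‖ ≤ ‖iteratedFDeriv ℝ (l+k) g x‖ := by
  induction k generalizing l with
  | zero => simp
  | succ k ih =>
    rw [Function.iterate_succ_apply']
    refine (iFD_lineDeriv _ (norm_eb i) _ _ _).trans ((ih _).trans ?_)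
    rw [show l + 1 + k = l + (k+1) by ring]

lemma iFD_mdL (L : List (Fin n)) (α : Fin n → ℕ) (g : Sch n) (l : ℕ) (x : Rn n) :
    ‖iteratedFDeriv ℝ l (mdL L α g : Sch n) x‖ ≤ ‖iteratedFDeriv ℝ (l+(L.map α).sum) g x‖ := by
  induction L generalizing l with
  | nil => exact le_of_eq rfl
  | cons i L ih =>
    have : mdL (i :: L) α g = (lineDerivOp (eb i))^[α i] (mdL L α g) := rfl
    rw [this]
    refine (iFD_lineDeriv_iter _ _ _ _ _).trans ((ih _).trans ?_)
    rw [List.map_cons, List.sum_cons, add_assoc]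

lemma norm_mderiv_le (α : Fin n → ℕ) (g : Sch n) (x : Rn n) :
    ‖mderiv α (fun y => g y) x‖ ≤ ‖iteratedFDeriv ℝ (mdeg α) g x‖ := by
  have := iFD_mdL (List.finRange n) α g 0 x
  rw [norm_iteratedFDeriv_zero, ← mderiv_coe] at this
  have h2 : ((List.finRange n).map α).sum = mdeg α := by
    rw [mdeg, ← List.sum_ofFn, List.ofFn_eq_map]
  rwa [zero_add, h2] at this

lemma lineDeriv_comm' (v w : Rn n) (g : Sch n) : (∂_{v} (∂_{w} g) : Sch n) = ∂_{w} (∂_{v} g) := by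
  ext x
  have h1 : (∂_{v} (∂_{w} g) : Sch n) = ∂^{![v, w]} g := by
    simp [iteratedLineDerivOp_succ_left]
  have h2 : (∂_{w} (∂_{v} g) : Sch n) = ∂^{![w, v]} g := by
    simp [iteratedLineDerivOp_succ_left]
  rw [h1, h2, SchwartzMap.iteratedLineDerivOp_eq_iteratedFDeriv,
    SchwartzMap.iteratedLineDerivOp_eq_iteratedFDeriv]
  have := ((g.smooth 2).contDiffAt (x := x)).isSymmSndFDerivAt (by simp)
  have h3 := this v w
  simpa [iteratedFDeriv_two_apply] using h3

lemma lineDeriv_iter_comm (v w : Rn n) (k : ℕ) (g : Sch n) :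
    (∂_{v} ((lineDerivOp w)^[k] g) : Sch n) = (lineDerivOp w)^[k] (∂_{v} g) := by
  induction k generalizing g with
  | zero => rfl
  | succ k ih => rw [Function.iterate_succ_apply, ih, lineDeriv_comm', ← Function.iterate_succ_apply]

lemma mdL_update_notMem (L : List (Fin n)) (α : Fin n → ℕ) (j : Fin n) (a : ℕ) (hj : j ∉ L) (g : Sch n) :
    mdL L (Function.update α j a) g = mdL L α g := by
  induction L with
  | nil => rfl
  | cons i L ih =>
    simp only [List.mem_cons, not_or] at hj
    have h : ∀ β, mdL (i :: L) β g = (lineDerivOp (eb i))^[β i] (mdL L β g) := fun _ => rfl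
    rw [h, h, ih hj.2, Function.update_of_ne (Ne.symm hj.1)]

lemma lineDeriv_mdL (L : List (Fin n)) (hL : L.Nodup) (α : Fin n → ℕ) (j : Fin n) (hj : j ∈ L)
    (g : Sch n) : (∂_{eb j} (mdL L α g) : Sch n) = mdL L (Function.update α j (α j + 1)) g := by
  induction L with
  | nil => simp at hj
  | cons i L ih =>
    have h : ∀ β, mdL (i :: L) β g = (lineDerivOp (eb i))^[β i] (mdL L β g) := fun _ => rfl
    rw [h, h]
    rw [List.nodup_cons] at hL
    by_cases hij : j = i
    · subst hij
      rw [mdL_update_notMem _ _ _ _ hL.1, Function.update_self, Function.iterate_succ_apply']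
    · have : j ∈ L := by simpa [hij] using hj
      rw [lineDeriv_iter_comm, ih hL.2 this, Function.update_of_ne (Ne.symm hij)]

lemma iterLine_eq_mdL (l : ℕ) (r : Fin l → Fin n) (g : Sch n) :
    ∃ α : Fin n → ℕ, mdeg α = l ∧
      (∂^{fun k => eb (r k)} g : Sch n) = mdL (List.finRange n) α g := by
  induction l with
  | zero =>
    refine ⟨0, by simp [mdeg], ?_⟩
    have : ∀ L : List (Fin n), mdL L 0 g = g := by
      intro L; induction L with
      | nil => rfl
      | cons i L ih => exact ih
    rw [this]; simp
  | succ l ih =>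
    obtain ⟨α, h1, h2⟩ := ih (fun k => r k.succ)
    refine ⟨Function.update α (r 0) (α (r 0) + 1), ?_, ?_⟩
    · have h3 : mdeg (Function.update α (r 0) (α (r 0) + 1)) = mdeg α + 1 := by
        rw [mdeg, mdeg, Finset.sum_update_of_mem (Finset.mem_univ _),
          ← Finset.add_sum_erase _ _ (Finset.mem_univ (r 0)), Finset.sdiff_singleton_eq_erase]
        ring
      rw [h3, h1]
    · rw [← lineDeriv_mdL _ (List.nodup_finRange n) _ _ (List.mem_finRange _), ← h2,
        iteratedLineDerivOp_succ_left]
      rfl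

lemma norm_iFD_le_of_mderiv (g : Sch n) (l : ℕ) (x : Rn n) (M : ℝ)
    (h : ∀ α : Fin n → ℕ, mdeg α = l → ‖mderiv α (fun y => g y) x‖ ≤ M) :
    ‖iteratedFDeriv ℝ l g x‖ ≤ Fintype.card (Fin l → Fin n) * M := by
  have hM : ∀ r : Fin l → Fin n, ‖iteratedFDeriv ℝ l g x (fun k => eb (r k))‖ ≤ M := by
    intro r
    obtain ⟨α, h1, h2⟩ := iterLine_eq_mdL l r g
    rw [← SchwartzMap.iteratedLineDerivOp_eq_iteratedFDeriv, h2, ← mderiv_coe]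
    exact h α h1
  have hc : 0 ≤ Fintype.card (Fin l → Fin n) * M := by
    by_cases hne : Nonempty (Fin l → Fin n)
    · obtain ⟨r⟩ := hne
      have := (norm_nonneg _).trans (hM r)
      positivity
    · rw [not_nonempty_iff] at hne; simp [Fintype.card_eq_zero]
  refine ContinuousMultilinearMap.opNorm_le_bound hc fun m => ?_
  have hm : m = fun k => ∑ i, (m k i) • eb i := by
    funext k
    ext j
    simp [eb, Finset.sum_apply, Pi.single_apply]
  have : iteratedFDeriv ℝ l g x m = ∑ r : Fin l → Fin n, (∏ k, m k (r k)) •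
      iteratedFDeriv ℝ l g x (fun k => eb (r k)) := by
    conv_lhs => rw [hm]
    rw [ContinuousMultilinearMap.map_sum]
    refine Finset.sum_congr rfl fun r _ => ?_
    rw [ContinuousMultilinearMap.map_smul_univ]
  rw [this]
  refine (norm_sum_le _ _).trans ?_
  calc _ ≤ ∑ r : Fin l → Fin n, M * ∏ k, ‖m k‖ := by
        refine Finset.sum_le_sum fun r _ => ?_
        rw [norm_smul, norm_prod, mul_comm]
        have h0 := (norm_nonneg _).trans (hM r)
        gcongr
        · exact hM r
        · exact PiLp.norm_apply_le _ _
    _ = _ := by simp [Finset.card_univ]; ring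

end BV

namespace BV

/-- joint Schwartz seminorm -/
def pN (N : ℕ) (m : Sch n) : ℝ :=
  ((Finset.Iic (N, N)).sup (schwartzSeminormFamily ℂ (Rn n) ℂ)) m

lemma pN_nonneg (N : ℕ) (m : Sch n) : 0 ≤ pN N m := apply_nonneg _ _

lemma le_pN {N k l : ℕ} (hk : k ≤ N) (hl : l ≤ N) (m : Sch n) (x : Rn n) :
    ‖x‖ ^ k * ‖iteratedFDeriv ℝ l m x‖ ≤ pN N m := by
  refine (SchwartzMap.le_seminorm ℂ k l m x).trans ?_
  have : schwartzSeminormFamily ℂ (Rn n) ℂ (k, l) ≤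
      (Finset.Iic (N, N)).sup (schwartzSeminormFamily ℂ (Rn n) ℂ) :=
    Finset.le_sup (f := schwartzSeminormFamily ℂ (Rn n) ℂ) (by simp [hk, hl])
  exact this m

lemma le_pN0 {N l : ℕ} (hl : l ≤ N) (m : Sch n) (x : Rn n) :
    ‖iteratedFDeriv ℝ l m x‖ ≤ pN N m := by
  simpa using le_pN (Nat.zero_le N) hl m x

lemma le_pN' {N k l : ℕ} (hk : k ≤ N) (hl : l ≤ N) (m : Sch n) (x : Rn n) :
    (1 + ‖x‖) ^ k * ‖iteratedFDeriv ℝ l m x‖ ≤ 2 ^ N * pN N m :=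
  SchwartzMap.one_add_le_sup_seminorm_apply (𝕜 := ℂ) (m := (N, N)) hk hl m x

lemma pN_le {N : ℕ} {m : Sch n} {C : ℝ} (hC : 0 ≤ C)
    (h : ∀ k ≤ N, ∀ l ≤ N, ∀ x, ‖x‖ ^ k * ‖iteratedFDeriv ℝ l m x‖ ≤ C) : pN N m ≤ C := by
  refine Seminorm.finset_sup_apply_le hC fun i hi => ?_
  simp only [Finset.mem_Iic, Prod.le_def] at hi
  exact SchwartzMap.seminorm_le_bound ℂ _ _ _ hC (h i.1 hi.1 i.2 hi.2)

lemma pN_mono {N N' : ℕ} (h : N ≤ N') (m : Sch n) : pN N m ≤ pN N' m :=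
  pN_le (pN_nonneg _ _) fun _ hk _ hl x => le_pN (hk.trans h) (hl.trans h) m x

lemma pN_clm (T : Sch n →L[ℂ] Sch n) (N : ℕ) :
    ∃ C N', 0 ≤ C ∧ ∀ m, pN N (T m) ≤ C * pN N' m := by
  have hcont : Continuous (((Finset.Iic (N, N)).sup (schwartzSeminormFamily ℂ (Rn n) ℂ)).comp
      (T : Sch n →ₗ[ℂ] Sch n)) := by
    have h1 := Seminorm.continuous_finsetSup (s := Finset.Iic (N, N)) (p := schwartzSeminormFamily ℂ (Rn n) ℂ)
      (fun i _ => (schwartz_withSeminorms ℂ (Rn n) ℂ).continuous_seminorm i)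
    exact h1.comp T.continuous
  obtain ⟨s, C, -, h⟩ := Seminorm.bound_of_continuous (schwartz_withSeminorms ℂ (Rn n) ℂ) _ hcont
  refine ⟨C, s.sup (fun i => max i.1 i.2), C.2, fun m => ?_⟩
  refine (h m).trans ?_
  change (C : ℝ) * _ ≤ _
  gcongr
  refine Seminorm.finset_sup_apply_le (pN_nonneg _ _) fun i hi => ?_
  have : max i.1 i.2 ≤ s.sup (fun i => max i.1 i.2) := Finset.le_sup (f := fun i : ℕ × ℕ => max i.1 i.2) hi
  exact SchwartzMap.seminorm_le_bound ℂ _ _ _ (pN_nonneg _ _) fun x =>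
    le_pN ((le_max_left _ _).trans this) ((le_max_right _ _).trans this) m x

lemma pN_invFourier (N : ℕ) :
    ∃ C N', 0 ≤ C ∧ ∀ m : Sch n, pN N (invFourierS m) ≤ C * pN N' m :=
  pN_clm ((FourierTransform.fourierCLE ℂ (Sch n)).symm : Sch n →L[ℂ] Sch n) N

/-- product of Schwartz functions -/
def mS (a b : Sch n) : Sch n := SchwartzMap.pairing (ContinuousLinearMap.mul ℂ ℂ) a b

@[simp] lemma mS_apply (a b : Sch n) (x : Rn n) : mS a b x = a x * b x := by
  simp [mS, SchwartzMap.pairing_apply_apply]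

lemma mS_coe (a b : Sch n) : (mS a b : Rn n → ℂ) = fun x => a x * b x := by
  ext x; simp

lemma iFD_mS {a b : Sch n} {x : Rn n} {l : ℕ} {w A B : ℝ} (hA : 0 ≤ A)
    (ha : ∀ i ≤ l, w * ‖iteratedFDeriv ℝ i a x‖ ≤ A) (hb : ∀ i ≤ l, ‖iteratedFDeriv ℝ i b x‖ ≤ B)
    (hw : 0 ≤ w) : w * ‖iteratedFDeriv ℝ l (mS a b) x‖ ≤ 2 ^ l * (A * B) := by
  rw [mS_coe]
  calc _ ≤ w * ∑ i ∈ Finset.range (l + 1), (l.choose i : ℝ) * ‖iteratedFDeriv ℝ i a x‖ *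
        ‖iteratedFDeriv ℝ (l - i) b x‖ := by
        gcongr
        exact norm_iteratedFDeriv_mul_le (N := l) (a.smooth l) (b.smooth l) x le_rfl
    _ ≤ ∑ i ∈ Finset.range (l + 1), (l.choose i : ℝ) * (A * B) := by
        rw [Finset.mul_sum]
        refine Finset.sum_le_sum fun i hi => ?_
        have h1 := ha i (by simp at hi; omega)
        have h2 := hb (l - i) (by omega)
        calc _ = (l.choose i : ℝ) * ((w * ‖iteratedFDeriv ℝ i a x‖) *
              ‖iteratedFDeriv ℝ (l - i) b x‖) := by ring
          _ ≤ _ := by gcongr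
    _ = _ := by
        rw [← Finset.sum_mul]
        congr 1
        exact_mod_cast Nat.sum_range_choose l

lemma pN_mS (N : ℕ) (a b : Sch n) : pN N (mS a b) ≤ 2 ^ N * (pN N a * pN N b) := by
  have h1 := pN_nonneg N a
  have h2 := pN_nonneg N b
  refine pN_le (by positivity) fun k hk l hl x => ?_
  refine (iFD_mS (A := pN N a) (B := pN N b) h1 (fun i hi => le_pN hk (hi.trans hl) a x)
    (fun i hi => le_pN0 (hi.trans hl) b x) (by positivity)).trans ?_
  gcongr; norm_num

@[simp] lemma dilate_apply (ψ : Sch n) {t : ℝ} (ht : t ≠ 0) (x : Rn n) : dilate ψ t x = ψ (t • x) := by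
  rw [dilate, dif_neg ht]; rfl

lemma dilate_coe (ψ : Sch n) {t : ℝ} (ht : t ≠ 0) : (dilate ψ t : Rn n → ℂ) = fun x => ψ (t • x) := by
  ext x; simp [ht]

lemma iFD_dilate (ψ : Sch n) {t : ℝ} (ht : t ≠ 0) (l : ℕ) (x : Rn n) :
    iteratedFDeriv ℝ l (dilate ψ t) x = t ^ l • iteratedFDeriv ℝ l ψ (t • x) := by
  rw [dilate_coe ψ ht, iteratedFDeriv_comp_const_smul _ (ψ.smooth l)]

lemma norm_iFD_dilate (ψ : Sch n) {t : ℝ} (ht : 0 < t) (l : ℕ) (x : Rn n) :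
    ‖iteratedFDeriv ℝ l (dilate ψ t) x‖ = t ^ l * ‖iteratedFDeriv ℝ l ψ (t • x)‖ := by
  rw [iFD_dilate ψ ht.ne', norm_smul, norm_pow, Real.norm_of_nonneg ht.le]

lemma dilate_dilate (ψ : Sch n) {s t : ℝ} (hs : s ≠ 0) (ht : t ≠ 0) :
    dilate (dilate ψ s) t = dilate ψ (s * t) := by
  ext x; simp [hs, ht, smul_smul]

lemma dilate_one (ψ : Sch n) : dilate ψ 1 = ψ := by ext x; simp

lemma dilate_mS (a b : Sch n) {t : ℝ} (ht : t ≠ 0) :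
    dilate (mS a b) t = mS (dilate a t) (dilate b t) := by ext x; simp [ht]

/-- dilation bound, with `K` bounding `t` and `1/t` -/
lemma pN_dilate (N : ℕ) (b : Sch n) {t K : ℝ} (ht : 0 < t) (hK : 1 ≤ K) (h1 : t ≤ K) (h2 : t⁻¹ ≤ K) :
    pN N (dilate b t) ≤ K ^ (2 * N) * pN N b := by
  have h0 := pN_nonneg N b
  refine pN_le (by positivity) fun k hk l hl x => ?_
  rw [norm_iFD_dilate b ht]
  have e : ‖x‖ = t⁻¹ * ‖t • x‖ := by
    rw [norm_smul, Real.norm_of_nonneg ht.le]; field_simp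
  calc _ = (t⁻¹) ^ k * t ^ l * (‖t • x‖ ^ k * ‖iteratedFDeriv ℝ l b (t • x)‖) := by
        rw [e, mul_pow]; ring
    _ ≤ K ^ N * K ^ N * pN N b := by
        have : (t⁻¹) ^ k ≤ K ^ N := (pow_le_pow_left₀ (by positivity) h2 k).trans (pow_le_pow_right₀ hK hk)
        have : t ^ l ≤ K ^ N := (pow_le_pow_left₀ ht.le h1 l).trans (pow_le_pow_right₀ hK hl)
        gcongr
        exact le_pN hk hl _ _
    _ = _ := by ring

lemma iFD_zero_of_eventually {b : Sch n} {x : Rn n} (h : ∀ᶠ y in 𝓝 x, b y = 0) (l : ℕ) :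
    iteratedFDeriv ℝ l b x = 0 := by
  have : (b : Rn n → ℂ) =ᶠ[𝓝 x] fun _ => (0 : ℂ) := h
  rw [(this.iteratedFDeriv ℝ l).eq_of_nhds]
  simp

/-- D': fast decay -/
lemma pN_decay (N B : ℕ) {r : ℝ} (hr : 0 < r) : ∃ C, 0 ≤ C ∧ ∀ (m b : Sch n) (μ : ℝ), 1 ≤ μ →
    (∀ x, ‖x‖ < r → b x = 0) →
    pN N (mS (dilate m μ) b) ≤ C * (μ ^ B)⁻¹ * (pN (N + B) m * pN N b) := by
  refine ⟨2 ^ N * (2 ^ (N + B) * (r ^ (N + B))⁻¹), by positivity, fun m b μ hμ hb => ?_⟩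
  have hm := pN_nonneg (N + B) m
  have hb0 := pN_nonneg N b
  have hμ0 : 0 < μ := by linarith
  refine pN_le (by positivity) fun k hk l hl x => ?_
  by_cases hx : ‖x‖ < r
  · have : ∀ᶠ y in 𝓝 x, mS (dilate m μ) b y = 0 := by
      have : ∀ᶠ y in 𝓝 x, ‖y‖ < r := (isOpen_lt continuous_norm continuous_const).mem_nhds hx
      filter_upwards [this] with y hy
      rw [mS_apply, hb y hy, mul_zero]
    rw [iFD_zero_of_eventually this]
    simp; positivity
  push Not at hx
  have hcomm : mS (dilate m μ) b = mS b (dilate m μ) := by ext y; simp [mul_comm]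
  rw [hcomm]
  have key : ∀ i ≤ l, ‖iteratedFDeriv ℝ i (dilate m μ) x‖ ≤
      2 ^ (N + B) * (r ^ (N + B))⁻¹ * (μ ^ B)⁻¹ * pN (N + B) m := by
    intro i hi
    rw [norm_iFD_dilate m hμ0]
    have h3 := le_pN' (N := N + B) le_rfl (show i ≤ N + B by omega) m (μ • x)
    have h4 : (μ * r) ^ (N + B) ≤ (1 + ‖μ • x‖) ^ (N + B) := by
      gcongr
      rw [norm_smul, Real.norm_of_nonneg hμ0.le]
      nlinarith
    have h5 : (μ * r) ^ (N + B) * ‖iteratedFDeriv ℝ i m (μ • x)‖ ≤ 2 ^ (N + B) * pN (N + B) m :=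
      (mul_le_mul_of_nonneg_right h4 (norm_nonneg _)).trans h3
    have h6 : μ ^ i ≤ μ ^ N := pow_le_pow_right₀ hμ (hi.trans hl)
    calc _ ≤ μ ^ N * ‖iteratedFDeriv ℝ i m (μ • x)‖ := by gcongr
      _ = (r ^ (N + B))⁻¹ * (μ ^ B)⁻¹ * ((μ * r) ^ (N + B) * ‖iteratedFDeriv ℝ i m (μ • x)‖) := by
          field_simp; ring
      _ ≤ (r ^ (N + B))⁻¹ * (μ ^ B)⁻¹ * (2 ^ (N + B) * pN (N + B) m) := by gcongr
      _ = _ := by ring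
  refine (iFD_mS (A := pN N b) hb0 (fun i hi => le_pN hk (hi.trans hl) b x) key
    (by positivity)).trans ?_
  calc _ ≤ 2 ^ N * (pN N b * (2 ^ (N + B) * (r ^ (N + B))⁻¹ * (μ ^ B)⁻¹ * pN (N + B) m)) := by
        gcongr; norm_num
    _ = _ := by ring

/-- mean value bound for iterated derivatives -/
lemma iFD_mvt (ψ : Sch n) (l : ℕ) (x y : Rn n) (M : ℝ)
    (h : ∀ z ∈ segment ℝ x y, ‖iteratedFDeriv ℝ (l + 1) ψ z‖ ≤ M) :
    ‖iteratedFDeriv ℝ l ψ y - iteratedFDeriv ℝ l ψ x‖ ≤ M * ‖y - x‖ := by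
  refine Convex.norm_image_sub_le_of_norm_fderiv_le (𝕜 := ℝ) (s := segment ℝ x y) (fun z _ => ?_)
    (fun z hz => ?_) (convex_segment _ _) (left_mem_segment _ _ _) (right_mem_segment _ _ _)
  · exact ((ψ.smooth (l + 1)).differentiable_iteratedFDeriv (by exact_mod_cast Nat.lt_succ_self l)) z
  · rw [norm_fderiv_iteratedFDeriv]; exact h z hz

lemma taylor (ψ : Sch n) (S : ℕ) (h : ∀ k < S, iteratedFDeriv ℝ k ψ 0 = 0) (j : ℕ) (hj : j ≤ S) :
    ∃ C, 0 ≤ C ∧ ∀ x, ‖iteratedFDeriv ℝ (S - j) ψ x‖ ≤ C * ‖x‖ ^ j := by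
  induction j with
  | zero => exact ⟨pN S ψ, pN_nonneg _ _, fun x => by simpa using le_pN0 le_rfl ψ x⟩
  | succ j ih =>
    obtain ⟨C, hC, hb⟩ := ih (by omega)
    refine ⟨C, hC, fun x => ?_⟩
    have e : S - j = S - (j + 1) + 1 := by omega
    rw [e] at hb
    have := iFD_mvt ψ (S - (j + 1)) 0 x (C * ‖x‖ ^ j) (fun z hz => (hb z).trans ?_)
    · rw [h _ (by omega), sub_zero, sub_zero] at this
      rw [pow_succ, ← mul_assoc]; exact this
    · have hz' : ‖z‖ ≤ ‖x‖ := by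
        have h2 : segment ℝ 0 x ⊆ closedBall (0 : Rn n) ‖x‖ :=
          (convex_closedBall _ _).segment_subset (by simp) (by simp)
        simpa using h2 hz
      gcongr

/-- D2: small dilations of a function with vanishing moments -/
lemma pN_moment (ψ : Sch n) (S : ℕ) (h : ∀ k < S, iteratedFDeriv ℝ k ψ 0 = 0) (N : ℕ) (R : ℝ) (hR : 0 ≤ R) :
    ∃ C, 0 ≤ C ∧ ∀ (b : Sch n) (μ : ℝ), 0 < μ → μ ≤ 2 →
    (∀ x, R < ‖x‖ → b x = 0) →
    pN N (mS (dilate ψ μ) b) ≤ C * μ ^ S * pN N b := by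
  have h1 : ∀ i, ∃ C, 0 ≤ C ∧ ∀ (μ : ℝ), 0 < μ → μ ≤ 2 → ∀ x, ‖x‖ ≤ R →
      ‖iteratedFDeriv ℝ i (dilate ψ μ) x‖ ≤ C * μ ^ S := by
    intro i
    by_cases hi : i < S
    · obtain ⟨C, hC, hb⟩ := taylor ψ S h (S - i) (by omega)
      refine ⟨C * R ^ (S - i), by positivity, fun μ hμ hμ2 x hx => ?_⟩
      rw [norm_iFD_dilate ψ hμ]
      have := hb (μ • x)
      rw [show S - (S - i) = i by omega, norm_smul, Real.norm_of_nonneg hμ.le] at this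
      calc _ ≤ μ ^ i * (C * (μ * ‖x‖) ^ (S - i)) := by gcongr
        _ ≤ μ ^ i * (C * (μ * R) ^ (S - i)) := by gcongr
        _ = C * R ^ (S - i) * (μ ^ i * μ ^ (S - i)) := by ring
        _ = _ := by rw [← pow_add]; congr 2; omega
    · refine ⟨2 ^ (i - S) * pN i ψ, by have := pN_nonneg i ψ; positivity, fun μ hμ hμ2 x hx => ?_⟩
      rw [norm_iFD_dilate ψ hμ]
      have e : μ ^ i = μ ^ (i - S) * μ ^ S := by rw [← pow_add]; congr 1; omega
      have h5 : ‖iteratedFDeriv ℝ i ψ (μ • x)‖ ≤ pN i ψ := le_pN0 le_rfl ψ _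
      rw [e]
      have := pN_nonneg i ψ
      calc _ ≤ 2 ^ (i - S) * μ ^ S * pN i ψ := by gcongr
        _ = _ := by ring
  choose C hC hb using h1
  refine ⟨2 ^ N * ∑ i ∈ Finset.range (N + 1), C i, by
    have := Finset.sum_nonneg (fun i (_ : i ∈ Finset.range (N + 1)) => hC i); positivity,
    fun b μ hμ hμ2 hbR => ?_⟩
  have hs := Finset.sum_nonneg (fun i (_ : i ∈ Finset.range (N + 1)) => hC i)
  have hb0 := pN_nonneg N b
  refine pN_le (by positivity) fun k hk l hl x => ?_
  by_cases hx : R < ‖x‖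
  · have : ∀ᶠ y in 𝓝 x, mS (dilate ψ μ) b y = 0 := by
      have : ∀ᶠ y in 𝓝 x, R < ‖y‖ := (isOpen_lt continuous_const continuous_norm).mem_nhds hx
      filter_upwards [this] with y hy
      rw [mS_apply, hbR y hy, mul_zero]
    rw [iFD_zero_of_eventually this]
    simp; positivity
  push Not at hx
  have hcomm : mS (dilate ψ μ) b = mS b (dilate ψ μ) := by ext y; simp [mul_comm]
  rw [hcomm]
  refine (iFD_mS (A := pN N b) (B := (∑ i ∈ Finset.range (N + 1), C i) * μ ^ S) hb0
    (fun i hi => le_pN hk (hi.trans hl) b x) (fun i hi => (hb i μ hμ hμ2 x hx).trans ?_)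
    (by positivity)).trans ?_
  · gcongr
    exact Finset.single_le_sum (fun i _ => hC i) (by simp; omega)
  · calc _ ≤ 2 ^ N * (pN N b * ((∑ i ∈ Finset.range (N + 1), C i) * μ ^ S)) := by
          gcongr; norm_num
      _ = _ := by ring

end BV

namespace BV

lemma sr_apply (ψ : Sch n) (x y : Rn n) : shiftReflect ψ x y = ψ (x - y) := rfl

lemma sr_coe (ψ : Sch n) (x : Rn n) :
    (shiftReflect ψ x : Rn n → ℂ) = fun y => dilate ψ (-1) (y - x) := by
  ext y; simp [sr_apply]

lemma iFD_sr (ψ : Sch n) (x y : Rn n) (l : ℕ) :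
    iteratedFDeriv ℝ l (shiftReflect ψ x) y = iteratedFDeriv ℝ l (dilate ψ (-1)) (y - x) := by
  rw [sr_coe, iteratedFDeriv_comp_sub]

lemma pN_reflect (N : ℕ) (ψ : Sch n) : pN N (dilate ψ (-1)) ≤ pN N ψ := by
  refine pN_le (pN_nonneg _ _) fun k hk l hl x => ?_
  rw [iFD_dilate ψ (by norm_num), norm_smul]
  have := le_pN hk hl ψ ((-1 : ℝ) • x)
  simpa using this

lemma one_add_norm_le (x y : Rn n) : 1 + ‖y‖ ≤ (1 + ‖x‖) * (1 + ‖y - x‖) := by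
  have : ‖y‖ ≤ ‖x‖ + ‖y - x‖ := by
    calc ‖y‖ = ‖x + (y - x)‖ := by congr 1; abel
      _ ≤ _ := norm_add_le _ _
  nlinarith [norm_nonneg x, norm_nonneg (y - x), mul_nonneg (norm_nonneg x) (norm_nonneg (y - x))]

lemma pN_sr (N : ℕ) (ψ : Sch n) (x : Rn n) :
    pN N (shiftReflect ψ x) ≤ 2 ^ N * (1 + ‖x‖) ^ N * pN N ψ := by
  have h0 := pN_nonneg N ψ
  refine pN_le (by positivity) fun k hk l hl y => ?_
  rw [iFD_sr]
  have h1 : ‖y‖ ^ k ≤ (1 + ‖x‖) ^ N * (1 + ‖y - x‖) ^ k := by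
    calc ‖y‖ ^ k ≤ ((1 + ‖x‖) * (1 + ‖y - x‖)) ^ k := by
          gcongr; linarith [one_add_norm_le x y]
      _ = (1 + ‖x‖) ^ k * (1 + ‖y - x‖) ^ k := mul_pow _ _ _
      _ ≤ _ := by gcongr; linarith [norm_nonneg x]
  have h2 := (le_pN' hk hl (dilate ψ (-1)) (y - x)).trans
    (mul_le_mul_of_nonneg_left (pN_reflect N ψ) (by positivity))
  calc _ ≤ (1 + ‖x‖) ^ N * (1 + ‖y - x‖) ^ k * ‖iteratedFDeriv ℝ l (dilate ψ (-1)) (y - x)‖ := by gcongr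
    _ = (1 + ‖x‖) ^ N * ((1 + ‖y - x‖) ^ k * ‖iteratedFDeriv ℝ l (dilate ψ (-1)) (y - x)‖) := by ring
    _ ≤ (1 + ‖x‖) ^ N * (2 ^ N * pN N ψ) := by gcongr
    _ = _ := by ring

lemma mv_w (ψ : Sch n) {N k l : ℕ} (hk : k ≤ N + 1) (hl : l ≤ N) (x y : Rn n) (w c : ℝ) (hw : 0 ≤ w)
    (hc : 0 ≤ c) (h : ∀ z ∈ segment ℝ x y, w ≤ c * (1 + ‖z‖) ^ k) :
    w * ‖iteratedFDeriv ℝ l ψ y - iteratedFDeriv ℝ l ψ x‖ ≤ c * (2 ^ (N + 1) * pN (N + 1) ψ) * ‖y - x‖ := by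
  have h0 := pN_nonneg (N + 1) ψ
  rcases hw.eq_or_lt with rfl | hw
  · simp; positivity
  have := iFD_mvt ψ l x y (c * (2 ^ (N + 1) * pN (N + 1) ψ) / w) (fun z hz => ?_)
  · calc _ ≤ w * (c * (2 ^ (N + 1) * pN (N + 1) ψ) / w * ‖y - x‖) := by gcongr
      _ = _ := by field_simp
  · rw [le_div_iff₀ hw]
    calc _ ≤ ‖iteratedFDeriv ℝ (l + 1) ψ z‖ * (c * (1 + ‖z‖) ^ k) := by gcongr; exact h z hz
      _ = c * ((1 + ‖z‖) ^ k * ‖iteratedFDeriv ℝ (l + 1) ψ z‖) := by ring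
      _ ≤ _ := mul_le_mul_of_nonneg_left (le_pN' hk (by omega) ψ z) hc

lemma pN_sr_sub (N : ℕ) (ψ : Sch n) (x x' : Rn n) (h : ‖x' - x‖ ≤ 1) :
    pN N (shiftReflect ψ x' - shiftReflect ψ x) ≤
      (2 * (1 + ‖x‖)) ^ N * (2 ^ (N + 1) * pN (N + 1) (dilate ψ (-1))) * ‖x' - x‖ := by
  have h0 := pN_nonneg (N + 1) (dilate ψ (-1))
  refine pN_le (by positivity) fun k hk l hl y => ?_
  have e : iteratedFDeriv ℝ l (shiftReflect ψ x' - shiftReflect ψ x : Sch n) y =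
      iteratedFDeriv ℝ l (dilate ψ (-1)) (y - x') - iteratedFDeriv ℝ l (dilate ψ (-1)) (y - x) := by
    rw [← iFD_sr, ← iFD_sr]
    exact iteratedFDeriv_sub_apply ((shiftReflect ψ x').smooth l).contDiffAt ((shiftReflect ψ x).smooth l).contDiffAt
  rw [e]
  have := mv_w (dilate ψ (-1)) (N := N) (k := k) (l := l) (by omega) hl (y - x) (y - x') (‖y‖ ^ k)
    ((2 * (1 + ‖x‖)) ^ N) (by positivity) (by positivity) (fun z hz => ?_)
  · refine this.trans (le_of_eq ?_)
    rw [show y - x' - (y - x) = -(x' - x) by abel, norm_neg]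
  · have hz' : ‖z - (y - x)‖ ≤ 1 := by
      have h2 : segment ℝ (y - x) (y - x') ⊆ closedBall (y - x) 1 := by
        refine (convex_closedBall _ _).segment_subset (by simp) ?_
        rw [mem_closedBall, dist_eq_norm, show y - x' - (y - x) = -(x' - x) by abel, norm_neg]
        exact h
      simpa [dist_eq_norm] using h2 hz
    have h3 : ‖y - x‖ ≤ ‖z‖ + 1 := by
      calc ‖y - x‖ = ‖z - (z - (y - x))‖ := by congr 1; abel
        _ ≤ ‖z‖ + ‖z - (y - x)‖ := norm_sub_le _ _
        _ ≤ _ := by linarith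
    have h4 := one_add_norm_le x y
    calc ‖y‖ ^ k ≤ (2 * (1 + ‖x‖) * (1 + ‖z‖)) ^ k := by
          gcongr
          nlinarith [norm_nonneg x, norm_nonneg z, mul_nonneg (norm_nonneg x) (norm_nonneg z)]
      _ = (2 * (1 + ‖x‖)) ^ k * (1 + ‖z‖) ^ k := mul_pow _ _ _
      _ ≤ _ := by gcongr; linarith [norm_nonneg x]

lemma tendsto_pN_sr (N : ℕ) (ψ : Sch n) (x : Rn n) :
    Tendsto (fun x' => pN N (shiftReflect ψ x' - shiftReflect ψ x)) (𝓝 x) (𝓝 0) := by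
  have h : Tendsto (fun x' => (2 * (1 + ‖x‖)) ^ N * (2 ^ (N + 1) * pN (N + 1) (dilate ψ (-1))) * ‖x' - x‖)
      (𝓝 x) (𝓝 0) := by
    have : Continuous (fun x' => (2 * (1 + ‖x‖)) ^ N * (2 ^ (N + 1) * pN (N + 1) (dilate ψ (-1))) * ‖x' - x‖) := by
      fun_prop
    simpa using this.tendsto x
  refine squeeze_zero' (Eventually.of_forall fun _ => pN_nonneg _ _) ?_ h
  filter_upwards [closedBall_mem_nhds x one_pos] with x' hx'
  exact pN_sr_sub N ψ x x' (by simpa [dist_eq_norm] using hx')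

lemma tendsto_pN_dilate (N : ℕ) (ψ : Sch n) (t : ℝ) (ht : 0 < t) :
    Tendsto (fun t' => pN N (dilate ψ t' - dilate ψ t)) (𝓝 t) (𝓝 0) := by
  set C1 := (2 / t) ^ N + 1 + (2 / t) ^ (N + 1) with hC1
  have hp := pN_nonneg N ψ
  have hp1 := pN_nonneg (N + 1) ψ
  have hbd : ∀ t' ∈ Ioo (t / 2) (2 * t), pN N (dilate ψ t' - dilate ψ t) ≤
      (∑ l ∈ Finset.range (N + 1), |t' ^ l - t ^ l|) * ((2 / t + 1) ^ N * pN N ψ) +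
      (1 + t) ^ N * ((2 / t + 1) ^ (N + 1) * (2 ^ (N + 1) * pN (N + 1) ψ) * |t' - t|) := by
    intro t' ht'
    have ht'0 : 0 < t' := by have := ht'.1; linarith
    have hsum : 0 ≤ ∑ l ∈ Finset.range (N + 1), |t' ^ l - t ^ l| := Finset.sum_nonneg fun _ _ => abs_nonneg _
    refine pN_le (by positivity) fun k hk l hl x => ?_
    have e : iteratedFDeriv ℝ l (dilate ψ t' - dilate ψ t : Sch n) x =
        (t' ^ l - t ^ l) • iteratedFDeriv ℝ l ψ (t' • x) + t ^ l • (iteratedFDeriv ℝ l ψ (t' • x) -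
          iteratedFDeriv ℝ l ψ (t • x)) := by
      have : iteratedFDeriv ℝ l (dilate ψ t' - dilate ψ t : Sch n) x =
          iteratedFDeriv ℝ l (dilate ψ t') x - iteratedFDeriv ℝ l (dilate ψ t) x :=
        iteratedFDeriv_sub_apply ((dilate ψ t').smooth l).contDiffAt ((dilate ψ t).smooth l).contDiffAt
      rw [this, iFD_dilate ψ ht'0.ne', iFD_dilate ψ ht.ne', sub_smul, smul_sub]
      abel
    have hxz : ∀ s, t / 2 ≤ s → ‖x‖ ≤ 2 / t * ‖s • x‖ := by
      intro s hs
      rw [norm_smul, Real.norm_of_nonneg (by linarith)]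
      calc ‖x‖ = 2 / t * (t / 2 * ‖x‖) := by field_simp
        _ ≤ _ := by gcongr
    have hK : 1 ≤ 2 / t + 1 := by have : 0 < 2 / t := by positivity
                                  linarith
    have hT : t ^ l ≤ (1 + t) ^ N :=
      (pow_le_pow_left₀ ht.le (by linarith) l).trans (pow_le_pow_right₀ (by linarith) hl)
    have hpow : ∀ s j, t / 2 ≤ s → ∀ M, j ≤ M → ‖x‖ ^ j ≤ (2 / t + 1) ^ M * ‖s • x‖ ^ j := by
      intro s j hs M hj
      calc ‖x‖ ^ j ≤ (2 / t * ‖s • x‖) ^ j := by gcongr; exact hxz s hs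
        _ = (2 / t) ^ j * ‖s • x‖ ^ j := mul_pow _ _ _
        _ ≤ _ := by
          gcongr
          exact (pow_le_pow_left₀ (by positivity) (by linarith) j).trans (pow_le_pow_right₀ hK hj)
    rw [e]
    have hA : ‖x‖ ^ k * ‖iteratedFDeriv ℝ l ψ (t' • x)‖ ≤ (2 / t + 1) ^ N * pN N ψ := by
      calc _ ≤ (2 / t + 1) ^ N * ‖t' • x‖ ^ k * ‖iteratedFDeriv ℝ l ψ (t' • x)‖ := by
            gcongr; exact hpow t' k ht'.1.le N hk
        _ = (2 / t + 1) ^ N * (‖t' • x‖ ^ k * ‖iteratedFDeriv ℝ l ψ (t' • x)‖) := by ring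
        _ ≤ _ := by gcongr; exact le_pN hk hl _ _
    have hB : ‖x‖ ^ k * ‖iteratedFDeriv ℝ l ψ (t' • x) - iteratedFDeriv ℝ l ψ (t • x)‖ ≤
        (2 / t + 1) ^ (N + 1) * (2 ^ (N + 1) * pN (N + 1) ψ) * |t' - t| := by
      rcases eq_or_ne x 0 with rfl | hx
      · simp; positivity
      have hx0 : 0 < ‖x‖ := norm_pos_iff.2 hx
      have := mv_w ψ (N := N) (k := k + 1) (l := l) (by omega) hl (t • x) (t' • x) (‖x‖ ^ (k + 1))
        ((2 / t + 1) ^ (N + 1)) (by positivity) (by positivity) (fun z hz => ?_)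
      · rw [← sub_smul, norm_smul, Real.norm_eq_abs, ← mul_assoc, pow_succ] at this
        nlinarith
      · obtain ⟨a, b, ha, hb, hab, rfl⟩ := hz
        rw [smul_smul, smul_smul, ← add_smul]
        refine (hpow (a * t + b * t') (k + 1) ?_ (N + 1) (by omega)).trans ?_
        · have := ht'.1
          nlinarith
        · gcongr; linarith
    calc _ ≤ ‖x‖ ^ k * (|t' ^ l - t ^ l| * ‖iteratedFDeriv ℝ l ψ (t' • x)‖ +
          t ^ l * ‖iteratedFDeriv ℝ l ψ (t' • x) - iteratedFDeriv ℝ l ψ (t • x)‖) := by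
          gcongr
          refine (norm_add_le _ _).trans ?_
          rw [norm_smul, norm_smul, Real.norm_eq_abs, Real.norm_of_nonneg (by positivity : 0 ≤ t ^ l)]
      _ = |t' ^ l - t ^ l| * (‖x‖ ^ k * ‖iteratedFDeriv ℝ l ψ (t' • x)‖) +
          t ^ l * (‖x‖ ^ k * ‖iteratedFDeriv ℝ l ψ (t' • x) - iteratedFDeriv ℝ l ψ (t • x)‖) := by ring
      _ ≤ _ := by
          gcongr
          exact Finset.single_le_sum (f := fun l => |t' ^ l - t ^ l|) (fun _ _ => abs_nonneg _)
            (by simp; omega)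
  refine squeeze_zero' (Eventually.of_forall fun _ => pN_nonneg _ _)
    (Filter.eventually_of_mem (Ioo_mem_nhds (by linarith) (by linarith)) hbd) ?_
  have : Continuous (fun t' : ℝ =>
      (∑ l ∈ Finset.range (N + 1), |t' ^ l - t ^ l|) * ((2 / t + 1) ^ N * pN N ψ) +
      (1 + t) ^ N * ((2 / t + 1) ^ (N + 1) * (2 ^ (N + 1) * pN (N + 1) ψ) * |t' - t|)) := by fun_prop
  simpa using this.tendsto t

lemma schSemi_le (K L : ℕ) : ∃ C, 0 ≤ C ∧ ∀ φ : Sch n, schSemi K L φ ≤ C * pN (K + L) φ := by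
  refine ⟨Fintype.card (Fin n → Fin (L + 1)) * 2 ^ (K + L), by positivity, fun φ => ?_⟩
  refine ciSup_le fun x => ?_
  have hp := pN_nonneg (K + L) φ
  have h1 : (1 + ‖x‖ ^ 2) ^ ((K : ℝ) / 2) ≤ (1 + ‖x‖) ^ K := by
    calc (1 + ‖x‖ ^ 2) ^ ((K : ℝ) / 2) ≤ ((1 + ‖x‖) ^ 2) ^ ((K : ℝ) / 2) := by
          gcongr; nlinarith [norm_nonneg x]
      _ = (1 + ‖x‖) ^ K := by
          rw [← Real.rpow_natCast, ← Real.rpow_mul (by positivity), ← Real.rpow_natCast]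
          congr 1; push_cast; ring
  calc _ ≤ (1 + ‖x‖) ^ K * ∑ α : Fin n → Fin (L + 1), if mdeg (fun i => (α i : ℕ)) ≤ L
      then ‖mderiv (fun i => (α i : ℕ)) (fun y => φ y) x‖ else 0 := by
        gcongr
    _ ≤ ∑ α : Fin n → Fin (L + 1), 2 ^ (K + L) * pN (K + L) φ := by
        rw [Finset.mul_sum]
        refine Finset.sum_le_sum fun α _ => ?_
        split_ifs with h
        · calc _ ≤ (1 + ‖x‖) ^ K * ‖iteratedFDeriv ℝ (mdeg fun i => (α i : ℕ)) φ x‖ := by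
                gcongr; exact norm_mderiv_le _ φ x
            _ ≤ _ := le_pN' (by omega) (by omega) φ x
        · simp; positivity
    _ = _ := by simp [Finset.card_univ]; ring

lemma TDist.bd (f : TDist n E) : ∃ C N, 0 ≤ C ∧ ∀ φ, ‖f.toFun φ‖ ≤ C * pN N φ := by
  obtain ⟨c, K, L, h⟩ := f.bound
  obtain ⟨C, hC, hb⟩ := schSemi_le (n := n) K L
  refine ⟨|c| * C, K + L, by positivity, fun φ => (h φ).trans ?_⟩
  have h0 : 0 ≤ schSemi K L φ := Real.iSup_nonneg fun x => by
    refine mul_nonneg (by positivity) (Finset.sum_nonneg fun _ _ => by split_ifs <;> positivity)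
  calc c * schSemi K L φ ≤ |c| * schSemi K L φ := by gcongr; exact le_abs_self c
    _ ≤ |c| * (C * pN (K + L) φ) := by gcongr; exact hb φ
    _ = _ := by ring

lemma sr_add (a b : Sch n) (x : Rn n) : shiftReflect (a + b) x = shiftReflect a x + shiftReflect b x := by
  ext y; simp [sr_apply]
lemma sr_smul (c : ℂ) (a : Sch n) (x : Rn n) : shiftReflect (c • a) x = c • shiftReflect a x := by
  ext y; simp [sr_apply]
lemma inv_add (a b : Sch n) : invFourierS (a + b) = invFourierS a + invFourierS b := by simp [invFourierS]
lemma inv_smul (c : ℂ) (a : Sch n) : invFourierS (c • a) = c • invFourierS a := by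
  rw [invFourierS, map_smul]; rfl

/-- `mOp` as a linear map in the multiplier -/
def mOpL (f : TDist n E) (x : Rn n) : Sch n →ₗ[ℂ] E where
  toFun m := mOp m f x
  map_add' a b := by simp [mOp, tdConv, inv_add, sr_add]
  map_smul' c a := by simp [mOp, tdConv, inv_smul, sr_smul]; rw [smul_comm]

lemma mOp_sub (f : TDist n E) (x : Rn n) (a b : Sch n) : mOp (a - b) f x = mOp a f x - mOp b f x :=
  map_sub (mOpL f x) a b
lemma mOp_add (f : TDist n E) (x : Rn n) (a b : Sch n) : mOp (a + b) f x = mOp a f x + mOp b f x :=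
  map_add (mOpL f x) a b
lemma mOp_sum (f : TDist n E) (x : Rn n) (s : Finset ℕ) (a : ℕ → Sch n) :
    mOp (∑ i ∈ s, a i) f x = ∑ i ∈ s, mOp (a i) f x :=
  map_sum (mOpL f x) a s

/-- a priori bound -/
lemma mOp_bd (f : TDist n E) : ∃ C N, 0 ≤ C ∧ ∀ m y, ‖mOp m f y‖ ≤ C * (1 + ‖y‖) ^ N * pN N m := by
  obtain ⟨C, N, hC, h⟩ := TDist.bd f
  obtain ⟨C', N', hC', h'⟩ := pN_invFourier (n := n) N
  have hpi : 0 ≤ ((2 * π) ^ (-(n : ℝ) / 2) : ℝ) := by positivity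
  refine ⟨((2 * π) ^ (-(n : ℝ) / 2) : ℝ) * (C * (2 ^ N * C')), max N N', by positivity, fun m y => ?_⟩
  rw [mOp, tdConv, norm_smul, Real.norm_of_nonneg hpi]
  have h0 := pN_nonneg (max N N') m
  calc _ ≤ ((2 * π) ^ (-(n : ℝ) / 2) : ℝ) * (C * (2 ^ N * (1 + ‖y‖) ^ max N N' * (C' * pN (max N N') m))) := by
        gcongr
        refine (h _).trans ?_
        gcongr
        refine (pN_sr _ _ _).trans ?_
        have := pN_nonneg N (invFourierS m)
        gcongr
        · linarith [norm_nonneg y]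
        · exact le_max_left _ _
        · refine (h' m).trans ?_
          gcongr
          exact pN_mono (le_max_right _ _) m
    _ = _ := by ring

lemma mOp_cont (m : Sch n) (f : TDist n E) : Continuous (mOp m f) := by
  obtain ⟨C, N, hC, h⟩ := TDist.bd f
  have : Continuous fun x => f.toFun (shiftReflect (invFourierS m) x) := by
    rw [continuous_iff_continuousAt]
    intro x
    rw [ContinuousAt, tendsto_iff_norm_sub_tendsto_zero]
    have h2 := (tendsto_pN_sr N (invFourierS m) x).const_mul C
    rw [mul_zero] at h2
    refine squeeze_zero (fun _ => norm_nonneg _) (fun x' => ?_) h2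
    rw [← map_sub]; exact h _
  exact this.const_smul _

lemma mOp_tendsto_of_pN (f : TDist n E) (x : Rn n) {ι : Type*} {l : Filter ι} (a : ι → Sch n) (b : Sch n)
    (h : ∀ N, Tendsto (fun i => pN N (a i - b)) l (𝓝 0)) : Tendsto (fun i => mOp (a i) f x) l (𝓝 (mOp b f x)) := by
  obtain ⟨C, N, hC, hb⟩ := mOp_bd f
  rw [tendsto_iff_norm_sub_tendsto_zero]
  have h2 := (h N).const_mul (C * (1 + ‖x‖) ^ N)
  rw [mul_zero] at h2
  refine squeeze_zero (fun _ => norm_nonneg _) (fun i => ?_) h2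
  rw [← mOp_sub]; exact hb _ _

lemma mOp_dilate_tendsto (ψ : Sch n) (f : TDist n E) (x : Rn n) (t : ℝ) (ht : 0 < t) :
    Tendsto (fun t' => mOp (dilate ψ t') f x) (𝓝 t) (𝓝 (mOp (dilate ψ t) f x)) :=
  mOp_tendsto_of_pN f x _ _ fun N => tendsto_pN_dilate N ψ t ht

lemma kernel_scale (m : Sch n) {R : ℝ} (hR : 0 < R) (x : Rn n) :
    invFourierS m x = (R ^ n : ℝ) • invFourierS (dilate m R) (R • x) := by
  have h1 : ∀ (g : Sch n) y, invFourierS g y = 𝓕⁻ (g : Rn n → ℂ) y := fun g y => by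
    rw [← SchwartzMap.fourierInv_coe]; rfl
  rw [h1, h1, Real.fourierInv_eq', Real.fourierInv_eq', dilate_coe m hR.ne']
  have := MeasureTheory.Measure.integral_comp_smul (volume : Measure (Rn n))
    (fun v => Complex.exp (((2 * π * inner ℝ v x : ℝ) : ℂ) * Complex.I) • m v) R
  have e : (fun v : Rn n => Complex.exp (((2 * π * inner ℝ v (R • x) : ℝ) : ℂ) * Complex.I) • m (R • v)) =
      fun v => Complex.exp (((2 * π * inner ℝ (R • v) x : ℝ) : ℂ) * Complex.I) • m (R • v) := by
    funext v; rw [inner_smul_left, inner_smul_right]; simp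
  rw [e, this, smul_smul, finrank_euclideanSpace_fin, abs_of_pos (by positivity),
    mul_inv_cancel₀ (by positivity), one_smul]

lemma kernel_bd (N : ℕ) : ∃ C N', 0 ≤ C ∧ ∀ (m : Sch n) (R : ℝ), 0 < R → ∀ x,
    ‖invFourierS m x‖ ≤ C * R ^ n * ((1 + R * ‖x‖) ^ N)⁻¹ * pN N' (dilate m R) := by
  obtain ⟨C', N', hC', h'⟩ := pN_invFourier (n := n) N
  refine ⟨2 ^ N * C', N', by positivity, fun m R hR x => ?_⟩
  rw [kernel_scale m hR, norm_smul, Real.norm_of_nonneg (by positivity)]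
  have h1 := le_pN' (N := N) le_rfl (Nat.zero_le N) (invFourierS (dilate m R)) (R • x)
  rw [norm_iteratedFDeriv_zero, norm_smul, Real.norm_of_nonneg hR.le] at h1
  have h2 : ‖invFourierS (dilate m R) (R • x)‖ ≤ ((1 + R * ‖x‖) ^ N)⁻¹ * (2 ^ N * (C' * pN N' (dilate m R))) := by
    rw [inv_mul_eq_div, le_div_iff₀ (by positivity), mul_comm]
    refine h1.trans ?_
    gcongr
    exact h' _
  calc _ ≤ R ^ n * (((1 + R * ‖x‖) ^ N)⁻¹ * (2 ^ N * (C' * pN N' (dilate m R)))) := by gcongr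
    _ = _ := by ring

end BV

namespace BV
open LineDeriv

lemma mdL_cons (i : Fin n) (L : List (Fin n)) (α : Fin n → ℕ) (g : Sch n) :
    mdL (i :: L) α g = (lineDerivOp (eb i))^[α i] (mdL L α g) := rfl

lemma iter_clm (v : Rn n) (k : ℕ) : ∃ T : Sch n →L[ℂ] Sch n, ∀ g, T g = (lineDerivOp v)^[k] g := by
  induction k with
  | zero => exact ⟨ContinuousLinearMap.id _ _, fun g => rfl⟩
  | succ k ih =>
    obtain ⟨T, hT⟩ := ih
    refine ⟨(lineDerivOpCLM ℂ (Sch n) v).comp T, fun g => ?_⟩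
    rw [Function.iterate_succ_apply', ← hT]; rfl

lemma mdL_clm (L : List (Fin n)) (α : Fin n → ℕ) : ∃ T : Sch n →L[ℂ] Sch n, ∀ g, T g = mdL L α g := by
  induction L with
  | nil => exact ⟨ContinuousLinearMap.id _ _, fun g => rfl⟩
  | cons i L ih =>
    obtain ⟨T, hT⟩ := ih
    obtain ⟨T', hT'⟩ := iter_clm (eb i) (α i)
    exact ⟨T'.comp T, fun g => by rw [mdL_cons, ← hT, ← hT']; rfl⟩

/-- convolution on Schwartz functions -/
def cS (a b : Sch n) : Sch n := SchwartzMap.convolution (ContinuousLinearMap.mul ℂ ℂ) a b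

lemma cS_apply (a b : Sch n) (x : Rn n) : cS a b x = ∫ w, a w * b (x - w) := by
  rw [cS, SchwartzMap.convolution_apply]; rfl

lemma fourier_cS (a b : Sch n) : 𝓕 (cS a b) = mS (𝓕 a) (𝓕 b) := SchwartzMap.fourier_convolution _ _ _

lemma inv_mS (a b : Sch n) : invFourierS (mS a b) = cS (invFourierS a) (invFourierS b) := by
  have h : ∀ g : Sch n, 𝓕 (invFourierS g) = g := fun g =>
    (FourierTransform.fourierCLE ℂ (Sch n)).apply_symm_apply g
  apply (FourierTransform.fourierCLE ℂ (Sch n)).injective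
  change 𝓕 (invFourierS (mS a b)) = 𝓕 (cS (invFourierS a) (invFourierS b))
  rw [fourier_cS, h, h, h]

lemma lineDeriv_cS (v : Rn n) (a b : Sch n) : (∂_{v} (cS a b) : Sch n) = cS a (∂_{v} b) := by
  apply (FourierTransform.fourierCLE ℂ (Sch n)).injective
  change 𝓕 (∂_{v} (cS a b) : Sch n) = 𝓕 (cS a (∂_{v} b))
  rw [fourier_cS, SchwartzMap.fourier_lineDerivOp_eq, SchwartzMap.fourier_lineDerivOp_eq, fourier_cS]
  have hg : Function.HasTemperateGrowth (fun x : Rn n => inner ℝ x v) := by fun_prop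
  ext x
  simp [SchwartzMap.smulLeftCLM_apply_apply hg]
  ring

lemma mdL_cS (L : List (Fin n)) (α : Fin n → ℕ) (a b : Sch n) : mdL L α (cS a b) = cS a (mdL L α b) := by
  induction L with
  | nil => rfl
  | cons i L ih =>
    rw [mdL_cons, mdL_cons, ih]
    generalize mdL L α b = b'
    induction α i with
    | zero => rfl
    | succ k ih => rw [Function.iterate_succ_apply', Function.iterate_succ_apply', ih, lineDeriv_cS]

lemma lineDeriv_sr (v x : Rn n) (ψ : Sch n) :
    (∂_{v} (shiftReflect ψ x) : Sch n) = (-1 : ℂ) • shiftReflect (∂_{v} ψ) x := by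
  ext y
  rw [SchwartzMap.lineDerivOp_apply_eq_fderiv, SchwartzMap.smul_apply, sr_apply, SchwartzMap.lineDerivOp_apply_eq_fderiv]
  have : (shiftReflect ψ x : Rn n → ℂ) = fun y => ψ (x - y) := rfl
  rw [this]
  have h1 : HasFDerivAt (fun y : Rn n => x - y) (-(ContinuousLinearMap.id ℝ (Rn n))) y :=
    (hasFDerivAt_id y).const_sub x
  have h2 := (ψ.hasFDerivAt (x - y)).comp y h1
  have h3 := h2.fderiv
  rw [show (fun y => ψ (x - y)) = (ψ : Rn n → ℂ) ∘ fun y => x - y from rfl, h3]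
  simp

lemma mdL_sr (L : List (Fin n)) (α : Fin n → ℕ) : ∃ c : ℂ, ∀ (ψ : Sch n) (x : Rn n),
    mdL L α (shiftReflect ψ x) = c • shiftReflect (mdL L α ψ) x := by
  induction L with
  | nil => exact ⟨1, fun ψ x => by simp [mdL]⟩
  | cons i L ih =>
    obtain ⟨c, hc⟩ := ih
    refine ⟨(-1) ^ (α i) * c, fun ψ x => ?_⟩
    rw [mdL_cons, mdL_cons, hc]
    generalize mdL L α ψ = b'
    induction α i with
    | zero => simp
    | succ k ih =>
      rw [Function.iterate_succ_apply', Function.iterate_succ_apply', ih, lineDerivOp_smul, lineDeriv_sr, smul_smul]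
      congr 1; ring

/-- target Banach space -/
abbrev WW (n L : ℕ) := (Fin n → Fin (L + 1)) → BoundedContinuousFunction (Rn n) ℂ

/-- weight -/
def wt (K : ℕ) : Rn n → ℂ := fun x => (((1 + ‖x‖ ^ 2) ^ K : ℝ) : ℂ)

lemma wt_growth (K : ℕ) : Function.HasTemperateGrowth (wt (n := n) K) := by
  have h : Function.HasTemperateGrowth (fun x : Rn n => (1 + ‖x‖ ^ 2 : ℝ) ^ K) := by
    have h1 : Function.HasTemperateGrowth (fun x : Rn n => (1 + ‖x‖ ^ 2 : ℝ)) := by fun_prop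
    fun_prop
  exact (Complex.ofRealCLM.hasTemperateGrowth).comp h

lemma exists_J (K L : ℕ) : ∃ J : Sch n →L[ℂ] WW n L, ∀ φ α y,
    J φ α y = wt K y * mdL (List.finRange n) (fun i => (α i : ℕ)) φ y := by
  choose T hT using fun α : Fin n → Fin (L + 1) => mdL_clm (List.finRange n) (fun i => (α i : ℕ))
  refine ⟨ContinuousLinearMap.pi fun α => (toBoundedContinuousFunctionCLM ℂ (Rn n) ℂ).comp
    ((smulLeftCLM ℂ (wt K)).comp (T α)), fun φ α y => ?_⟩
  simp [SchwartzMap.smulLeftCLM_apply_apply (wt_growth K), hT]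

lemma sr_cont (ψ : Sch n) : Continuous fun x => shiftReflect ψ x := by
  rw [continuous_iff_continuousAt]
  intro x
  rw [ContinuousAt, (schwartz_withSeminorms ℂ (Rn n) ℂ).tendsto_nhds]
  intro i ε hε
  have := (tendsto_pN_sr (max i.1 i.2) ψ x).eventually (gt_mem_nhds hε)
  filter_upwards [this] with x' hx'
  refine lt_of_le_of_lt ?_ hx'
  exact SchwartzMap.seminorm_le_bound ℂ _ _ _ (pN_nonneg _ _) fun x =>
    le_pN (le_max_left _ _) (le_max_right _ _) _ x

lemma clm_bd {W : Type*} [NormedAddCommGroup W] [NormedSpace ℂ W] (T : Sch n →L[ℂ] W) :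
    ∃ C N', 0 ≤ C ∧ ∀ m, ‖T m‖ ≤ C * pN N' m := by
  have hcont : Continuous ((normSeminorm ℂ W).comp (T : Sch n →ₗ[ℂ] W)) := by
    exact continuous_norm.comp T.continuous
  obtain ⟨s, C, -, h⟩ := Seminorm.bound_of_continuous (schwartz_withSeminorms ℂ (Rn n) ℂ) _ hcont
  refine ⟨C, s.sup (fun i => max i.1 i.2), C.2, fun m => ?_⟩
  refine (h m).trans ?_
  change (C : ℝ) * _ ≤ _
  gcongr
  refine Seminorm.finset_sup_apply_le (pN_nonneg _ _) fun i hi => ?_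
  have : max i.1 i.2 ≤ s.sup (fun i => max i.1 i.2) := Finset.le_sup (f := fun i : ℕ × ℕ => max i.1 i.2) hi
  exact SchwartzMap.seminorm_le_bound ℂ _ _ _ (pN_nonneg _ _) fun x =>
    le_pN ((le_max_left _ _).trans this) ((le_max_right _ _).trans this) m x

lemma J_integrable {W : Type*} [NormedAddCommGroup W] [NormedSpace ℂ W] (J : Sch n →L[ℂ] W) (a b : Sch n) (x : Rn n) :
    Integrable fun w => a w • J (shiftReflect b (x - w)) := by
  obtain ⟨C, N, hC, hJ⟩ := clm_bd J
  have hcont : Continuous fun w => a w • J (shiftReflect b (x - w)) :=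
    a.continuous.smul (J.continuous.comp ((sr_cont b).comp (continuous_const.sub continuous_id)))
  have hb0 := pN_nonneg N b
  set D := C * (2 ^ N * (1 + ‖x‖) ^ N * pN N b) with hD
  have hD0 : 0 ≤ D := by positivity
  have hi : Integrable fun w : Rn n => D * (2 ^ (N - 1) * (‖w‖ ^ 0 * ‖a w‖ + ‖w‖ ^ N * ‖a w‖)) :=
    (((integrable_pow_mul volume a 0).add (integrable_pow_mul volume a N)).const_mul _).const_mul _
  refine hi.mono' hcont.aestronglyMeasurable (Eventually.of_forall fun w => ?_)
  rw [norm_smul]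
  have h1 : 1 + ‖x - w‖ ≤ (1 + ‖x‖) * (1 + ‖w‖) := by
    have := norm_sub_le x w
    nlinarith [norm_nonneg x, norm_nonneg w, mul_nonneg (norm_nonneg x) (norm_nonneg w)]
  have h2 : (1 + ‖w‖) ^ N ≤ 2 ^ (N - 1) * (1 + ‖w‖ ^ N) := by
    simpa using add_pow_le (zero_le_one' ℝ) (norm_nonneg w) N
  calc _ ≤ ‖a w‖ * (C * (2 ^ N * ((1 + ‖x‖) * (1 + ‖w‖)) ^ N * pN N b)) := by
        gcongr
        refine (hJ _).trans ?_
        gcongr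
        refine (pN_sr _ _ _).trans ?_
        gcongr
    _ = ‖a w‖ * (D * (1 + ‖w‖) ^ N) := by rw [mul_pow, hD]; ring
    _ ≤ ‖a w‖ * (D * (2 ^ (N - 1) * (1 + ‖w‖ ^ N))) := by gcongr
    _ = _ := by ring

lemma J_integral (K L : ℕ) (J : Sch n →L[ℂ] WW n L) (hJ : ∀ φ α y,
    J φ α y = wt K y * mdL (List.finRange n) (fun i => (α i : ℕ)) φ y) (a b : Sch n) (x : Rn n) :
    ∫ w, a w • J (shiftReflect b (x - w)) = J (shiftReflect (cS a b) x) := by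
  funext α
  ext y
  let ev : WW n L →L[ℂ] ℂ := (BoundedContinuousFunction.evalCLM ℂ y).comp (ContinuousLinearMap.proj α)
  have h := ev.integral_comp_comm (J_integrable J a b x)
  change ev _ = _
  rw [← h, hJ]
  obtain ⟨c, hc⟩ := mdL_sr (List.finRange n) (fun i => (α i : ℕ))
  have e : ∀ w, ev (a w • J (shiftReflect b (x - w))) =
      (wt K y * c) * (a w * mdL (List.finRange n) (fun i => (α i : ℕ)) b (x - y - w)) := by
    intro w
    rw [map_smul]
    change a w • (J _ α y) = _
    rw [hJ, hc, SchwartzMap.smul_apply, sr_apply, show x - w - y = x - y - w by abel]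
    simp only [smul_eq_mul]; ring
  simp_rw [e]
  rw [integral_const_mul, hc, SchwartzMap.smul_apply, sr_apply, mdL_cS, cS_apply]
  simp only [smul_eq_mul]; ring

lemma f_le_J (f : TDist n E) : ∃ K L, ∃ J : Sch n →L[ℂ] WW n L, (∀ φ α y,
    J φ α y = wt K y * mdL (List.finRange n) (fun i => (α i : ℕ)) φ y) ∧
    ∃ C, 0 ≤ C ∧ ∀ φ, ‖f.toFun φ‖ ≤ C * ‖J φ‖ := by
  obtain ⟨c, K, L, h⟩ := f.bound
  obtain ⟨J, hJ⟩ := exists_J (n := n) K L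
  refine ⟨K, L, J, hJ, |c| * Fintype.card (Fin n → Fin (L + 1)), by positivity, fun φ => (h φ).trans ?_⟩
  have h0 : 0 ≤ schSemi K L φ := Real.iSup_nonneg fun x => by
    refine mul_nonneg (by positivity) (Finset.sum_nonneg fun _ _ => by split_ifs <;> positivity)
  calc c * schSemi K L φ ≤ |c| * schSemi K L φ := by gcongr; exact le_abs_self c
    _ ≤ |c| * (Fintype.card (Fin n → Fin (L + 1)) * ‖J φ‖) := by
        gcongr
        refine ciSup_le fun x => ?_
        calc _ ≤ ∑ α : Fin n → Fin (L + 1), ‖J φ‖ := by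
              rw [Finset.mul_sum]
              refine Finset.sum_le_sum fun α _ => ?_
              split_ifs with hα
              · have h1 : ‖J φ α x‖ ≤ ‖J φ‖ :=
                  ((J φ α).norm_coe_le_norm x).trans (norm_le_pi_norm (J φ) α)
                rw [hJ, norm_mul, ← mderiv_coe] at h1
                refine le_trans ?_ h1
                gcongr
                rw [wt, Complex.norm_real, Real.norm_of_nonneg (by positivity)]
                have hb : (1:ℝ) ≤ 1 + ‖x‖ ^ 2 := le_add_of_nonneg_right (by positivity)
                have hk : (K : ℝ) / 2 ≤ (K : ℝ) := by
                  have := Nat.cast_nonneg (α := ℝ) K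
                  linarith
                rw [← Real.rpow_natCast (1 + ‖x‖ ^ 2) K]
                exact Real.rpow_le_rpow_of_exponent_le hb hk
              · simp
          _ = _ := by simp [Finset.card_univ]
    _ = _ := by ring

lemma conv_f (f : TDist n E) (a b : Sch n) (x : Rn n) :
    ‖f.toFun (shiftReflect (cS a b) x)‖ₑ ≤ ∫⁻ w, ‖a w‖ₑ * ‖f.toFun (shiftReflect b (x - w))‖ₑ := by
  obtain ⟨K, L, J, hJ, C, hC, hf⟩ := f_le_J f
  obtain ⟨g, hg1, hg⟩ := exists_dual_vector'' ℂ (f.toFun (shiftReflect (cS a b) x))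
  have hinj : Function.Injective (J : Sch n →ₗ[ℂ] WW n L) := by
    rw [← LinearMap.ker_eq_bot, LinearMap.ker_eq_bot']
    intro φ hφ
    ext y
    have h1 := hJ φ 0 y
    have h2 : J φ = 0 := hφ
    have h3 : ∀ L : List (Fin n), mdL L (fun _ => 0) φ = φ := by
      intro L; induction L with
      | nil => rfl
      | cons i L ih => exact ih
    have h4 : wt K y ≠ 0 := by
      rw [wt]; norm_cast; positivity
    rw [h2] at h1
    simp [h3, h4] at h1
    simpa using h1
  let e := LinearEquiv.ofInjective (J : Sch n →ₗ[ℂ] WW n L) hinj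
  let T0 : LinearMap.range (J : Sch n →ₗ[ℂ] WW n L) →ₗ[ℂ] ℂ := (g : E →ₗ[ℂ] ℂ) ∘ₗ f.toFun ∘ₗ (e.symm : _ →ₗ[ℂ] Sch n)
  have hT0 : ∀ z, ‖T0 z‖ ≤ C * ‖z‖ := by
    intro z
    obtain ⟨φ, rfl⟩ := e.surjective z
    have : T0 (e φ) = g (f.toFun φ) := by simp [T0]
    rw [this]
    have h5 : ‖e φ‖ = ‖J φ‖ := rfl
    rw [h5]
    calc _ ≤ ‖g‖ * ‖f.toFun φ‖ := g.le_opNorm _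
      _ ≤ 1 * ‖f.toFun φ‖ := by gcongr
      _ ≤ _ := by rw [one_mul]; exact hf φ
  obtain ⟨T, hT, -⟩ := exists_extension_norm_eq _ (T0.mkContinuous C hT0)
  have hTJ : ∀ φ, T (J φ) = g (f.toFun φ) := by
    intro φ
    have := hT (e φ)
    have h6 : T0.mkContinuous C hT0 (e φ) = g (f.toFun φ) := by simp [T0]
    rw [h6] at this
    exact this
  have h7 : ‖f.toFun (shiftReflect (cS a b) x)‖ₑ = ‖T (J (shiftReflect (cS a b) x))‖ₑ := by
    rw [hTJ, hg, enorm_eq_nnnorm, enorm_eq_nnnorm]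
    congr 1; ext; simp
  rw [h7, ← J_integral K L J hJ, ← T.integral_comp_comm (J_integrable J a b x)]
  refine (enorm_integral_le_lintegral_enorm _).trans (lintegral_mono fun w => ?_)
  rw [map_smul, hTJ, enorm_smul]
  gcongr
  have h8 : ‖g (f.toFun (shiftReflect b (x - w)))‖ ≤ ‖f.toFun (shiftReflect b (x - w))‖ := by
    calc _ ≤ ‖g‖ * ‖f.toFun (shiftReflect b (x - w))‖ := g.le_opNorm _
      _ ≤ 1 * _ := by gcongr
      _ = _ := one_mul _
  exact enorm_le_iff_norm_le.2 h8

/-- Convolution estimate for multipliers. -/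
lemma mOp_mul (f : TDist n E) (a b : Sch n) (x : Rn n) :
    ‖mOp (mS a b) f x‖ₑ ≤ ∫⁻ z, ‖invFourierS a (x - z)‖ₑ * ‖mOp b f z‖ₑ := by
  have h := conv_f f (invFourierS a) (invFourierS b) x
  rw [mOp, tdConv, inv_mS, enorm_smul]
  rw [← lintegral_sub_left_eq_self _ x]
  simp only [sub_sub_cancel]
  calc _ ≤ ‖((2 * π) ^ (-(n : ℝ) / 2) : ℝ)‖ₑ * ∫⁻ w, ‖invFourierS a w‖ₑ * ‖f.toFun (shiftReflect (invFourierS b) (x - w))‖ₑ := by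
        gcongr
    _ = _ := by
        rw [← lintegral_const_mul' _ _ (by simp)]
        refine lintegral_congr fun w => ?_
        rw [mOp, tdConv, enorm_smul]; ring

end BV

namespace BV

section abs
variable {X : Type*} [MeasurableSpace X] {μ : Measure X} {U : X → X → ℝ≥0∞} {G : X → ℝ≥0∞}
  {C : ℕ → ℝ≥0∞}

lemma absR_int (hUU : ∀ a b c, U a b * U b c ≤ U a c)
    (hUm : ∀ a, Measurable (U a)) (hG : Measurable G)
    (H : ∀ N a, G a ≤ C N * ∫⁻ b, U a b ^ N * G b ∂μ) (A : ℕ) (a b : X) :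
    U a b ^ A * G b ≤ C A * ∫⁻ c, U a c ^ A * G c ∂μ := by
  calc U a b ^ A * G b ≤ U a b ^ A * (C A * ∫⁻ c, U b c ^ A * G c ∂μ) := by gcongr; exact H A b
    _ = C A * (U a b ^ A * ∫⁻ c, U b c ^ A * G c ∂μ) := by ring
    _ = C A * ∫⁻ c, U a b ^ A * (U b c ^ A * G c) ∂μ := by
        rw [lintegral_const_mul]
        exact ((hUm b).pow_const A).mul hG
    _ ≤ _ := by
        refine mul_le_mul_right (lintegral_mono fun c => ?_) _
        rw [← mul_assoc, ← mul_pow]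
        gcongr
        exact hUU a b c

lemma absR_step (hUU : ∀ a b c, U a b * U b c ≤ U a c)
    (hUm : ∀ a, Measurable (U a)) (hG : Measurable G)
    (H : ∀ N a, G a ≤ C N * ∫⁻ b, U a b ^ N * G b ∂μ) (hC : ∀ N, 1 ≤ C N) (A : ℕ) (a : X)
    (p : ℝ) (hp : 0 < p) (hp1 : p ≤ 1)
    (hM : (⨆ b, U a b ^ A * G b) ≠ ∞) :
    (⨆ b, U a b ^ A * G b) ^ p ≤ C A * ∫⁻ c, (U a c ^ A * G c) ^ p ∂μ := by
  set M := ⨆ b, U a b ^ A * G b with hMd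
  set Q := ∫⁻ c, (U a c ^ A * G c) ^ p ∂μ with hQ
  have h1 : M ≤ M ^ (1 - p) * (C A * Q) := by
    refine iSup_le fun b => (absR_int hUU hUm hG H A a b).trans ?_
    rw [mul_left_comm]
    gcongr
    rw [hQ, ← lintegral_const_mul]
    · refine lintegral_mono fun c => ?_
      have h2 : U a c ^ A * G c ≤ M := le_iSup (fun b => U a b ^ A * G b) c
      calc U a c ^ A * G c = (U a c ^ A * G c) ^ ((1 - p) + p) := by simp
        _ = (U a c ^ A * G c) ^ (1 - p) * (U a c ^ A * G c) ^ p :=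
            ENNReal.rpow_add_of_nonneg _ _ (by linarith) hp.le
        _ ≤ _ := by gcongr
    · exact (((hUm a).pow_const A).mul hG).pow_const p
  by_cases h0 : M = 0
  · rw [h0, ENNReal.zero_rpow_of_pos hp]; exact bot_le
  have h3 : M ^ p * M ^ (1 - p) = M := by
    rw [← ENNReal.rpow_add_of_nonneg _ _ hp.le (by linarith)]; simp
  have h4 : M ^ (1 - p) ≠ 0 := by
    simp [ENNReal.rpow_eq_zero_iff, h0, hM]
  have h5 : M ^ (1 - p) ≠ ∞ := ENNReal.rpow_ne_top_of_nonneg (by linarith) hM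
  rw [← ENNReal.mul_le_mul_iff_right h4 h5, mul_comm, h3]
  exact h1

lemma absR (hU1 : ∀ a b, U a b ≤ 1) (hUr : ∀ a, U a a = 1) (hUU : ∀ a b c, U a b * U b c ≤ U a c)
    (hUm : ∀ a, Measurable (U a)) (hG : Measurable G)
    (H : ∀ N a, G a ≤ C N * ∫⁻ b, U a b ^ N * G b ∂μ) (hC : ∀ N, 1 ≤ C N) (hCt : ∀ N, C N ≠ ∞)
    (AP : ∃ A₀ : ℕ, ∀ a, (⨆ b, U a b ^ A₀ * G b) ≠ ∞) (A : ℕ) (a : X)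
    (p : ℝ) (hp : 0 < p) (hp1 : p ≤ 1) :
    (⨆ b, U a b ^ A * G b) ^ p ≤ C A * ∫⁻ c, (U a c ^ A * G c) ^ p ∂μ := by
  obtain ⟨A₀, hA₀⟩ := AP
  by_cases hQ : ∫⁻ c, (U a c ^ A * G c) ^ p ∂μ = ∞
  · rw [hQ, ENNReal.mul_top (by have := hC A; positivity)]; exact le_top
  refine absR_step hUU hUm hG H hC A a p hp hp1 (ne_of_lt ?_)
  set A' := max A A₀
  have h1 : ∀ b, G b ^ p ≤ C A' * ∫⁻ c, (U b c ^ A * G c) ^ p ∂μ := by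
    intro b
    have h2 : (⨆ c, U b c ^ A' * G c) ≠ ∞ := by
      refine ne_top_of_le_ne_top (hA₀ b) (iSup_mono fun c => ?_)
      gcongr ?_ * _
      exact pow_le_pow_right_of_le_one' (hU1 b c) (le_max_right _ _)
    calc G b ^ p ≤ (⨆ c, U b c ^ A' * G c) ^ p := by
          gcongr
          refine le_trans ?_ (le_iSup _ b)
          simp [hUr]
      _ ≤ _ := absR_step hUU hUm hG H hC A' b p hp hp1 h2
      _ ≤ _ := by
          refine mul_le_mul_right (lintegral_mono fun c => ?_) _
          refine ENNReal.rpow_le_rpow (mul_le_mul_left ?_ _) hp.le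
          exact pow_le_pow_right_of_le_one' (hU1 b _) (le_max_left _ _)
  have h2 : ∀ b, U a b ^ A * G b ≤ (C A' * ∫⁻ c, (U a c ^ A * G c) ^ p ∂μ) ^ (1 / p) := by
    intro b
    rw [one_div, ENNReal.le_rpow_inv_iff hp, ENNReal.mul_rpow_of_nonneg _ _ hp.le]
    calc (U a b ^ A) ^ p * G b ^ p ≤ (U a b ^ A) ^ p * (C A' * ∫⁻ c, (U b c ^ A * G c) ^ p ∂μ) := by
          gcongr; exact h1 b
      _ = C A' * ((U a b ^ A) ^ p * ∫⁻ c, (U b c ^ A * G c) ^ p ∂μ) := by ring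
      _ = C A' * ∫⁻ c, (U a b ^ A) ^ p * (U b c ^ A * G c) ^ p ∂μ := by
          rw [lintegral_const_mul]
          exact (((hUm b).pow_const A).mul hG).pow_const p
      _ ≤ _ := by
          refine mul_le_mul_right (lintegral_mono fun c => ?_) _
          rw [← ENNReal.mul_rpow_of_nonneg _ _ hp.le, ← mul_assoc, ← mul_pow]
          gcongr
          exact hUU a b c
  refine lt_of_le_of_lt (iSup_le h2) ?_
  exact ENNReal.rpow_lt_top_of_nonneg (by positivity) (ENNReal.mul_ne_top (hCt _) hQ)

lemma absR_ge (hUU : ∀ a b c, U a b * U b c ≤ U a c)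
    (hUm : ∀ a, Measurable (U a)) (hG : Measurable G)
    (H : ∀ N a, G a ≤ C N * ∫⁻ b, U a b ^ N * G b ∂μ) (A : ℕ) (a : X)
    (p : ℝ) (hp : 1 ≤ p) :
    (⨆ b, U a b ^ A * G b) ^ p ≤
      C A ^ p * ((∫⁻ c, U a c ^ A ∂μ) ^ (p - 1) * ∫⁻ c, U a c ^ A * G c ^ p ∂μ) := by
  have hp0 : 0 < p := by linarith
  calc (⨆ b, U a b ^ A * G b) ^ p ≤ (C A * ∫⁻ c, U a c ^ A * G c ∂μ) ^ p := by
        gcongr; exact iSup_le fun b => absR_int hUU hUm hG H A a b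
    _ = C A ^ p * (∫⁻ c, U a c ^ A * G c ∂μ) ^ p := ENNReal.mul_rpow_of_nonneg _ _ hp0.le
    _ ≤ _ := by
        gcongr
        rcases hp.eq_or_lt with rfl | h1
        · simp
        have hpq : p.HolderConjugate (p / (p - 1)) := Real.HolderConjugate.conjExponent h1
        have hm : Measurable fun c => U a c ^ A := (hUm a).pow_const A
        have h2 := ENNReal.lintegral_mul_le_Lp_mul_Lq μ hpq
          (f := fun c => (U a c ^ A) ^ (1 / p) * G c) (g := fun c => (U a c ^ A) ^ ((p - 1) / p))
          ((hm.pow_const _).mul hG).aemeasurable (hm.pow_const _).aemeasurable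
        have e1 : ∀ c, ((U a c ^ A) ^ (1 / p) * G c) * (U a c ^ A) ^ ((p - 1) / p) = U a c ^ A * G c := by
          intro c
          rw [mul_right_comm, ← ENNReal.rpow_add_of_nonneg _ _ (by positivity)
            (div_nonneg (by linarith) hp0.le), ← add_div]
          simp [hp0.ne']
        have e2 : ∀ c, ((U a c ^ A) ^ (1 / p) * G c) ^ p = U a c ^ A * G c ^ p := by
          intro c
          rw [ENNReal.mul_rpow_of_nonneg _ _ hp0.le, ← ENNReal.rpow_mul]
          simp [hp0.ne']
        have e3 : ∀ c, ((U a c ^ A) ^ ((p - 1) / p)) ^ (p / (p - 1)) = U a c ^ A := by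
          intro c
          rw [← ENNReal.rpow_mul]
          have : (p - 1) / p * (p / (p - 1)) = 1 := by
            have : p - 1 ≠ 0 := by linarith
            field_simp
          rw [this]; simp
        simp only [Pi.mul_apply, e1, e2, e3] at h2
        calc (∫⁻ c, U a c ^ A * G c ∂μ) ^ p ≤ _ := by
              apply ENNReal.rpow_le_rpow h2 hp0.le
          _ = _ := by
              rw [ENNReal.mul_rpow_of_nonneg _ _ hp0.le, ← ENNReal.rpow_mul, ← ENNReal.rpow_mul,
                mul_comm]
              have h3 : p - 1 ≠ 0 := by linarith
              congr 2
              · field_simp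
              · rw [one_div_mul_cancel hp0.ne']; simp
end abs

end BV

namespace BV

def kap (c : ℝ) (i l : ℕ) : ℝ≥0∞ := (2 : ℝ≥0∞) ^ (-(c * |(l : ℝ) - i|))

lemma two_rpow_add (x y : ℝ) : (2 : ℝ≥0∞) ^ (x + y) = 2 ^ x * 2 ^ y :=
  ENNReal.rpow_add _ _ (by norm_num) (by norm_num)

lemma two_rpow_mono {x y : ℝ} (h : x ≤ y) : (2 : ℝ≥0∞) ^ x ≤ 2 ^ y :=
  ENNReal.rpow_le_rpow_of_exponent_le (by norm_num) h

lemma two_rpow_ne_top (x : ℝ) : (2 : ℝ≥0∞) ^ x ≠ ∞ :=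
  ENNReal.rpow_ne_top_of_ne_zero (by norm_num) (by norm_num)

lemma two_rpow_ne_zero (x : ℝ) : (2 : ℝ≥0∞) ^ x ≠ 0 := by
  simp [ENNReal.rpow_eq_zero_iff]

lemma ofReal_two_rpow (x : ℝ) : ENNReal.ofReal ((2 : ℝ) ^ x) = 2 ^ x := by
  rw [← ENNReal.ofReal_rpow_of_pos (by norm_num)]; norm_num

lemma kap_add (c c' : ℝ) (i l : ℕ) : kap (c + c') i l = kap c i l * kap c' i l := by
  rw [kap, kap, kap, ← two_rpow_add]; congr 1; ring

lemma kap_rpow (c p : ℝ) (i l : ℕ) : kap c i l ^ p = kap (c * p) i l := by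
  rw [kap, kap, ← ENNReal.rpow_mul]; congr 1; ring

lemma kap_mono {c c' : ℝ} (h : c ≤ c') (i l : ℕ) : kap c' i l ≤ kap c i l := by
  refine two_rpow_mono ?_
  have := abs_nonneg ((l : ℝ) - i)
  nlinarith

lemma kap_le_one {c : ℝ} (h : 0 ≤ c) (i l : ℕ) : kap c i l ≤ 1 := by
  refine (kap_mono h i l).trans ?_
  simp [kap]

lemma kap_tri {c : ℝ} (h : 0 ≤ c) (i k l : ℕ) : kap c i k * kap c k l ≤ kap c i l := by
  rw [kap, kap, kap, ← two_rpow_add]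
  refine two_rpow_mono ?_
  have := abs_sub_le (l : ℝ) k i
  nlinarith

lemma kap_shift {c c' s : ℝ} (h : c + |s| ≤ c') (k l : ℕ) :
    (2 : ℝ≥0∞) ^ ((k : ℝ) * s) * kap c' k l ≤ kap c k l * 2 ^ ((l : ℝ) * s) := by
  rw [kap, kap, ← two_rpow_add, ← two_rpow_add]
  refine two_rpow_mono ?_
  have h1 := abs_nonneg ((l : ℝ) - k)
  have h2 : ((k : ℝ) - l) * s ≤ |(l : ℝ) - k| * |s| := by
    rw [← abs_mul, ← abs_neg]
    refine le_trans (le_abs_self _) (le_of_eq ?_)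
    congr 1; ring
  nlinarith

lemma kap_sum {c : ℝ} (h : 0 < c) : ∃ K : ℝ≥0∞, K ≠ ∞ ∧ ∀ i, ∑' l, kap c i l ≤ K := by
  set x : ℝ := (2 : ℝ) ^ (-c) with hx
  have hx0 : 0 < x := by positivity
  have hx1 : x < 1 := Real.rpow_lt_one_of_one_lt_of_neg (by norm_num) (by linarith)
  have hs : Summable fun e : ℤ => x ^ e.natAbs := by
    refine Summable.of_nat_of_neg ?_ ?_ <;>
    simpa using summable_geometric_of_lt_one hx0.le hx1
  refine ⟨∑' e : ℤ, ENNReal.ofReal (x ^ e.natAbs), hs.tsum_ofReal_ne_top, fun i => ?_⟩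
  have hinj : Function.Injective fun l : ℕ => (l : ℤ) - i := by
    intro a b hab; simpa using hab
  refine le_trans (le_of_eq ?_) (ENNReal.tsum_comp_le_tsum_of_injective hinj _)
  refine tsum_congr fun l => ?_
  rw [kap, ← ofReal_two_rpow, hx, ← Real.rpow_natCast, ← Real.rpow_mul (by norm_num)]
  congr 2
  rw [Nat.cast_natAbs]; push_cast; ring

lemma kap_sup {c c' : ℝ} (h : 0 < c) : ∃ K : ℝ≥0∞, K ≠ ∞ ∧ ∀ i (h : ℕ → ℝ≥0∞),
    ∑' l, kap (c + c') i l * h l ≤ K * ⨆ l, kap c' i l * h l := by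
  obtain ⟨K, hK, hk⟩ := kap_sum h
  refine ⟨K, hK, fun i h => ?_⟩
  calc ∑' l, kap (c + c') i l * h l ≤ ∑' l, kap c i l * ⨆ l, kap c' i l * h l := by
        refine ENNReal.tsum_le_tsum fun l => ?_
        rw [kap_add, mul_assoc]
        gcongr
        exact le_iSup (fun l => kap c' i l * h l) l
    _ = (∑' l, kap c i l) * _ := ENNReal.tsum_mul_right
    _ ≤ _ := by gcongr; exact hk i

def uR (a b : ℕ × Rn n) : ℝ :=
  if a.1 ≤ b.1 then ((2:ℝ) ^ (b.1 - a.1))⁻¹ * (1 + 2 ^ a.1 * ‖a.2 - b.2‖)⁻¹ else 0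

def UU (a b : ℕ × Rn n) : ℝ≥0∞ := ENNReal.ofReal (uR a b)

lemma uR_nonneg (a b : ℕ × Rn n) : 0 ≤ uR a b := by
  unfold uR; split_ifs <;> positivity

lemma uR_le_one (a b : ℕ × Rn n) : uR a b ≤ 1 := by
  unfold uR; split_ifs
  · refine mul_le_one₀ (inv_le_one_of_one_le₀ (one_le_pow₀ (by norm_num))) (by positivity)
      (inv_le_one_of_one_le₀ ?_)
    exact le_add_of_nonneg_right (by positivity)
  · norm_num

lemma UU_le_one (a b : ℕ × Rn n) : UU a b ≤ 1 := by
  simpa [UU] using uR_le_one a b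

lemma UU_self (a : ℕ × Rn n) : UU a a = 1 := by simp [UU, uR]

lemma UU_mul (a b c : ℕ × Rn n) : UU a b * UU b c ≤ UU a c := by
  rw [UU, UU, UU, ← ENNReal.ofReal_mul (uR_nonneg a b)]
  refine ENNReal.ofReal_le_ofReal ?_
  by_cases h1 : a.1 ≤ b.1
  swap
  · have : uR a b = 0 := by simp [uR, h1]
    rw [this, zero_mul]; exact uR_nonneg _ _
  by_cases h2 : b.1 ≤ c.1
  swap
  · have : uR b c = 0 := by simp [uR, h2]
    rw [this, mul_zero]; exact uR_nonneg _ _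
  rw [uR, uR, uR, if_pos h1, if_pos h2, if_pos (h1.trans h2)]
  have e : (2:ℝ) ^ (c.1 - a.1) = 2 ^ (b.1 - a.1) * 2 ^ (c.1 - b.1) := by
    rw [← pow_add]; congr 1; omega
  rw [e, ← mul_inv, ← mul_inv, ← mul_inv, ← mul_inv]
  refine inv_anti₀ (by positivity) ?_
  have h3 : (2:ℝ) ^ a.1 ≤ 2 ^ b.1 := pow_le_pow_right₀ (by norm_num) h1
  have h4 : ‖a.2 - c.2‖ ≤ ‖a.2 - b.2‖ + ‖b.2 - c.2‖ := norm_sub_le_norm_sub_add_norm_sub _ _ _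
  have h5 : 1 + 2 ^ a.1 * ‖a.2 - c.2‖ ≤ (1 + 2 ^ a.1 * ‖a.2 - b.2‖) * (1 + 2 ^ b.1 * ‖b.2 - c.2‖) := by
    calc 1 + 2 ^ a.1 * ‖a.2 - c.2‖ ≤ 1 + 2 ^ a.1 * (‖a.2 - b.2‖ + ‖b.2 - c.2‖) := by gcongr
      _ ≤ 1 + 2 ^ a.1 * ‖a.2 - b.2‖ + 2 ^ b.1 * ‖b.2 - c.2‖ := by
          have := mul_le_mul_of_nonneg_right h3 (norm_nonneg (b.2 - c.2))
          linarith
      _ ≤ _ := by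
          have : 0 ≤ (2 ^ a.1 * ‖a.2 - b.2‖) * (2 ^ b.1 * ‖b.2 - c.2‖) := by positivity
          linarith
  calc _ = (2 ^ (b.1 - a.1) * 2 ^ (c.1 - b.1) : ℝ) * (1 + 2 ^ a.1 * ‖a.2 - c.2‖) := by ring
    _ ≤ (2 ^ (b.1 - a.1) * 2 ^ (c.1 - b.1) : ℝ) *
        ((1 + 2 ^ a.1 * ‖a.2 - b.2‖) * (1 + 2 ^ b.1 * ‖b.2 - c.2‖)) := by gcongr
    _ = _ := by ring

lemma UU_cont (i l : ℕ) : Continuous fun w : Rn n × Rn n => UU (i, w.1) (l, w.2) := by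
  unfold UU uR
  refine ENNReal.continuous_ofReal.comp ?_
  by_cases h : i ≤ l
  · simp only [h, if_true]
    refine continuous_const.mul (Continuous.inv₀ (by fun_prop) fun w => ?_)
    positivity
  · simp only [h, if_false]; exact continuous_const

lemma meas_prodN {g : ℕ × Rn n → ℝ≥0∞} (h : ∀ l, Measurable fun z => g (l, z)) : Measurable g := by
  refine measurable_from_prod_countable_right h

lemma UU_meas (a : ℕ × Rn n) : Measurable (UU a) :=
  meas_prodN fun l => ((UU_cont a.1 l).comp (by fun_prop : Continuous fun z : Rn n => (a.2, z))).measurable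

def muX (n : ℕ) : Measure (ℕ × Rn n) :=
  Measure.sum fun l : ℕ => ((2:ℝ≥0∞) ^ ((l : ℝ) * n)) • (volume.map (Prod.mk l))

lemma lint_muX {g : ℕ × Rn n → ℝ≥0∞} (h : Measurable g) :
    ∫⁻ b, g b ∂(muX n) = ∑' l : ℕ, (2:ℝ≥0∞) ^ ((l : ℝ) * n) * ∫⁻ z, g (l, z) := by
  rw [muX, lintegral_sum_measure]
  refine tsum_congr fun l => ?_
  rw [lintegral_smul_measure, lintegral_map h (by fun_prop), smul_eq_mul]

lemma lint_scale (i : ℕ) (x : Rn n) (ρ : ℝ) :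
    ∫⁻ z : Rn n, ENNReal.ofReal ((1 + 2 ^ i * ‖x - z‖) ^ (-ρ)) =
      (2:ℝ≥0∞) ^ (-((i : ℝ) * n)) * ∫⁻ z : Rn n, ENNReal.ofReal ((1 + ‖z‖) ^ (-ρ)) := by
  have h1 : ∫⁻ z : Rn n, ENNReal.ofReal ((1 + 2 ^ i * ‖x - z‖) ^ (-ρ)) =
      ∫⁻ z : Rn n, ENNReal.ofReal ((1 + 2 ^ i * ‖z‖) ^ (-ρ)) :=
    lintegral_sub_left_eq_self (fun z : Rn n => ENNReal.ofReal ((1 + 2 ^ i * ‖z‖) ^ (-ρ))) x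
  have hc : Measurable fun z : Rn n => ENNReal.ofReal ((1 + ‖z‖) ^ (-ρ)) := by fun_prop
  have h2 := lintegral_map (μ := volume) hc (measurable_const_smul ((2:ℝ) ^ i) : Measurable fun z : Rn n => (2:ℝ) ^ i • z)
  rw [Measure.map_addHaar_smul _ (by positivity), lintegral_smul_measure] at h2
  have e : ∀ z : Rn n, 2 ^ i * ‖z‖ = ‖(2:ℝ) ^ i • z‖ := fun z => by
    rw [norm_smul, Real.norm_of_nonneg (by positivity)]
  rw [h1]
  simp_rw [e]
  rw [← h2, smul_eq_mul]
  congr 1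
  rw [abs_of_nonneg (by positivity), finrank_euclideanSpace_fin, ← ofReal_two_rpow,
    Real.rpow_neg (by norm_num), Real.rpow_mul (by norm_num)]
  simp

def cI (n : ℕ) (ρ : ℝ) : ℝ≥0∞ := ∫⁻ z : Rn n, ENNReal.ofReal ((1 + ‖z‖) ^ (-ρ))

lemma cI_lt {ρ : ℝ} (h : (n : ℝ) < ρ) : cI n ρ ≠ ∞ :=
  (finite_integral_one_add_norm (by simpa using h)).ne

lemma UU_rpow_le (i l : ℕ) (x z : Rn n) {ρ : ℝ} (hρ : 0 < ρ) :
    UU (i, x) (l, z) ^ ρ ≤ kap ρ i l * ENNReal.ofReal ((1 + 2 ^ i * ‖x - z‖) ^ (-ρ)) ∧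
      (l < i → UU (i, x) (l, z) ^ ρ = 0) := by
  by_cases h : i ≤ l
  · refine ⟨le_of_eq ?_, fun h' => absurd h' (by omega)⟩
    rw [UU, uR, if_pos h, ENNReal.ofReal_rpow_of_nonneg (by positivity) hρ.le,
      Real.mul_rpow (by positivity) (by positivity), ENNReal.ofReal_mul (by positivity)]
    congr 1
    · rw [kap, ← ofReal_two_rpow]
      congr 1
      have : (i : ℝ) ≤ l := by exact_mod_cast h
      rw [abs_of_nonneg (by linarith), ← Real.rpow_natCast, ← Real.rpow_neg (by norm_num),
        ← Real.rpow_mul (by norm_num)]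
      push_cast [h]
      congr 1; ring
    · rw [Real.inv_rpow (by positivity), Real.rpow_neg (by positivity)]
  · have : UU (i, x) (l, z) = 0 := by simp [UU, uR, h]
    simp [this, hρ]

lemma UU_int (i l : ℕ) (x : Rn n) {ρ : ℝ} (hρ : 0 < ρ) :
    (2:ℝ≥0∞) ^ ((l : ℝ) * n) * ∫⁻ z, UU (i, x) (l, z) ^ ρ ≤ kap (ρ - n) i l * cI n ρ := by
  by_cases h : l < i
  · simp [(UU_rpow_le i l x _ hρ).2 h]
  push Not at h
  calc _ ≤ (2:ℝ≥0∞) ^ ((l : ℝ) * n) * ∫⁻ z, kap ρ i l * ENNReal.ofReal ((1 + 2 ^ i * ‖x - z‖) ^ (-ρ)) := by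
        gcongr with z
        exact (UU_rpow_le i l x z hρ).1
    _ = (2:ℝ≥0∞) ^ ((l : ℝ) * n) * (kap ρ i l * (2 ^ (-((i : ℝ) * n)) * cI n ρ)) := by
        rw [lintegral_const_mul _ (by fun_prop), lint_scale, cI]
    _ = ((2:ℝ≥0∞) ^ ((l : ℝ) * n) * kap ρ i l * 2 ^ (-((i : ℝ) * n))) * cI n ρ := by ring
    _ ≤ _ := by
        refine le_of_eq ?_
        congr 1
        rw [kap, kap, ← two_rpow_add, ← two_rpow_add]
        congr 1
        have : (i : ℝ) ≤ l := by exact_mod_cast h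
        rw [abs_of_nonneg (by linarith)]
        ring

lemma UU_symm (i l : ℕ) (x z : Rn n) : UU (i, x) (l, z) = UU (i, z) (l, x) := by
  simp [UU, uR, norm_sub_rev]

end BV

namespace BV

lemma root_sup {pr : ℝ} (hp : 0 < pr) (c : ℝ) (i : ℕ) (I : ℕ → ℝ≥0∞) :
    (⨆ k, kap (c * pr) i k * I k) ^ (1 / pr) ≤ ⨆ k, kap c i k * I k ^ (1 / pr) := by
  rw [one_div, ENNReal.rpow_inv_le_iff hp]
  refine iSup_le fun k => ?_
  refine le_trans (le_of_eq ?_) (ENNReal.rpow_le_rpow (le_iSup _ k) hp.le)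
  rw [ENNReal.mul_rpow_of_nonneg _ _ hp.le, kap_rpow, ← ENNReal.rpow_mul]
  simp [hp.ne']

lemma lp_sum {p : ℝ≥0∞} (hp : p ≠ 0) {δ : ℝ} (hδ : 0 < δ) (c : ℝ) :
    ∃ K : ℝ≥0∞, K ≠ ∞ ∧ ∀ i (h : ℕ → Rn n → ℝ≥0∞), (∀ k, Measurable (h k)) →
      lpNormENN p (fun x => ∑' k, kap (δ + (δ + c)) i k * h k x) ≤
        K * ⨆ k, kap c i k * lpNormENN p (h k) := by
  by_cases hpt : p = ∞
  · obtain ⟨K, hK, hk⟩ := kap_sup (c := δ + δ) (c' := c) (by linarith)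
    refine ⟨K, hK, fun i h hm => ?_⟩
    simp only [lpNormENN, hpt, if_true]
    refine essSup_le_of_ae_le _ ?_
    have : ∀ᵐ x : Rn n, ∀ k, h k x ≤ essSup (h k) volume :=
      ae_all_iff.2 fun k => ENNReal.ae_le_essSup _
    filter_upwards [this] with x hx
    refine le_trans (ENNReal.tsum_le_tsum fun k => mul_le_mul_right (hx k) _) ?_
    rw [← add_assoc]
    exact hk i _
  · set pr := p.toReal with hpr
    have hp0 : 0 < pr := ENNReal.toReal_pos hp hpt
    obtain ⟨K, hK, hk⟩ := kap_sup (c := δ) (c' := δ + c) hδ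
    obtain ⟨K2, hK2, hk2⟩ := kap_sup (c := δ * pr) (c' := c * pr) (by positivity)
    refine ⟨K * K2 ^ (1 / pr), ENNReal.mul_ne_top hK
      (ENNReal.rpow_ne_top_of_nonneg (by positivity) hK2), fun i h hm => ?_⟩
    simp only [lpNormENN, hpt, if_false, ← hpr]
    have h1 : ∫⁻ x, (∑' k, kap (δ + (δ + c)) i k * h k x) ^ pr ≤
        K ^ pr * (K2 * ⨆ k, kap (c * pr) i k * ∫⁻ x, h k x ^ pr) := by
      calc _ ≤ ∫⁻ x, K ^ pr * ∑' k, kap ((δ + c) * pr) i k * h k x ^ pr := by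
            refine lintegral_mono fun x => ?_
            refine (ENNReal.rpow_le_rpow (hk i (fun k => h k x)) hp0.le).trans ?_
            rw [ENNReal.mul_rpow_of_nonneg _ _ hp0.le]
            gcongr
            rw [← ENNReal.le_rpow_inv_iff hp0]
            refine iSup_le fun k => ?_
            rw [ENNReal.le_rpow_inv_iff hp0, ENNReal.mul_rpow_of_nonneg _ _ hp0.le, kap_rpow]
            exact ENNReal.le_tsum k
        _ = K ^ pr * ∑' k, kap (δ * pr + c * pr) i k * ∫⁻ x, h k x ^ pr := by
            have hm' : ∀ k, Measurable fun x => h k x ^ pr := fun k => (hm k).pow_const pr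
            rw [lintegral_const_mul, lintegral_tsum]
            · congr 1
              refine tsum_congr fun k => ?_
              rw [lintegral_const_mul _ (hm' k), add_mul]
            · exact fun k => ((hm' k).const_mul _).aemeasurable
            · exact Measurable.tsum fun k => (hm' k).const_mul _
        _ ≤ _ := by gcongr; exact hk2 i _
    refine (ENNReal.rpow_le_rpow h1 (by positivity)).trans ?_
    rw [ENNReal.mul_rpow_of_nonneg _ _ (by positivity), ENNReal.mul_rpow_of_nonneg _ _ (by positivity),
      ← ENNReal.rpow_mul, mul_one_div_cancel hp0.ne', ENNReal.rpow_one, mul_assoc]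
    gcongr
    exact root_sup hp0 c i _

def MM (A : ℕ) (G : ℕ → Rn n → ℝ≥0∞) (i : ℕ) (x : Rn n) : ℝ≥0∞ :=
  ⨆ b : ℕ × Rn n, UU (i, x) b ^ A * G b.1 b.2

lemma MM_meas (A : ℕ) (G : ℕ → Rn n → ℝ≥0∞) (hG : ∀ l z, G l z ≠ ∞) (i : ℕ) : Measurable (MM A G i) := by
  refine LowerSemicontinuous.measurable (lowerSemicontinuous_iSup fun b => ?_)
  refine Continuous.lowerSemicontinuous ?_
  have := (UU_cont (n := n) i b.1).comp (by fun_prop : Continuous fun x : Rn n => (x, b.2))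
  exact (ENNReal.continuous_mul_const (hG b.1 b.2)).comp ((ENNReal.continuous_pow A).comp this)

/-- hypotheses on the discrete family -/
structure Good (C : ℕ → ℝ≥0∞) (G : ℕ → Rn n → ℝ≥0∞) : Prop where
  meas : ∀ l, Measurable (G l)
  fin : ∀ l z, G l z ≠ ∞
  H : ∀ N i x, G i x ≤ C N * ∑' l : ℕ, (2:ℝ≥0∞) ^ ((l : ℝ) * n) * ∫⁻ z, UU (i, x) (l, z) ^ N * G l z
  AP : ∃ A₀ : ℕ, ∀ i x, MM A₀ G i x ≠ ∞

lemma Good.measX {C : ℕ → ℝ≥0∞} {G : ℕ → Rn n → ℝ≥0∞} (h : Good C G) :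
    Measurable fun b : ℕ × Rn n => G b.1 b.2 := meas_prodN h.meas

lemma Good.HX {C : ℕ → ℝ≥0∞} {G : ℕ → Rn n → ℝ≥0∞} (h : Good C G) (N : ℕ) (a : ℕ × Rn n) :
    G a.1 a.2 ≤ C N * ∫⁻ b, UU a b ^ N * G b.1 b.2 ∂(muX n) := by
  have hm : Measurable fun b => UU a b ^ N * G b.1 b.2 := ((UU_meas a).pow_const N).mul h.measX
  rw [lint_muX hm]
  exact h.H N a.1 a.2

lemma Good.int {C : ℕ → ℝ≥0∞} {G : ℕ → Rn n → ℝ≥0∞} (h : Good C G) {ρ : ℝ} (hρ : 0 < ρ) (pr : ℝ) (i : ℕ) :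
    ∫⁻ x, ∫⁻ c, UU (i, x) c ^ ρ * G c.1 c.2 ^ pr ∂(muX n) ≤
      cI n ρ * ∑' l, kap (ρ - n) i l * ∫⁻ z, G l z ^ pr := by
  have hm2 : ∀ l, Measurable fun w : Rn n × Rn n => UU (i, w.1) (l, w.2) ^ ρ * G l w.2 ^ pr := fun l =>
    ((UU_cont i l).measurable.pow_const ρ).mul (((h.meas l).comp measurable_snd).pow_const pr)
  calc _ = ∫⁻ x, ∑' l : ℕ, (2:ℝ≥0∞) ^ ((l : ℝ) * n) * ∫⁻ z, UU (i, x) (l, z) ^ ρ * G l z ^ pr := by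
        refine lintegral_congr fun x => ?_
        have hm : Measurable fun b => UU (i, x) b ^ ρ * G b.1 b.2 ^ pr :=
          ((UU_meas (i, x)).pow_const ρ).mul (h.measX.pow_const pr)
        rw [lint_muX hm]
    _ = ∑' l : ℕ, (2:ℝ≥0∞) ^ ((l : ℝ) * n) * ∫⁻ x, ∫⁻ z, UU (i, x) (l, z) ^ ρ * G l z ^ pr := by
        rw [lintegral_tsum]
        · refine tsum_congr fun l => ?_
          rw [lintegral_const_mul _ (hm2 l).lintegral_prod_right']
        · exact fun l => ((hm2 l).lintegral_prod_right'.const_mul _).aemeasurable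
    _ ≤ ∑' l : ℕ, cI n ρ * (kap (ρ - n) i l * ∫⁻ z, G l z ^ pr) := by
        refine ENNReal.tsum_le_tsum fun l => ?_
        rw [lintegral_lintegral_swap (hm2 l).aemeasurable]
        rw [← lintegral_const_mul _ (hm2 l).lintegral_prod_left', ← mul_assoc,
          ← lintegral_const_mul _ ((h.meas l).pow_const pr)]
        refine lintegral_mono fun z => ?_
        have hz : Measurable fun x => UU (i, x) (l, z) ^ ρ :=
          ((UU_cont (n := n) i l).comp (by fun_prop : Continuous fun x : Rn n => (x, z))).measurable.pow_const ρ
        dsimp only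
        rw [lintegral_mul_const _ hz, ← mul_assoc, mul_comm (cI n ρ)]
        refine mul_le_mul_left ?_ _
        have hsy : (fun x => UU (i, x) (l, z) ^ ρ) = fun x => UU (i, z) (l, x) ^ ρ :=
          funext fun x => by rw [UU_symm i l x z]
        rw [hsy]
        exact UU_int i l z hρ
    _ = _ := ENNReal.tsum_mul_left

theorem RN (n : ℕ) {p : ℝ≥0∞} (hp : p ≠ 0) (B : ℝ) (hB : 0 ≤ B) :
    ∃ A : ℕ, ∀ C : ℕ → ℝ≥0∞, (∀ N, 1 ≤ C N) → (∀ N, C N ≠ ∞) → ∃ K : ℝ≥0∞, K ≠ ∞ ∧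
      ∀ G : ℕ → Rn n → ℝ≥0∞, Good C G → ∀ i,
        lpNormENN p (MM A G i) ≤ K * ⨆ l, kap B i l * lpNormENN p (G l) := by
  by_cases hpt : p = ∞
  · obtain ⟨A, hA⟩ := exists_nat_ge (1 + B + n)
    refine ⟨A, fun C hC1 hCt => ?_⟩
    obtain ⟨K, hK, hk⟩ := kap_sup (c := 1) (c' := B) (by norm_num)
    have hcI : cI n A ≠ ∞ := cI_lt (by linarith)
    have hA0 : (0:ℝ) < A := by have := Nat.cast_nonneg (α := ℝ) n; linarith
    refine ⟨C A * (cI n A * K), by finiteness [hCt A], fun G hG i => ?_⟩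
    simp only [lpNormENN, hpt, if_true]
    refine essSup_le_of_ae_le _ (Eventually.of_forall fun x => ?_)
    calc MM A G i x ≤ C A * ∫⁻ c, UU (i, x) c ^ A * G c.1 c.2 ∂(muX n) :=
          iSup_le fun b => absR_int UU_mul UU_meas hG.measX hG.HX A (i, x) b
      _ ≤ C A * ∑' l, cI n A * (kap (1 + B) i l * essSup (G l) volume) := by
          gcongr
          have hm : Measurable fun b => UU (i, x) b ^ A * G b.1 b.2 :=
            ((UU_meas (i, x)).pow_const A).mul hG.measX
          rw [lint_muX hm]
          refine ENNReal.tsum_le_tsum fun l => ?_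
          have hz : Measurable fun z => UU (i, x) (l, z) ^ A :=
            ((UU_meas (i, x)).comp measurable_prodMk_left).pow_const A
          calc _ ≤ (2:ℝ≥0∞) ^ ((l : ℝ) * n) * ∫⁻ z, UU (i, x) (l, z) ^ A * essSup (G l) volume := by
                refine mul_le_mul_right (lintegral_mono_ae ?_) _
                filter_upwards [ENNReal.ae_le_essSup (G l)] with z hz
                gcongr
            _ = ((2:ℝ≥0∞) ^ ((l : ℝ) * n) * ∫⁻ z, UU (i, x) (l, z) ^ (A : ℝ)) * essSup (G l) volume := by
                rw [lintegral_mul_const _ hz, mul_assoc]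
                simp
            _ ≤ (kap (A - n) i l * cI n A) * essSup (G l) volume := by
                exact mul_le_mul_left (UU_int i l x hA0) _
            _ ≤ (kap (1 + B) i l * cI n A) * essSup (G l) volume := by
                gcongr
                exact kap_mono (by linarith) i l
            _ = _ := by ring
      _ ≤ C A * (cI n A * (K * ⨆ l, kap B i l * essSup (G l) volume)) := by
          rw [ENNReal.tsum_mul_left]
          gcongr
          exact hk i _
      _ = _ := by ring
  · set pr := p.toReal with hpr
    have hp0 : 0 < pr := ENNReal.toReal_pos hp hpt
    set r := min pr 1 with hr
    have hr0 : 0 < r := lt_min hp0 one_pos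
    obtain ⟨A, hA⟩ := exists_nat_ge ((1 + B * pr + n) / r)
    have hA' : 1 + B * pr + n ≤ A * r := (div_le_iff₀ hr0).1 hA
    have hBp : 0 ≤ B * pr := by positivity
    have hA0 : (0:ℝ) < A * r := by have := Nat.cast_nonneg (α := ℝ) n; linarith
    have hcI : cI n (A * r) ≠ ∞ := cI_lt (by linarith)
    obtain ⟨K1, hK1, hk1⟩ := kap_sum (c := 1) (by norm_num)
    obtain ⟨K2, hK2, hk2⟩ := kap_sup (c := 1) (c' := B * pr) (by norm_num)
    refine ⟨A, fun C hC1 hCt => ?_⟩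
    -- pointwise estimate
    have key : ∃ K3 : ℝ≥0∞, K3 ≠ ∞ ∧ ∀ G : ℕ → Rn n → ℝ≥0∞, Good C G → ∀ i x,
        MM A G i x ^ pr ≤ K3 * ∫⁻ c, UU (i, x) c ^ (A * r) * G c.1 c.2 ^ pr ∂(muX n) := by
      rcases le_total pr 1 with h1 | h1
      · refine ⟨C A, hCt A, fun G hG i x => ?_⟩
        have h2 := absR (p := pr) UU_le_one UU_self UU_mul UU_meas hG.measX hG.HX hC1 hCt
          (by obtain ⟨A₀, h⟩ := hG.AP; exact ⟨A₀, fun a => h a.1 a.2⟩) A (i, x) hp0 h1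
        refine h2.trans (le_of_eq ?_)
        congr 1
        refine lintegral_congr fun c => ?_
        rw [ENNReal.mul_rpow_of_nonneg _ _ hp0.le, ← ENNReal.rpow_natCast, ← ENNReal.rpow_mul,
          hr, min_eq_left h1]
      · have hr1 : r = 1 := min_eq_right h1
        rw [hr1] at hA' hA0 hcI ⊢
        simp only [mul_one] at hA' hA0 hcI ⊢
        refine ⟨C A ^ pr * (K1 * cI n A) ^ (pr - 1), ?_, fun G hG i x => ?_⟩
        · refine ENNReal.mul_ne_top (ENNReal.rpow_ne_top_of_nonneg hp0.le (hCt A))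
            (ENNReal.rpow_ne_top_of_nonneg (by linarith) (ENNReal.mul_ne_top hK1 hcI))
        have h2 := absR_ge UU_mul UU_meas hG.measX hG.HX A (i, x) pr h1
        refine h2.trans ?_
        rw [mul_assoc]
        refine mul_le_mul_right (mul_le_mul' ?_ ?_) _
        · refine ENNReal.rpow_le_rpow ?_ (by linarith)
          rw [lint_muX ((UU_meas (i, x)).pow_const A)]
          calc _ ≤ ∑' l, kap 1 i l * cI n A := by
                refine ENNReal.tsum_le_tsum fun l => ?_
                have h3 := UU_int i l x hA0
                simp only [ENNReal.rpow_natCast] at h3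
                refine h3.trans ?_
                gcongr
                exact kap_mono (by linarith) i l
            _ ≤ _ := by rw [ENNReal.tsum_mul_right]; gcongr; exact hk1 i
        · simp
    obtain ⟨K3, hK3, hk3⟩ := key
    refine ⟨(K3 * (cI n (A * r) * K2)) ^ (1 / pr), ENNReal.rpow_ne_top_of_nonneg (by positivity)
      (by finiteness), fun G hG i => ?_⟩
    simp only [lpNormENN, hpt, if_false, ← hpr]
    have h1 : ∫⁻ x, MM A G i x ^ pr ≤ K3 * (cI n (A * r) * K2) * ⨆ l, kap (B * pr) i l * ∫⁻ z, G l z ^ pr := by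
      calc _ ≤ ∫⁻ x, K3 * ∫⁻ c, UU (i, x) c ^ (A * r) * G c.1 c.2 ^ pr ∂(muX n) :=
            lintegral_mono fun x => hk3 G hG i x
        _ = K3 * ∫⁻ x, ∫⁻ c, UU (i, x) c ^ (A * r) * G c.1 c.2 ^ pr ∂(muX n) :=
            lintegral_const_mul' _ _ hK3
        _ ≤ K3 * (cI n (A * r) * ∑' l, kap (A * r - n) i l * ∫⁻ z, G l z ^ pr) := by
            gcongr
            exact hG.int hA0 pr i
        _ ≤ K3 * (cI n (A * r) * ∑' l, kap (1 + B * pr) i l * ∫⁻ z, G l z ^ pr) := by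
            gcongr with l
            exact kap_mono (by linarith) i l
        _ ≤ K3 * (cI n (A * r) * (K2 * ⨆ l, kap (B * pr) i l * ∫⁻ z, G l z ^ pr)) := by
            gcongr
            exact hk2 i _
        _ = _ := by ring
    refine (ENNReal.rpow_le_rpow h1 (by positivity)).trans ?_
    rw [ENNReal.mul_rpow_of_nonneg _ _ (by positivity)]
    gcongr
    exact root_sup hp0 B i _

end BV

namespace BV

structure Sys (C : ℕ → ℝ) (r R : ℝ) (Λ Θ Υ : ℕ → Sch n) : Prop where
  bL : ∀ N k, pN N (dilate (Λ k) (2 ^ k)) ≤ C N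
  bT : ∀ N k, pN N (dilate (Θ k) (2 ^ k)) ≤ C N
  bU : ∀ N k, pN N (dilate (Υ k) (2 ^ k)) ≤ C N
  T0 : ∀ k, 1 ≤ k → ∀ x, ‖x‖ < r → dilate (Θ k) (2 ^ k) x = 0
  TR : ∀ k x, R < ‖x‖ → dilate (Θ k) (2 ^ k) x = 0
  sum : ∀ ξ, HasSum (fun k => Θ k ξ * Λ k ξ) 1
  loc : ∀ j k, k < j → ∀ ξ, (1 - Υ j ξ) * Λ j ξ * Θ k ξ = 0

lemma Sys.C_nonneg {C : ℕ → ℝ} {r R : ℝ} {Λ Θ Υ : ℕ → Sch n} (h : Sys C r R Λ Θ Υ) (N : ℕ) : 0 ≤ C N :=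
  (pN_nonneg _ _).trans (h.bL N 0)

lemma pN_add (N : ℕ) (a b : Sch n) : pN N (a + b) ≤ pN N a + pN N b := map_add_le_add _ a b
lemma pN_sub (N : ℕ) (a b : Sch n) : pN N (a - b) ≤ pN N a + pN N b := map_sub_le_add _ a b
lemma pN_zero (N : ℕ) : pN N (0 : Sch n) = 0 := map_zero _
lemma pN_neg (N : ℕ) (a : Sch n) : pN N (-a) = pN N a := map_neg_eq_map _ a

lemma pN_sum (N : ℕ) (s : Finset ℕ) (g : ℕ → Sch n) : pN N (∑ i ∈ s, g i) ≤ ∑ i ∈ s, pN N (g i) := by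
  induction s using Finset.cons_induction with
  | empty => simp [pN_zero]
  | cons a s ha ih =>
    rw [Finset.sum_cons, Finset.sum_cons]
    exact (pN_add _ _ _).trans (by gcongr)

lemma two_pow_ne (k : ℕ) : (2:ℝ) ^ k ≠ 0 := by positivity

lemma dilate_sub (a b : Sch n) (t : ℝ) : dilate (a - b) t = dilate a t - dilate b t := by
  by_cases h : t = 0
  · simp [dilate, h]
  · ext x; simp [dilate_apply, h]

lemma dec (N B : ℕ) (C : ℕ → ℝ) {r : ℝ} (hr : 0 < r) (R : ℝ) : ∃ D, 0 ≤ D ∧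
    ∀ Λ Θ Υ : ℕ → Sch n, Sys C r R Λ Θ Υ → ∀ (m : Sch n) (j k : ℕ), j ≤ k →
      pN N (mS (dilate m (2 ^ k)) (dilate (Θ k) (2 ^ k))) ≤
        D * (((2:ℝ) ^ (k - j)) ^ B)⁻¹ * pN (N + B) (dilate m (2 ^ j)) := by
  obtain ⟨D, hD, h⟩ := pN_decay (n := n) N B hr
  refine ⟨(D + 2 ^ N) * |C N|, by positivity, fun Λ Θ Υ hS m j k hjk => ?_⟩
  have hC := hS.C_nonneg N
  rw [abs_of_nonneg hC]
  rcases Nat.eq_zero_or_pos k with rfl | hk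
  · obtain rfl : j = 0 := by omega
    have h1 := pN_mS N (dilate m (2 ^ 0)) (dilate (Θ 0) (2 ^ 0))
    have h2 := pN_mono (Nat.le_add_right N B) (dilate m (2 ^ 0))
    have h3 := pN_nonneg N (dilate m (2 ^ 0))
    calc _ ≤ 2 ^ N * (pN (N + B) (dilate m (2 ^ 0)) * C N) := by
          refine h1.trans ?_
          gcongr
          · exact pN_nonneg _ _
          · exact pN_nonneg _ _
          · exact hS.bT N 0
      _ ≤ (D + 2 ^ N) * (pN (N + B) (dilate m (2 ^ 0)) * C N) := by
          have := pN_nonneg (N + B) (dilate m (2 ^ 0))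
          gcongr; linarith
      _ = _ := by simp; ring
  · have e : dilate m (2 ^ k) = dilate (dilate m (2 ^ j)) (2 ^ (k - j)) := by
      rw [dilate_dilate _ (two_pow_ne _) (two_pow_ne _), ← pow_add]; congr 2; omega
    rw [e]
    refine (h (dilate m (2 ^ j)) (dilate (Θ k) (2 ^ k)) (2 ^ (k - j)) (one_le_pow₀ (by norm_num))
      (hS.T0 k hk)).trans ?_
    have h3 := pN_nonneg (N + B) (dilate m (2 ^ j))
    calc _ ≤ D * (((2:ℝ) ^ (k - j)) ^ B)⁻¹ * (pN (N + B) (dilate m (2 ^ j)) * C N) := by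
          gcongr
          exact hS.bT N k
      _ ≤ (D + 2 ^ N) * (((2:ℝ) ^ (k - j)) ^ B)⁻¹ * (pN (N + B) (dilate m (2 ^ j)) * C N) := by
          gcongr
          have : (0:ℝ) ≤ 2 ^ N := by positivity
          linarith
      _ = _ := by ring

lemma Sys.summ {C : ℕ → ℝ} {r R : ℝ} {Λ Θ Υ : ℕ → Sch n} (h : Sys C r R Λ Θ Υ) (hr : 0 < r)
    (m : Sch n) (N : ℕ) : Summable fun k => pN N (mS (mS m (Θ k)) (Λ k)) := by
  obtain ⟨D, hD, hd⟩ := dec (n := n) N (2 * N + 1) C hr R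
  refine Summable.of_nonneg_of_le (fun k => pN_nonneg _ _) (fun k => ?_)
    ((summable_geometric_two).mul_left (2 ^ N * (D * pN (N + (2 * N + 1)) m * C N)))
  have h1 : mS (mS m (Θ k)) (Λ k) =
      dilate (mS (mS (dilate m (2 ^ k)) (dilate (Θ k) (2 ^ k))) (dilate (Λ k) (2 ^ k))) (((2:ℝ) ^ k)⁻¹) := by
    rw [← dilate_mS _ _ (two_pow_ne k), ← dilate_mS _ _ (two_pow_ne k),
      dilate_dilate _ (two_pow_ne k) (inv_ne_zero (two_pow_ne k)), mul_inv_cancel₀ (two_pow_ne k), dilate_one]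
  have h2 := hd Λ Θ Υ h m 0 k (Nat.zero_le k)
  rw [pow_zero, dilate_one, Nat.sub_zero] at h2
  have hk1 : (1:ℝ) ≤ 2 ^ k := one_le_pow₀ (by norm_num)
  have hC := h.C_nonneg N
  have h5 := pN_nonneg (N + (2 * N + 1)) m
  rw [h1]
  calc _ ≤ ((2:ℝ) ^ k) ^ (2 * N) * pN N (mS (mS (dilate m (2 ^ k)) (dilate (Θ k) (2 ^ k))) (dilate (Λ k) (2 ^ k))) :=
        pN_dilate N _ (by positivity) hk1 ((inv_le_one_of_one_le₀ hk1).trans hk1) (by simp)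
    _ ≤ ((2:ℝ) ^ k) ^ (2 * N) * (2 ^ N * (D * (((2:ℝ) ^ k) ^ (2 * N + 1))⁻¹ * pN (N + (2 * N + 1)) m * C N)) := by
        gcongr
        refine (pN_mS _ _ _).trans ?_
        gcongr
        · exact pN_nonneg _ _
        · exact h.bL N k
    _ = _ := by
        rw [pow_succ, one_div, inv_pow]
        field_simp

lemma Sys.expand {C : ℕ → ℝ} {r R : ℝ} {Λ Θ Υ : ℕ → Sch n} (h : Sys C r R Λ Θ Υ) (hr : 0 < r)
    (m : Sch n) (f : TDist n E) (y : Rn n) :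
    ‖mOp m f y‖ₑ ≤ ∑' k, ‖mOp (mS (mS m (Θ k)) (Λ k)) f y‖ₑ := by
  set g : ℕ → Sch n := fun k => mS (mS m (Θ k)) (Λ k) with hg
  have hgv' : ∀ ξ, ∃ K', ∀ k, K' ≤ k → ∀ᶠ η in 𝓝 ξ, ∀ k', k ≤ k' → g k' η = 0 := by
    intro ξ
    obtain ⟨K', hK'⟩ := pow_unbounded_of_one_lt ((‖ξ‖ + 1) / r) (by norm_num : (1:ℝ) < 2)
    refine ⟨K' + 1, fun k0 hk0 => ?_⟩
    filter_upwards [Metric.ball_mem_nhds ξ one_pos] with η hη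
    intro k hk
    have h1 : ‖η‖ < ‖ξ‖ + 1 := by
      have := norm_sub_norm_le η ξ
      rw [mem_ball, dist_eq_norm] at hη
      linarith
    have h2 : (2:ℝ) ^ K' ≤ 2 ^ k := pow_le_pow_right₀ (by norm_num) (by omega)
    have h3 : ‖((2:ℝ) ^ k)⁻¹ • η‖ < r := by
      rw [norm_smul, Real.norm_of_nonneg (by positivity), inv_mul_lt_iff₀ (by positivity)]
      rw [div_lt_iff₀ hr] at hK'
      nlinarith
    have h4 := h.T0 k (by omega) _ h3
    rw [dilate_apply _ (two_pow_ne k), smul_smul, mul_inv_cancel₀ (two_pow_ne k), one_smul] at h4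
    simp [hg, h4]
  have htend : ∀ N, Tendsto (fun K => pN N ((∑ k ∈ Finset.range K, g k) - m)) atTop (𝓝 0) := by
    intro N
    have hs := h.summ hr m N
    have ht := tendsto_sum_nat_add fun k => pN N (g k)
    refine squeeze_zero (fun K => pN_nonneg _ _) (fun K => ?_) ht
    refine pN_le (tsum_nonneg fun _ => pN_nonneg _ _) fun a ha l hl ξ => ?_
    obtain ⟨K₀, hK₀⟩ := hgv' ξ
    set K' := K + K₀ with hK'
    have he : ∀ᶠ η in 𝓝 ξ, ((∑ k ∈ Finset.range K, g k) - m + ∑ k ∈ Finset.range K₀, g (k + K)) η = 0 := by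
      filter_upwards [hK₀ K' (by omega)] with η hη
      have h1 : HasSum (fun k => g k η) (m η) := by
        have := (h.sum η).mul_left (m η)
        simpa [hg, mul_assoc] using this
      have h2 : HasSum (fun k => g k η) (∑ k ∈ Finset.range K', g k η) :=
        hasSum_sum_of_ne_finset_zero fun k hk => hη k (by simpa using hk)
      have h3 := h1.unique h2
      simp only [SchwartzMap.add_apply, SchwartzMap.sub_apply, SchwartzMap.sum_apply]
      rw [h3, hK', Finset.sum_range_add]
      simp only [add_comm K]
      ring
    have h0 := iFD_zero_of_eventually he l
    have h1 : iteratedFDeriv ℝ l ((∑ k ∈ Finset.range K, g k) - m : Sch n) ξ =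
        - iteratedFDeriv ℝ l (∑ k ∈ Finset.range K₀, g (k + K) : Sch n) ξ := by
      have hco : ∀ a b : Sch n, (⇑(a + b) : Rn n → ℂ) = ⇑a + ⇑b := fun _ _ => rfl
      rw [eq_neg_iff_add_eq_zero, ← h0, hco, iteratedFDeriv_add_apply]
      · exact (((∑ k ∈ Finset.range K, g k) - m : Sch n).smooth l).contDiffAt
      · exact ((∑ k ∈ Finset.range K₀, g (k + K) : Sch n).smooth l).contDiffAt
    rw [h1, norm_neg]
    calc _ ≤ pN N (∑ k ∈ Finset.range K₀, g (k + K)) := le_pN ha hl _ ξ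
      _ ≤ ∑ k ∈ Finset.range K₀, pN N (g (k + K)) := pN_sum N _ fun k => g (k + K)
      _ ≤ _ := ((summable_nat_add_iff K).2 hs).sum_le_tsum _ fun _ _ => pN_nonneg _ _
  have hT := (mOp_tendsto_of_pN f y _ m htend).enorm
  refine le_of_tendsto hT (Eventually.of_forall fun K => ?_)
  rw [mOp_sum]
  exact (enorm_sum_le _ _).trans (ENNReal.sum_le_tsum _)

end BV

namespace BV

def JJ (N k : ℕ) (y : Rn n) (g : Rn n → ℝ≥0∞) : ℝ≥0∞ :=
  (2:ℝ≥0∞) ^ ((k : ℝ) * n) * ∫⁻ z, ENNReal.ofReal (((1 + 2 ^ k * ‖y - z‖) ^ N)⁻¹) * g z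

lemma ofReal_two_pow (k : ℕ) : ENNReal.ofReal (((2:ℝ) ^ k) ^ n) = (2:ℝ≥0∞) ^ ((k : ℝ) * n) := by
  rw [← ofReal_two_rpow, Real.rpow_mul (by norm_num)]; simp

lemma CL (n N : ℕ) : ∃ (K : ℝ≥0∞) (N' : ℕ), K ≠ ∞ ∧ ∀ {E : Type*} [NormedAddCommGroup E] [NormedSpace ℂ E]
    (a b : Sch n) (f : TDist n E) (y : Rn n) (k : ℕ),
    ‖mOp (mS a b) f y‖ₑ ≤ K * ENNReal.ofReal (pN N' (dilate a (2 ^ k))) * JJ N k y fun z => ‖mOp b f z‖ₑ := by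
  obtain ⟨C, N', hC, h⟩ := kernel_bd (n := n) N
  refine ⟨ENNReal.ofReal C, N', ENNReal.ofReal_ne_top, fun {E} _ _ a b f y k => ?_⟩
  refine (mOp_mul f a b y).trans ?_
  have hm : Measurable fun z => ENNReal.ofReal (((1 + 2 ^ k * ‖y - z‖) ^ N)⁻¹) * ‖mOp b f z‖ₑ := by
    refine Measurable.mul ?_ (mOp_cont b f).enorm.measurable
    fun_prop
  rw [JJ, ← ofReal_two_pow, ← mul_assoc, ← lintegral_const_mul _ hm]
  refine lintegral_mono fun z => ?_
  rw [← mul_assoc]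
  refine mul_le_mul_left ?_ _
  have := h a (2 ^ k) (by positivity) (y - z)
  rw [← ofReal_norm, ← ENNReal.ofReal_mul hC, ← ENNReal.ofReal_mul (by have := pN_nonneg N' (dilate a (2^k)); positivity),
    ← ENNReal.ofReal_mul (by have := pN_nonneg N' (dilate a (2^k)); positivity)]
  refine ENNReal.ofReal_le_ofReal (this.trans (le_of_eq ?_))
  ring

lemma UU_pow_ge {i k : ℕ} (h : i ≤ k) (N : ℕ) (y z : Rn n) :
    ENNReal.ofReal ((((2:ℝ) ^ (k - i)) ^ N)⁻¹) * ENNReal.ofReal (((1 + 2 ^ k * ‖y - z‖) ^ N)⁻¹) ≤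
      UU (i, y) (k, z) ^ N := by
  rw [UU, ← ENNReal.ofReal_pow (uR_nonneg _ _), ← ENNReal.ofReal_mul (by positivity)]
  refine ENNReal.ofReal_le_ofReal ?_
  simp only [uR, h, if_true]
  rw [mul_pow, inv_pow, inv_pow]
  gcongr
  norm_num

lemma JJ_le {i k : ℕ} (h : i ≤ k) (N : ℕ) (y : Rn n) {g : Rn n → ℝ≥0∞} (hg : Measurable g) :
    ENNReal.ofReal ((((2:ℝ) ^ (k - i)) ^ N)⁻¹) * JJ N k y g ≤
      (2:ℝ≥0∞) ^ ((k : ℝ) * n) * ∫⁻ z, UU (i, y) (k, z) ^ N * g z := by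
  rw [JJ, mul_left_comm, ← lintegral_const_mul _ (by fun_prop)]
  refine mul_le_mul_right (lintegral_mono fun z => ?_) _
  rw [← mul_assoc]
  exact mul_le_mul_left (UU_pow_ge h N y z) _

lemma Sys.AP {C : ℕ → ℝ} {r R : ℝ} {Λ Θ Υ : ℕ → Sch n} (h : Sys C r R Λ Θ Υ) (f : TDist n E) :
    ∃ A₀ : ℕ, ∀ i x, MM A₀ (fun l z => ‖mOp (Λ l) f z‖ₑ) i x ≠ ∞ := by
  obtain ⟨C', N, hC', hb⟩ := mOp_bd f
  refine ⟨2 * N, fun i x => ?_⟩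
  have hC := h.C_nonneg N
  refine ne_top_of_le_ne_top (b := ENNReal.ofReal (C' * (1 + ‖x‖) ^ N * (((2:ℝ) ^ i) ^ (2 * N) * C N))) ENNReal.ofReal_ne_top ?_
  refine iSup_le fun b => ?_
  obtain ⟨l, z⟩ := b
  simp only
  rw [UU, ← ENNReal.ofReal_pow (uR_nonneg _ _), ← ofReal_norm, ← ENNReal.ofReal_mul (pow_nonneg (uR_nonneg _ _) _)]
  refine ENNReal.ofReal_le_ofReal ?_
  by_cases hil : i ≤ l
  swap
  · rcases Nat.eq_zero_or_pos N with rfl | hN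
    · have h1 := hb (Λ l) z
      simp only [pow_zero, mul_one, mul_zero, one_mul] at h1 ⊢
      refine h1.trans ?_
      have h2 := pN_dilate 0 (dilate (Λ l) (2 ^ l)) (t := ((2:ℝ)^l)⁻¹) (K := 2 ^ l) (by positivity) (one_le_pow₀ (by norm_num))
        ((inv_le_one_of_one_le₀ (one_le_pow₀ (by norm_num))).trans (one_le_pow₀ (by norm_num))) (by simp)
      rw [dilate_dilate _ (two_pow_ne l) (inv_ne_zero (two_pow_ne l)), mul_inv_cancel₀ (two_pow_ne l), dilate_one] at h2
      have h3 := h.bL 0 l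
      gcongr
      simpa using h2.trans (by simpa using h3)
    · have h0 : uR (i, x) (l, z) = 0 := by simp [uR, hil]
      rw [h0, zero_pow (by omega), zero_mul]
      positivity
  have h2 := pN_dilate N (dilate (Λ l) (2 ^ l)) (t := ((2:ℝ)^l)⁻¹) (K := 2 ^ l) (by positivity) (one_le_pow₀ (by norm_num))
    ((inv_le_one_of_one_le₀ (one_le_pow₀ (by norm_num))).trans (one_le_pow₀ (by norm_num))) (by simp)
  rw [dilate_dilate _ (two_pow_ne l) (inv_ne_zero (two_pow_ne l)), mul_inv_cancel₀ (two_pow_ne l), dilate_one] at h2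
  have h3 : pN N (Λ l) ≤ ((2:ℝ) ^ l) ^ (2 * N) * C N := h2.trans (by gcongr; exact h.bL N l)
  have h4 : ‖mOp (Λ l) f z‖ ≤ C' * ((1 + ‖x‖) * (1 + 2 ^ i * ‖x - z‖)) ^ N * (((2:ℝ) ^ l) ^ (2 * N) * C N) := by
    refine (hb (Λ l) z).trans ?_
    have := pN_nonneg N (Λ l)
    gcongr
    refine (one_add_norm_le x z).trans ?_
    gcongr
    rw [norm_sub_rev]
    refine le_mul_of_one_le_left (norm_nonneg _) (one_le_pow₀ (by norm_num))
  have e1 : (2:ℝ) ^ l = 2 ^ (l - i) * 2 ^ i := by rw [← pow_add]; congr 1; omega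
  set w := 1 + 2 ^ i * ‖x - z‖ with hw
  have hw1 : 1 ≤ w := by rw [hw]; have : 0 ≤ 2 ^ i * ‖x - z‖ := by positivity
                         linarith
  have e2 : uR (i, x) (l, z) = ((2:ℝ) ^ (l - i))⁻¹ * w⁻¹ := by simp [uR, hil, hw]
  calc uR (i, x) (l, z) ^ (2 * N) * ‖mOp (Λ l) f z‖
      ≤ (((2:ℝ) ^ (l - i))⁻¹ * w⁻¹) ^ (2 * N) * (C' * ((1 + ‖x‖) * w) ^ N * (((2:ℝ) ^ (l - i) * 2 ^ i) ^ (2 * N) * C N)) := by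
        rw [e2, ← e1]; gcongr
    _ = (C' * (1 + ‖x‖) ^ N * (((2:ℝ) ^ i) ^ (2 * N) * C N)) * (w ^ N)⁻¹ := by
        rw [mul_pow, mul_pow, mul_pow, show w⁻¹ ^ (2 * N) = (w ^ N)⁻¹ * (w ^ N)⁻¹ by rw [two_mul, pow_add, inv_pow],
          inv_pow ((2:ℝ) ^ (l - i))]
        field_simp
    _ ≤ _ := mul_le_of_le_one_right (by positivity) (inv_le_one_of_one_le₀ (one_le_pow₀ hw1))

lemma Sys.good (C : ℕ → ℝ) {r : ℝ} (hr : 0 < r) (R : ℝ) : ∃ CC : ℕ → ℝ≥0∞, (∀ N, 1 ≤ CC N) ∧ (∀ N, CC N ≠ ∞) ∧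
    ∀ {E : Type*} [NormedAddCommGroup E] [NormedSpace ℂ E] (Λ Θ Υ : ℕ → Sch n), Sys C r R Λ Θ Υ →
      ∀ f : TDist n E, Good CC (fun l z => ‖mOp (Λ l) f z‖ₑ) := by
  choose K N' hK hCL using fun N => CL n N
  choose D hD hdec using fun N => dec (n := n) (N' N) N C hr R
  refine ⟨fun N => 1 + K N * ENNReal.ofReal (C (N' N)) +
    K N * ENNReal.ofReal (D N * (C (N' N + N) + 2 ^ (N' N + N) * (C (N' N + N) * C (N' N + N)))),
    fun N => ?_, fun N => ?_, fun {E} _ _ Λ Θ Υ h f => ⟨fun l => (mOp_cont _ f).enorm.measurable, fun l z => enorm_ne_top, fun N i x => ?_, h.AP f⟩⟩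
  · simp only; rw [add_assoc]; exact le_self_add
  · simp [ENNReal.mul_ne_top, hK]
  set G : ℕ → Rn n → ℝ≥0∞ := fun l z => ‖mOp (Λ l) f z‖ₑ with hG
  have hGm : ∀ l, Measurable (G l) := fun l => (mOp_cont _ f).enorm.measurable
  set a : ℕ → ℝ≥0∞ := fun l => (2:ℝ≥0∞) ^ ((l : ℝ) * n) * ∫⁻ z, UU (i, x) (l, z) ^ N * G l z with ha
  set m := Λ i - mS (Υ i) (Λ i) with hm
  have e : mOp (Λ i) f x = mOp (mS (Υ i) (Λ i)) f x + mOp m f x := by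
    rw [hm, mOp_sub]; abel
  have h1 : ‖mOp (mS (Υ i) (Λ i)) f x‖ₑ ≤ K N * ENNReal.ofReal (C (N' N)) * ∑' l, a l := by
    refine (hCL N (Υ i) (Λ i) f x i).trans ?_
    gcongr
    · exact h.bU _ _
    · refine le_trans ?_ (ENNReal.le_tsum i)
      have := JJ_le (le_refl i) N x (hGm i)
      simpa using this
  have hbm : pN (N' N + N) (dilate m (2 ^ i)) ≤ C (N' N + N) + 2 ^ (N' N + N) * (C (N' N + N) * C (N' N + N)) := by
    rw [hm, dilate_sub, dilate_mS _ _ (two_pow_ne i)]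
    refine (pN_sub _ _ _).trans (add_le_add (h.bL _ _) ((pN_mS _ _ _).trans ?_))
    have := h.C_nonneg (N' N + N)
    gcongr
    · exact pN_nonneg _ _
    · exact h.bU _ _
    · exact h.bL _ _
  have h2 : ‖mOp m f x‖ₑ ≤ K N * ENNReal.ofReal (D N * (C (N' N + N) + 2 ^ (N' N + N) * (C (N' N + N) * C (N' N + N)))) * ∑' l, a l := by
    refine (h.expand hr m f x).trans ?_
    rw [← ENNReal.tsum_mul_left]
    refine ENNReal.tsum_le_tsum fun k => ?_
    rcases lt_or_ge k i with hk | hk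
    · have : mS m (Θ k) = 0 := by
        ext ξ
        have := h.loc i k hk ξ
        simp only [mS_apply, hm, sub_apply, zero_apply]
        rw [← this]; ring
      have h0 : mS (mS m (Θ k)) (Λ k) = 0 := by ext ξ; simp [this]
      have h00 : mOp (0 : Sch n) f x = 0 := by simpa using mOp_sub f x (0 : Sch n) 0
      rw [h0, h00]; simp
    · refine (hCL N _ (Λ k) f x k).trans ?_
      rw [dilate_mS _ _ (two_pow_ne k)]
      have h3 := hdec N Λ Θ Υ h m i k hk
      have h4 : pN (N' N) (mS (dilate m (2 ^ k)) (dilate (Θ k) (2 ^ k))) ≤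
          (D N * (C (N' N + N) + 2 ^ (N' N + N) * (C (N' N + N) * C (N' N + N)))) * (((2:ℝ) ^ (k - i)) ^ N)⁻¹ := by
        refine h3.trans ?_
        rw [mul_right_comm]
        have := hD N
        gcongr
      have hpos : 0 ≤ D N * (C (N' N + N) + 2 ^ (N' N + N) * (C (N' N + N) * C (N' N + N))) := by
        have := hD N; have := h.C_nonneg (N' N + N); positivity
      calc _ ≤ K N * ENNReal.ofReal ((D N * (C (N' N + N) + 2 ^ (N' N + N) * (C (N' N + N) * C (N' N + N)))) * (((2:ℝ) ^ (k - i)) ^ N)⁻¹) * JJ N k x (G k) := by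
            gcongr
        _ = K N * ENNReal.ofReal (D N * (C (N' N + N) + 2 ^ (N' N + N) * (C (N' N + N) * C (N' N + N)))) * (ENNReal.ofReal ((((2:ℝ) ^ (k - i)) ^ N)⁻¹) * JJ N k x (G k)) := by
            rw [ENNReal.ofReal_mul hpos]; ring
        _ ≤ _ := mul_le_mul_right (JJ_le hk N x (hGm k)) _
  calc G i x ≤ ‖mOp (mS (Υ i) (Λ i)) f x‖ₑ + ‖mOp m f x‖ₑ := by
        rw [hG]; simp only; rw [e]; exact enorm_add_le _ _
    _ ≤ _ := by
        refine (add_le_add h1 h2).trans ?_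
        rw [← add_mul]
        refine mul_le_mul_left ?_ _
        rw [add_assoc]; exact le_add_self

end BV

namespace BV

lemma lp_mono (p : ℝ≥0∞) {g h : Rn n → ℝ≥0∞} (H : ∀ x, g x ≤ h x) : lpNormENN p g ≤ lpNormENN p h := by
  unfold lpNormENN
  split_ifs
  · exact essSup_mono_ae (Eventually.of_forall H)
  · refine ENNReal.rpow_le_rpow (lintegral_mono fun x => ENNReal.rpow_le_rpow (H x) (by positivity)) (by positivity)

lemma lp_const {p : ℝ≥0∞} (hp : p ≠ 0) {c : ℝ≥0∞} (hc : c ≠ ∞) (g : Rn n → ℝ≥0∞) :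
    lpNormENN p (fun x => c * g x) = c * lpNormENN p g := by
  unfold lpNormENN
  split_ifs with h
  · exact ENNReal.essSup_const_mul
  · have h0 : 0 < p.toReal := ENNReal.toReal_pos hp h
    simp only [ENNReal.mul_rpow_of_nonneg _ _ h0.le]
    rw [lintegral_const_mul' _ _ (ENNReal.rpow_ne_top_of_nonneg h0.le hc), ENNReal.mul_rpow_of_nonneg _ _ (by positivity),
      ← ENNReal.rpow_mul, mul_one_div_cancel h0.ne', ENNReal.rpow_one]

lemma kap_symm (c : ℝ) (i l : ℕ) : kap c i l = kap c l i := by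
  rw [kap, kap, abs_sub_comm]

lemma schur {q : ℝ≥0∞} (hq : q ≠ 0) {δ : ℝ} (hδ : 0 < δ) : ∃ K : ℝ≥0∞, K ≠ ∞ ∧ ∀ H : ℕ → ℝ≥0∞,
    lqSum q (fun i => ⨆ l, kap δ i l * H l) ≤ K * lqSum q H := by
  by_cases hqt : q = ∞
  · refine ⟨1, by simp, fun H => ?_⟩
    simp only [lqSum, hqt, if_true, one_mul]
    refine iSup_le fun i => iSup_mono fun l => ?_
    exact mul_le_of_le_one_left bot_le (kap_le_one hδ.le i l)
  · have h0 : 0 < q.toReal := ENNReal.toReal_pos hq hqt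
    obtain ⟨K, hK, hk⟩ := kap_sum (c := δ * q.toReal) (by positivity)
    refine ⟨K ^ (1 / q.toReal), ENNReal.rpow_ne_top_of_nonneg (by positivity) hK, fun H => ?_⟩
    simp only [lqSum, hqt, if_false]
    rw [← ENNReal.mul_rpow_of_nonneg _ _ (by positivity)]
    refine ENNReal.rpow_le_rpow ?_ (by positivity)
    calc _ ≤ ∑' i, ∑' l, kap (δ * q.toReal) i l * H l ^ q.toReal := by
          refine ENNReal.tsum_le_tsum fun i => ?_
          rw [← ENNReal.le_rpow_inv_iff h0]
          refine iSup_le fun l => ?_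
          rw [ENNReal.le_rpow_inv_iff h0, ENNReal.mul_rpow_of_nonneg _ _ h0.le, kap_rpow]
          exact ENNReal.le_tsum l
      _ = ∑' l, (∑' i, kap (δ * q.toReal) l i) * H l ^ q.toReal := by
          rw [ENNReal.tsum_comm]
          refine tsum_congr fun l => ?_
          rw [← ENNReal.tsum_mul_right]
          simp only [kap_symm _ l]
      _ ≤ ∑' l, K * H l ^ q.toReal := ENNReal.tsum_le_tsum fun l => mul_le_mul_left (hk l) _
      _ = _ := ENNReal.tsum_mul_left

lemma JJ_MM (A i k : ℕ) {d : ℝ} (hd : 0 ≤ d) (G : ℕ → Rn n → ℝ≥0∞) {x y : Rn n} (h : dist x y ≤ d * ((2:ℝ) ^ i)⁻¹) :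
    JJ (A + (n + 1)) k y (G k) ≤ ENNReal.ofReal (((1 + d) * 2 ^ (k - i)) ^ A) * cI n (n + 1) * MM A G k x := by
  have h1 : ∀ z, ENNReal.ofReal (((1 + 2 ^ k * ‖y - z‖) ^ (A + (n + 1)))⁻¹) * G k z ≤
      ENNReal.ofReal (((1 + d) * 2 ^ (k - i)) ^ A) * MM A G k x * ENNReal.ofReal ((1 + 2 ^ k * ‖y - z‖) ^ (-((n : ℝ) + 1))) := by
    intro z
    have h2 : UU (k, x) (k, z) ^ A * G k z ≤ MM A G k x := le_iSup (fun b : ℕ × Rn n => UU (k, x) b ^ A * G b.1 b.2) (k, z)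
    have h3 : 1 + 2 ^ k * ‖x - z‖ ≤ ((1 + d) * 2 ^ (k - i)) * (1 + 2 ^ k * ‖y - z‖) := by
      have h4 : (2:ℝ) ^ k ≤ 2 ^ (k - i) * 2 ^ i := by
        rw [← pow_add]; exact pow_le_pow_right₀ (by norm_num) (by omega)
      have h5 : 2 ^ k * ‖x - y‖ ≤ 2 ^ (k - i) * d := by
        rw [dist_eq_norm] at h
        calc _ ≤ (2 ^ (k - i) * 2 ^ i) * (d * ((2:ℝ) ^ i)⁻¹) := by gcongr
          _ = _ := by field_simp
      have h6 : ‖x - z‖ ≤ ‖x - y‖ + ‖y - z‖ := by simpa using norm_add_le (x - y) (y - z)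
      have h7 : (1:ℝ) ≤ 2 ^ (k - i) := one_le_pow₀ (by norm_num)
      have h8 : (0:ℝ) ≤ 2 ^ k * ‖y - z‖ := by positivity
      have h9 : (2:ℝ) ^ k * ‖x - z‖ ≤ 2 ^ k * ‖x - y‖ + 2 ^ k * ‖y - z‖ := by rw [← mul_add]; gcongr
      have h10 : 1 + 2 ^ (k - i) * d ≤ (1 + d) * 2 ^ (k - i) := by linarith
      have h11 : 1 ≤ (1 + d) * 2 ^ (k - i) := by nlinarith
      nlinarith
    set w := 1 + 2 ^ k * ‖y - z‖ with hw
    have hw1 : 0 < w := by positivity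
    have hv1 : 0 < 1 + 2 ^ k * ‖x - z‖ := by positivity
    have e : UU (k, x) (k, z) ^ A = ENNReal.ofReal (((1 + 2 ^ k * ‖x - z‖) ^ A)⁻¹) := by
      rw [UU, ← ENNReal.ofReal_pow (uR_nonneg _ _)]; simp [uR]
    calc _ ≤ ENNReal.ofReal (((1 + d) * 2 ^ (k - i)) ^ A * ((1 + 2 ^ k * ‖x - z‖) ^ A)⁻¹ * w ^ (-((n : ℝ) + 1))) * G k z := by
          refine mul_le_mul_left (ENNReal.ofReal_le_ofReal ?_) _
          rw [Real.rpow_neg hw1.le, pow_add, mul_inv]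
          have : w ^ ((n : ℝ) + 1) = w ^ (n + 1) := by exact_mod_cast Real.rpow_natCast w (n + 1)
          rw [this]
          refine mul_le_mul_of_nonneg_right ?_ (by positivity)
          rw [← div_eq_mul_inv, le_div_iff₀ (by positivity), inv_mul_le_iff₀ (by positivity), ← mul_pow]
          refine pow_le_pow_left₀ hv1.le (h3.trans (le_of_eq (mul_comm _ _))) _
      _ = ENNReal.ofReal (((1 + d) * 2 ^ (k - i)) ^ A) * (UU (k, x) (k, z) ^ A * G k z) * ENNReal.ofReal (w ^ (-((n : ℝ) + 1))) := by
          rw [e, ENNReal.ofReal_mul (by positivity), ENNReal.ofReal_mul (by positivity)]; ring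
      _ ≤ _ := mul_le_mul_left (mul_le_mul_right h2 _) _
  calc _ ≤ (2:ℝ≥0∞) ^ ((k : ℝ) * n) * ∫⁻ z, ENNReal.ofReal (((1 + d) * 2 ^ (k - i)) ^ A) * MM A G k x * ENNReal.ofReal ((1 + 2 ^ k * ‖y - z‖) ^ (-((n : ℝ) + 1))) :=
        mul_le_mul_right (lintegral_mono h1) _
    _ = ((2:ℝ≥0∞) ^ ((k : ℝ) * n) * 2 ^ (-((k : ℝ) * n))) * (ENNReal.ofReal (((1 + d) * 2 ^ (k - i)) ^ A) * cI n (n + 1) * MM A G k x) := by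
        rw [lintegral_const_mul _ (by fun_prop), lint_scale, cI]; ring
    _ = _ := by rw [← two_rpow_add, add_neg_cancel, ENNReal.rpow_zero, one_mul]

lemma wt_le (s δ : ℝ) (A B i k : ℕ) (hB : A + 3 * δ + |s| ≤ B) {W v : ℝ} (hW : 0 ≤ W)
    (h1 : k ≤ i → v ≤ W * 2 ^ (((k : ℝ) - i) * (s + 3 * δ))) (h2 : i ≤ k → v ≤ W * (((2:ℝ) ^ (k - i)) ^ B)⁻¹) :
    (2:ℝ≥0∞) ^ ((i : ℝ) * s) * (ENNReal.ofReal v * ENNReal.ofReal ((2 ^ (k - i)) ^ A)) ≤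
      ENNReal.ofReal W * (kap (δ + (δ + δ)) i k * 2 ^ ((k : ℝ) * s)) := by
  rcases le_total k i with h | h
  · have e : k - i = 0 := by omega
    have hc : (k : ℝ) ≤ i := by exact_mod_cast h
    rw [e]; simp only [pow_zero, one_pow, ENNReal.ofReal_one, mul_one]
    refine (mul_le_mul_right (ENNReal.ofReal_le_ofReal (h1 h)) _).trans (le_of_eq ?_)
    rw [ENNReal.ofReal_mul hW, ofReal_two_rpow, kap, mul_left_comm, ← two_rpow_add, ← two_rpow_add,
      abs_of_nonpos (by linarith)]
    congr 2; ring
  · have hc : (i : ℝ) ≤ k := by exact_mod_cast h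
    have ep : ∀ M : ℕ, ((2:ℝ) ^ (k - i)) ^ M = 2 ^ (((k : ℝ) - i) * M) := by
      intro M
      rw [← Nat.cast_sub h, Real.rpow_mul (by norm_num)]; simp
    refine (mul_le_mul_right (mul_le_mul_left (ENNReal.ofReal_le_ofReal (h2 h)) _) _).trans ?_
    rw [ENNReal.ofReal_mul hW, ep, ep, ← Real.rpow_neg (by norm_num), ofReal_two_rpow, ofReal_two_rpow, kap, mul_assoc (ENNReal.ofReal W), mul_left_comm,
      ← two_rpow_add, ← two_rpow_add, ← two_rpow_add]
    refine mul_le_mul_right (two_rpow_mono ?_) _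
    rw [abs_of_nonneg (by linarith)]
    have := neg_abs_le s
    nlinarith

theorem FC {p : ℝ≥0∞} (hp : p ≠ 0) (s : ℝ) {δ : ℝ} (hδ : 0 < δ) (C : ℕ → ℝ) {r : ℝ} (hr : 0 < r) (R : ℝ) {d : ℝ} (hd : 0 ≤ d) :
    ∃ (N' B : ℕ) (K : ℝ≥0∞), K ≠ ∞ ∧ ∀ {E : Type*} [NormedAddCommGroup E] [NormedSpace ℂ E] (Λ Θ Υ : ℕ → Sch n), Sys C r R Λ Θ Υ →
      ∀ (f : TDist n E) (i : ℕ) (𝓜 : Set (Sch n)) (F : Rn n → ℝ≥0∞) (W : ℝ), 0 ≤ W →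
      (∀ m ∈ 𝓜, ∀ k, k ≤ i → pN N' (mS (dilate m (2 ^ k)) (dilate (Θ k) (2 ^ k))) ≤ W * 2 ^ (((k : ℝ) - i) * (s + 3 * δ))) →
      (∀ m ∈ 𝓜, ∀ k, i ≤ k → pN N' (mS (dilate m (2 ^ k)) (dilate (Θ k) (2 ^ k))) ≤ W * (((2:ℝ) ^ (k - i)) ^ B)⁻¹) →
      (∀ x c, (∀ m ∈ 𝓜, ∀ y, dist x y ≤ d * ((2:ℝ) ^ i)⁻¹ → ‖mOp m f y‖ₑ ≤ c) → F x ≤ c) →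
      (2:ℝ≥0∞) ^ ((i : ℝ) * s) * lpNormENN p F ≤
        K * ENNReal.ofReal W * ⨆ l, kap δ i l * ((2:ℝ≥0∞) ^ ((l : ℝ) * s) * lpNormENN p (fun z => ‖mOp (Λ l) f z‖ₑ)) := by
  obtain ⟨A, hA⟩ := RN n hp (δ + |s|) (by positivity)
  obtain ⟨CC, hCC1, hCC2, hgood⟩ := Sys.good (n := n) C hr R
  obtain ⟨K4, hK4, h4⟩ := hA CC hCC1 hCC2
  obtain ⟨K1, N', hK1, hCL⟩ := CL n (A + (n + 1))
  obtain ⟨B, hB⟩ := exists_nat_ge ((A : ℝ) + 3 * δ + |s|)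
  obtain ⟨K3, hK3, h3⟩ := lp_sum (n := n) hp hδ δ
  set c0 : ℝ≥0∞ := K1 * (ENNReal.ofReal ((1 + d) ^ A) * cI n (n + 1)) with hc0
  have hc0t : c0 ≠ ∞ := ENNReal.mul_ne_top hK1 (ENNReal.mul_ne_top ENNReal.ofReal_ne_top (cI_lt (by linarith)))
  refine ⟨N', B, c0 * (K3 * K4), ENNReal.mul_ne_top hc0t (ENNReal.mul_ne_top hK3 hK4), fun {E} _ _ Λ Θ Υ hS f i 𝓜 F W hW hw1 hw2 hF => ?_⟩
  set G : ℕ → Rn n → ℝ≥0∞ := fun l z => ‖mOp (Λ l) f z‖ₑ with hG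
  have hGood : Good CC G := hgood Λ Θ Υ hS f
  set hh : ℕ → Rn n → ℝ≥0∞ := fun k x => (2:ℝ≥0∞) ^ ((k : ℝ) * s) * MM A G k x with hhh
  have hhm : ∀ k, Measurable (hh k) := fun k => (MM_meas A G hGood.fin k).const_mul _
  have hpt : ∀ x, (2:ℝ≥0∞) ^ ((i : ℝ) * s) * F x ≤ (c0 * ENNReal.ofReal W) * ∑' k, kap (δ + (δ + δ)) i k * hh k x := by
    intro x
    rw [mul_comm, ← ENNReal.le_div_iff_mul_le (Or.inl (two_rpow_ne_zero _)) (Or.inl (two_rpow_ne_top _))]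
    refine hF x _ fun m hm y hy => ?_
    rw [ENNReal.le_div_iff_mul_le (Or.inl (two_rpow_ne_zero _)) (Or.inl (two_rpow_ne_top _)), mul_comm]
    refine (mul_le_mul_right (hS.expand hr m f y) _).trans ?_
    rw [← ENNReal.tsum_mul_left, ← ENNReal.tsum_mul_left]
    refine ENNReal.tsum_le_tsum fun k => ?_
    have h5 := hCL (mS m (Θ k)) (Λ k) f y k
    rw [dilate_mS _ _ (two_pow_ne k)] at h5
    have h6 := JJ_MM A i k hd G hy
    have h7 := wt_le s δ A B i k hB hW (hw1 m hm k) (hw2 m hm k)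
    calc _ ≤ (2:ℝ≥0∞) ^ ((i : ℝ) * s) * (K1 * ENNReal.ofReal (pN N' (mS (dilate m (2 ^ k)) (dilate (Θ k) (2 ^ k)))) *
          (ENNReal.ofReal (((1 + d) * 2 ^ (k - i)) ^ A) * cI n (n + 1) * MM A G k x)) :=
          mul_le_mul_right (h5.trans (mul_le_mul_right h6 _)) _
      _ = c0 * ((2:ℝ≥0∞) ^ ((i : ℝ) * s) * (ENNReal.ofReal (pN N' (mS (dilate m (2 ^ k)) (dilate (Θ k) (2 ^ k)))) * ENNReal.ofReal ((2 ^ (k - i)) ^ A))) * MM A G k x := by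
          rw [mul_pow, ENNReal.ofReal_mul (by positivity), hc0]; ring
      _ ≤ c0 * (ENNReal.ofReal W * (kap (δ + (δ + δ)) i k * 2 ^ ((k : ℝ) * s))) * MM A G k x :=
          mul_le_mul_left (mul_le_mul_right h7 _) _
      _ = _ := by rw [hhh]; ring
  calc _ = lpNormENN p fun x => (2:ℝ≥0∞) ^ ((i : ℝ) * s) * F x := (lp_const hp (two_rpow_ne_top _) _).symm
    _ ≤ lpNormENN p fun x => (c0 * ENNReal.ofReal W) * ∑' k, kap (δ + (δ + δ)) i k * hh k x := lp_mono p hpt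
    _ = (c0 * ENNReal.ofReal W) * lpNormENN p fun x => ∑' k, kap (δ + (δ + δ)) i k * hh k x :=
        lp_const hp (ENNReal.mul_ne_top hc0t ENNReal.ofReal_ne_top) _
    _ ≤ (c0 * ENNReal.ofReal W) * (K3 * ⨆ k, kap δ i k * lpNormENN p (hh k)) := mul_le_mul_right (h3 i hh hhm) _
    _ ≤ (c0 * ENNReal.ofReal W) * (K3 * (K4 * ⨆ l, kap δ i l * ((2:ℝ≥0∞) ^ ((l : ℝ) * s) * lpNormENN p (G l)))) := by
        refine mul_le_mul_right (mul_le_mul_right (iSup_le fun k => ?_) _) _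
        rw [hhh]
        simp only
        rw [lp_const hp (two_rpow_ne_top _)]
        calc _ ≤ kap δ i k * ((2:ℝ≥0∞) ^ ((k : ℝ) * s) * (K4 * ⨆ l, kap (δ + |s|) k l * lpNormENN p (G l))) :=
              mul_le_mul_right (mul_le_mul_right (h4 G hGood k) _) _
          _ = K4 * ⨆ l, kap δ i k * ((2:ℝ≥0∞) ^ ((k : ℝ) * s) * (kap (δ + |s|) k l * lpNormENN p (G l))) := by
              rw [mul_left_comm _ K4, mul_left_comm _ K4, ENNReal.mul_iSup, ENNReal.mul_iSup]
          _ ≤ _ := by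
              refine mul_le_mul_right (iSup_mono fun l => ?_) _
              calc _ ≤ kap δ i k * ((kap δ k l * 2 ^ ((l : ℝ) * s)) * lpNormENN p (G l)) := by
                    rw [← mul_assoc ((2:ℝ≥0∞) ^ _)]
                    exact mul_le_mul_right (mul_le_mul_left (kap_shift le_rfl k l) _) _
                _ = (kap δ i k * kap δ k l) * (2 ^ ((l : ℝ) * s) * lpNormENN p (G l)) := by ring
                _ ≤ _ := mul_le_mul_left (kap_tri hδ.le i k l) _
    _ = _ := by ring

end BV

namespace BV

lemma bump (n : ℕ) {a b : ℝ} (ha : 0 < a) (hab : a < b) :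
    ∃ χ : Sch n, (∀ x, ‖x‖ ≤ a → χ x = 1) ∧ ∀ x, b ≤ ‖x‖ → χ x = 0 := by
  let g : ContDiffBump (0 : Rn n) := ⟨a, b, ha, hab⟩
  have h1 : HasCompactSupport fun x => ((g x : ℝ) : ℂ) := g.hasCompactSupport.comp_left Complex.ofReal_zero
  have h2 : ContDiff ℝ (⊤ : ℕ∞) fun x => ((g x : ℝ) : ℂ) := Complex.ofRealCLM.contDiff.comp g.contDiff
  refine ⟨h1.toSchwartzMap h2, fun x hx => ?_, fun x hx => ?_⟩
  · have := g.one_of_mem_closedBall (x := x) (by simpa using hx)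
    change ((g x : ℝ) : ℂ) = 1
    simp [this]
  · have := g.zero_of_le_dist (x := x) (by simpa using hx)
    change ((g x : ℝ) : ℂ) = 0
    simp [this]

lemma dil_inv (χ : Sch n) (k : ℕ) : dilate (dilate χ ((2:ℝ) ^ k)⁻¹) (2 ^ k) = χ := by
  rw [dilate_dilate _ (inv_ne_zero (two_pow_ne k)) (two_pow_ne k), inv_mul_cancel₀ (two_pow_ne k), dilate_one]

lemma phi_bd {φ : ℕ → Sch n} (hφ : SmoothResolution n φ) : ∃ C : ℕ → ℝ, ∀ N k, pN N (dilate (φ k) (2 ^ k)) ≤ C N := by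
  choose c hc using hφ.deriv_bound
  refine ⟨fun N => 2 ^ N * ((∑ l ∈ Finset.range (N + 1), (Fintype.card (Fin l → Fin n) : ℝ)) * ∑ α : Fin n → Fin (N + 1), |c fun i => α i|), fun N k => ?_⟩
  refine pN_le (by positivity) fun a ha l hl x => ?_
  by_cases hx : 2 < ‖x‖
  · have h0 : iteratedFDeriv ℝ l (dilate (φ k) (2 ^ k)) x = 0 := by
      refine iFD_zero_of_eventually ?_ l
      filter_upwards [(isOpen_lt continuous_const continuous_norm).mem_nhds hx] with y hy
      rw [dilate_apply _ (two_pow_ne k)]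
      by_contra hne
      have hn : ‖(2:ℝ) ^ k • y‖ = 2 ^ k * ‖y‖ := by rw [norm_smul]; simp
      have hy' : 2 < ‖y‖ := hy
      have hk : (0:ℝ) < 2 ^ k := by positivity
      rcases Nat.eq_zero_or_pos k with rfl | hk0
      · have := hφ.supp0 hne
        simp at this; linarith
      · have := (hφ.suppj k hk0 hne).2
        rw [hn, Real.rpow_add (by norm_num), Real.rpow_natCast, Real.rpow_one] at this
        nlinarith
    rw [h0, norm_zero, mul_zero]
    positivity
  · push Not at hx
    have h1 : ‖iteratedFDeriv ℝ l (φ k) ((2:ℝ) ^ k • x)‖ ≤ Fintype.card (Fin l → Fin n) * ((∑ α : Fin n → Fin (N + 1), |c fun i => α i|) * (((2:ℝ) ^ k) ^ l)⁻¹) := by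
      refine norm_iFD_le_of_mderiv _ l _ _ fun α hα => ?_
      refine (hc α k _).trans ?_
      have e : (2:ℝ) ^ (-(k : ℝ) * (mdeg α : ℝ)) = (((2:ℝ) ^ k) ^ l)⁻¹ := by
        rw [hα, neg_mul, Real.rpow_neg (by norm_num), Real.rpow_mul (by norm_num)]; simp
      rw [e]
      gcongr
      have hαi : ∀ i, α i < N + 1 := fun i => by
        have : α i ≤ mdeg α := Finset.single_le_sum (f := α) (fun _ _ => Nat.zero_le _) (Finset.mem_univ i)
        omega
      refine (le_abs_self _).trans ?_
      exact Finset.single_le_sum (f := fun α : Fin n → Fin (N + 1) => |c fun i => α i|) (fun _ _ => abs_nonneg _)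
        (Finset.mem_univ (fun i => (⟨α i, hαi i⟩ : Fin (N + 1))))
    rw [norm_iFD_dilate _ (by positivity)]
    have h2 : ‖x‖ ^ a ≤ 2 ^ N := by
      calc ‖x‖ ^ a ≤ 2 ^ a := by gcongr
        _ ≤ _ := pow_le_pow_right₀ (by norm_num) ha
    have h3 : (Fintype.card (Fin l → Fin n) : ℝ) ≤ ∑ l ∈ Finset.range (N + 1), (Fintype.card (Fin l → Fin n) : ℝ) :=
      Finset.single_le_sum (f := fun l => (Fintype.card (Fin l → Fin n) : ℝ)) (fun _ _ => by positivity) (Finset.mem_range.2 (by omega))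
    have hS : 0 ≤ ∑ α : Fin n → Fin (N + 1), |c fun i => α i| := Finset.sum_nonneg fun _ _ => abs_nonneg _
    refine mul_le_mul h2 ?_ (by positivity) (by positivity)
    calc _ ≤ ((2:ℝ) ^ k) ^ l * (Fintype.card (Fin l → Fin n) * ((∑ α : Fin n → Fin (N + 1), |c fun i => α i|) * (((2:ℝ) ^ k) ^ l)⁻¹)) := by gcongr
      _ = Fintype.card (Fin l → Fin n) * ∑ α : Fin n → Fin (N + 1), |c fun i => α i| := by field_simp
      _ ≤ _ := by gcongr

lemma phi_sys {φ : ℕ → Sch n} (hφ : SmoothResolution n φ) : ∃ (C : ℕ → ℝ) (Θ Υ : ℕ → Sch n), Sys C (1 / 4) 4 φ Θ Υ := by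
  obtain ⟨C, hC⟩ := phi_bd hφ
  obtain ⟨χ₀, h1, h2⟩ := bump n (a := 2) (b := 4) (by norm_num) (by norm_num)
  obtain ⟨χ₁, h3, h4⟩ := bump n (a := 1 / 4) (b := 1 / 2) (by norm_num) (by norm_num)
  set χ : ℕ → Sch n := fun k => if k = 0 then χ₀ else χ₀ - χ₁ with hχ
  have hdil : ∀ k, dilate (dilate (χ k) ((2:ℝ) ^ k)⁻¹) (2 ^ k) = χ k := fun k => dil_inv _ k
  have hT : ∀ N k, pN N (χ k) ≤ C N + (pN N χ₀ + pN N (χ₀ - χ₁)) := by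
    intro N k
    have h5 := (pN_nonneg N (dilate (φ 0) (2 ^ 0))).trans (hC N 0)
    have h6 := pN_nonneg N χ₀
    have h7 := pN_nonneg N (χ₀ - χ₁)
    simp only [hχ]; split_ifs <;> linarith
  have hone : ∀ k ξ, dilate (χ k) ((2:ℝ) ^ k)⁻¹ ξ * φ k ξ = φ k ξ := by
    intro k ξ
    by_cases hne : φ k ξ = 0
    · simp [hne]
    rw [dilate_apply _ (inv_ne_zero (two_pow_ne k))]
    have hn : ‖((2:ℝ) ^ k)⁻¹ • ξ‖ = ((2:ℝ) ^ k)⁻¹ * ‖ξ‖ := by rw [norm_smul]; simp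
    have hk : (0:ℝ) < 2 ^ k := by positivity
    rcases Nat.eq_zero_or_pos k with rfl | hk0
    · have := hφ.supp0 hne
      simp at this
      simp [hχ, h1 ξ this]
    · have := hφ.suppj k hk0 hne
      simp only [mem_ofPred_eq] at this
      rw [Real.rpow_add (by norm_num), Real.rpow_sub (by norm_num), Real.rpow_natCast, Real.rpow_one] at this
      have h5 : ‖((2:ℝ) ^ k)⁻¹ • ξ‖ ≤ 2 := by rw [hn, inv_mul_le_iff₀ hk]; exact this.2
      have h6 : 1 / 2 ≤ ‖((2:ℝ) ^ k)⁻¹ • ξ‖ := by rw [hn, le_inv_mul_iff₀ hk]; linarith [this.1]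
      have : (χ k) (((2:ℝ) ^ k)⁻¹ • ξ) = 1 := by
        simp only [hχ, hk0.ne', if_false, sub_apply]
        rw [h1 _ h5, h4 _ h6, sub_zero]
      rw [this, one_mul]
  refine ⟨fun N => C N + (pN N χ₀ + pN N (χ₀ - χ₁)), fun k => dilate (χ k) ((2:ℝ) ^ k)⁻¹, fun k => dilate (χ k) ((2:ℝ) ^ k)⁻¹, ?_, ?_, ?_, ?_, ?_, ?_, ?_⟩
  · intro N k
    have h6 := pN_nonneg N χ₀
    have h7 := pN_nonneg N (χ₀ - χ₁)
    linarith [hC N k]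
  · intro N k; simp only [hdil]; exact hT N k
  · intro N k; simp only [hdil]; exact hT N k
  · intro k hk x hx
    simp only [hdil]
    simp only [hχ]
    rw [if_neg (by omega), sub_apply, h1 x (by linarith), h3 x hx.le, sub_self]
  · intro k x hx
    simp only [hdil]
    simp only [hχ]
    split_ifs
    · exact h2 x hx.le
    · rw [sub_apply, h2 x hx.le, h4 x (by linarith), sub_self]
  · intro ξ
    simp only [hone]
    have hs : Summable fun k => φ k ξ := by
      by_contra hns
      have := hφ.sum_eq ξ
      rw [tsum_eq_zero_of_not_summable hns] at this
      exact zero_ne_one this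
    rw [← hφ.sum_eq ξ]
    exact hs.hasSum
  · intro j k _ ξ
    rw [one_sub_mul, hone, sub_self, zero_mul]

end BV

namespace BV

def contQ (q : ℝ≥0∞) (F : ℝ → ℝ≥0∞) : ℝ≥0∞ :=
  if q = ∞ then essSup F (volume.restrict (Ioc (0 : ℝ) 1))
  else (∫⁻ t in Ioc (0 : ℝ) 1, F t ^ q.toReal * ENNReal.ofReal t⁻¹) ^ (1 / q.toReal)

lemma contQ_mono (q : ℝ≥0∞) {F F' : ℝ → ℝ≥0∞} (h : ∀ t, 0 < t → t ≤ 1 → F t ≤ F' t) : contQ q F ≤ contQ q F' := by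
  unfold contQ
  split_ifs
  · refine essSup_mono_ae ?_
    filter_upwards [ae_restrict_mem measurableSet_Ioc] with t ht using h t ht.1 ht.2
  · refine ENNReal.rpow_le_rpow ?_ (by positivity)
    refine setLIntegral_mono' measurableSet_Ioc fun t ht => ?_
    refine mul_le_mul_left (ENNReal.rpow_le_rpow (h t ht.1 ht.2) (by positivity)) _

lemma dyadic_mem {t : ℝ} (h0 : 0 < t) (h1 : t ≤ 1) : ∃ i : ℕ, t ∈ Ioc ((2:ℝ) ^ (i + 1))⁻¹ ((2:ℝ) ^ i)⁻¹ := by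
  obtain ⟨i, h2, h3⟩ := exists_nat_pow_near_of_lt_one h0 h1 (by norm_num : (0:ℝ) < 1 / 2) (by norm_num)
  refine ⟨i, ?_, ?_⟩
  · simpa using h2
  · simpa using h3

lemma contQ_le {q : ℝ≥0∞} {F : ℝ → ℝ≥0∞} {H : ℕ → ℝ≥0∞}
    (h : ∀ i : ℕ, ∀ t ∈ Ioc ((2:ℝ) ^ (i + 1))⁻¹ ((2:ℝ) ^ i)⁻¹, F t ≤ H i) : contQ q F ≤ lqSum q H := by
  unfold contQ lqSum
  split_ifs with hq
  · refine essSup_le_of_ae_le _ ?_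
    filter_upwards [ae_restrict_mem measurableSet_Ioc] with t ht
    obtain ⟨i, hi⟩ := dyadic_mem ht.1 ht.2
    exact (h i t hi).trans (le_iSup H i)
  · refine ENNReal.rpow_le_rpow ?_ (by positivity)
    calc _ ≤ ∫⁻ t in ⋃ i : ℕ, Ioc ((2:ℝ) ^ (i + 1))⁻¹ ((2:ℝ) ^ i)⁻¹, F t ^ q.toReal * ENNReal.ofReal t⁻¹ := by
          refine lintegral_mono_set fun t ht => ?_
          exact mem_iUnion.2 (dyadic_mem ht.1 ht.2)
      _ ≤ ∑' i : ℕ, ∫⁻ t in Ioc ((2:ℝ) ^ (i + 1))⁻¹ ((2:ℝ) ^ i)⁻¹, F t ^ q.toReal * ENNReal.ofReal t⁻¹ := lintegral_iUnion_le _ _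
      _ ≤ _ := by
          refine ENNReal.tsum_le_tsum fun i => ?_
          calc _ ≤ ∫⁻ t in Ioc ((2:ℝ) ^ (i + 1))⁻¹ ((2:ℝ) ^ i)⁻¹, H i ^ q.toReal * ENNReal.ofReal (2 ^ (i + 1)) := by
                refine setLIntegral_mono' measurableSet_Ioc fun t ht => ?_
                refine mul_le_mul' (ENNReal.rpow_le_rpow (h i t ht) (by positivity)) (ENNReal.ofReal_le_ofReal ?_)
                rw [inv_le_comm₀ (lt_trans (by positivity) ht.1) (by positivity)]
                exact ht.1.le
            _ = _ := by
                rw [setLIntegral_const, Real.volume_Ioc, mul_assoc, ← ENNReal.ofReal_mul (by positivity)]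
                have : (2:ℝ) ^ (i + 1) * (((2:ℝ) ^ i)⁻¹ - ((2:ℝ) ^ (i + 1))⁻¹) = 1 := by
                  rw [pow_succ]; field_simp; norm_num
                rw [this]; simp

lemma lq_mono (q : ℝ≥0∞) {a b : ℕ → ℝ≥0∞} (h : ∀ j, a j ≤ b j) : lqSum q a ≤ lqSum q b := by
  unfold lqSum
  split_ifs
  · exact iSup_mono h
  · exact ENNReal.rpow_le_rpow (ENNReal.tsum_le_tsum fun j => ENNReal.rpow_le_rpow (h j) (by positivity)) (by positivity)

lemma lq_const {q : ℝ≥0∞} (hq : q ≠ 0) (c : ℝ≥0∞) (a : ℕ → ℝ≥0∞) : lqSum q (fun j => c * a j) = c * lqSum q a := by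
  unfold lqSum
  split_ifs with h
  · rw [ENNReal.mul_iSup]
  · have h0 : 0 < q.toReal := ENNReal.toReal_pos hq h
    simp only [ENNReal.mul_rpow_of_nonneg _ _ h0.le, ENNReal.tsum_mul_left]
    rw [ENNReal.mul_rpow_of_nonneg _ _ (by positivity), ← ENNReal.rpow_mul, mul_one_div_cancel h0.ne', ENNReal.rpow_one]

lemma le_lq {q : ℝ≥0∞} (hq : q ≠ 0) (a : ℕ → ℝ≥0∞) (j : ℕ) : a j ≤ lqSum q a := by
  unfold lqSum
  split_ifs with h
  · exact le_iSup a j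
  · have h0 : 0 < q.toReal := ENNReal.toReal_pos hq h
    rw [one_div, ENNReal.le_rpow_inv_iff h0]
    exact ENNReal.le_tsum j

lemma eLp_eq {p : ℝ≥0∞} (hp : p ≠ 0) (g : Rn n → E) : eLpNorm g p volume = lpNormENN p fun z => ‖g z‖ₑ := by
  unfold lpNormENN
  split_ifs with h
  · rw [h, eLpNorm_exponent_top]; rfl
  · rw [eLpNorm_eq_lintegral_rpow_enorm_toReal hp h]

lemma ofReal_rpow_le (s : ℝ) (i : ℕ) {t : ℝ} (h : t ∈ Icc ((2:ℝ) ^ (i + 1))⁻¹ ((2:ℝ) ^ i)⁻¹) :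
    ENNReal.ofReal (t ^ (-s)) ≤ 2 ^ |s| * 2 ^ ((i : ℝ) * s) := by
  have ht0 : 0 < t := lt_of_lt_of_le (by positivity) h.1
  have e1 : ((2:ℝ) ^ (i + 1))⁻¹ = 2 ^ (-((i : ℝ) + 1)) := by
    rw [Real.rpow_neg (by norm_num)]; norm_cast
  have e2 : ((2:ℝ) ^ i)⁻¹ = 2 ^ (-(i : ℝ)) := by
    rw [Real.rpow_neg (by norm_num)]; norm_cast
  rw [← two_rpow_add, ← ofReal_two_rpow]
  refine ENNReal.ofReal_le_ofReal ?_
  rcases le_total 0 s with hs | hs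
  · calc t ^ (-s) ≤ (2 ^ (-((i : ℝ) + 1))) ^ (-s) := by
          refine Real.rpow_le_rpow_of_nonpos (by positivity) ?_ (by linarith)
          rw [← e1]; exact h.1
      _ = _ := by rw [← Real.rpow_mul (by norm_num), abs_of_nonneg hs]; congr 1; ring
  · calc t ^ (-s) ≤ (2 ^ (-(i : ℝ))) ^ (-s) := by
          refine Real.rpow_le_rpow ht0.le ?_ (by linarith)
          rw [← e2]; exact h.2
      _ ≤ _ := by
          rw [← Real.rpow_mul (by norm_num)]
          refine Real.rpow_le_rpow_of_exponent_le (by norm_num) ?_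
          have := abs_nonneg s
          linarith

theorem partA {p q : ℝ≥0∞} (hp : p ≠ 0) (hq : q ≠ 0) {s d : ℝ} (hd : 0 ≤ d) (Ψ ψ : Sch n) (S' : ℕ) (hS' : s < S')
    (hmom : ∀ k < S', iteratedFDeriv ℝ k ψ 0 = 0) {φ : ℕ → Sch n} (hφ : SmoothResolution n φ) :
    ∃ K : ℝ≥0∞, K ≠ ∞ ∧ ∀ {E : Type*} [NormedAddCommGroup E] [NormedSpace ℂ E] (f : TDist n E),
      besovContNormSup s p q d Ψ ψ f ≤ K * besovNorm s p q φ f := by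
  obtain ⟨C, Θ, Υ, hS⟩ := phi_sys hφ
  set δ : ℝ := (S' - s) / 3 with hδd
  have hδ : 0 < δ := by rw [hδd]; linarith
  have hδe : s + 3 * δ = S' := by rw [hδd]; ring
  obtain ⟨N', B, K, hK, hFC⟩ := FC (n := n) hp s hδ C (r := 1 / 4) (by norm_num) 4 hd
  obtain ⟨D, hD, hdec⟩ := dec (n := n) N' B C (r := 1 / 4) (by norm_num) 4
  obtain ⟨Cm, hCm, hmo⟩ := pN_moment ψ S' hmom N' 4 (by norm_num)
  obtain ⟨KS, hKS, hsch⟩ := schur hq hδ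
  have hC0 := hS.C_nonneg N'
  set W1 : ℝ := D * pN (N' + B) Ψ with hW1
  set W2 : ℝ := Cm * 2 ^ S' * C N' + D * (2 ^ (2 * (N' + B)) * pN (N' + B) ψ) with hW2
  have hp1 := pN_nonneg (N' + B) Ψ
  have hp2 := pN_nonneg (N' + B) ψ
  have hW10 : 0 ≤ W1 := by positivity
  have hW20 : 0 ≤ W2 := by positivity
  refine ⟨K * ENNReal.ofReal W1 + 2 ^ |s| * (K * ENNReal.ofReal W2) * KS, ?_, fun {E} _ _ f => ?_⟩
  · refine ENNReal.add_ne_top.2 ⟨ENNReal.mul_ne_top hK ENNReal.ofReal_ne_top, ENNReal.mul_ne_top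
      (ENNReal.mul_ne_top (two_rpow_ne_top _) (ENNReal.mul_ne_top hK ENNReal.ofReal_ne_top)) hKS⟩
  set H : ℕ → ℝ≥0∞ := fun l => (2:ℝ≥0∞) ^ ((l : ℝ) * s) * lpNormENN p (fun z => ‖mOp (φ l) f z‖ₑ) with hH
  have hbes : besovNorm s p q φ f = lqSum q H := by
    unfold besovNorm; simp only [eLp_eq hp, hH]
  have hA1 : lpNormENN p (supBall d (mOp Ψ f)) ≤ K * ENNReal.ofReal W1 * lqSum q H := by
    have hd1 : ∀ k, pN N' (mS (dilate Ψ (2 ^ k)) (dilate (Θ k) (2 ^ k))) ≤ W1 * (((2:ℝ) ^ k) ^ B)⁻¹ := fun k => by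
      have := hdec φ Θ Υ hS Ψ 0 k (Nat.zero_le _)
      rw [pow_zero, dilate_one, Nat.sub_zero] at this
      exact this.trans (le_of_eq (by rw [hW1]; ring))
    have := hFC φ Θ Υ hS f 0 {Ψ} (supBall d (mOp Ψ f)) W1 hW10
      (by rintro m rfl k hk
          obtain rfl : k = 0 := by omega
          simpa using hd1 0)
      (by rintro m rfl k hk; simpa using hd1 k)
      (by intro x c hc
          refine iSup₂_le fun y hy => ?_
          exact hc Ψ rfl y (by simpa using hy))
    simp only [Nat.cast_zero, zero_mul, ENNReal.rpow_zero, one_mul] at this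
    refine this.trans (mul_le_mul_right (iSup_le fun l => ?_) _)
    exact (mul_le_of_le_one_left bot_le (kap_le_one hδ.le 0 l)).trans (le_lq hq H l)
  have hA2 : ∀ i : ℕ, ∀ t ∈ Ioc ((2:ℝ) ^ (i + 1))⁻¹ ((2:ℝ) ^ i)⁻¹,
      ENNReal.ofReal (t ^ (-s)) * lpNormENN p (supLocal d ψ f t) ≤
        2 ^ |s| * (K * ENNReal.ofReal W2) * ⨆ l, kap δ i l * H l := by
    intro i t ht
    have h2i : (0:ℝ) < 2 ^ i := by positivity
    have hτ : ∀ τ ∈ Icc t (2 * t), 1 / 2 ≤ τ * 2 ^ i ∧ τ * 2 ^ i ≤ 2 := by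
      intro τ hτ
      have h1 : ((2:ℝ) ^ (i + 1))⁻¹ ≤ τ := ht.1.le.trans hτ.1
      have h2 : τ ≤ 2 * ((2:ℝ) ^ i)⁻¹ := hτ.2.trans (by linarith [ht.2])
      constructor
      · rw [pow_succ, mul_inv] at h1
        calc (1:ℝ) / 2 = ((2:ℝ) ^ i)⁻¹ * 2⁻¹ * 2 ^ i := by field_simp
          _ ≤ _ := by gcongr
      · calc _ ≤ 2 * ((2:ℝ) ^ i)⁻¹ * 2 ^ i := by gcongr
          _ = 2 := by field_simp
    have ht0 : 0 < t := lt_trans (by positivity) ht.1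
    have := hFC φ Θ Υ hS f i ((fun τ => dilate ψ τ) '' Icc t (2 * t)) (supLocal d ψ f t) W2 hW20
      (by rintro _ ⟨τ, hτm, rfl⟩ k hk
          have hτ0 : 0 < τ := lt_of_lt_of_le ht0 hτm.1
          simp only
          rw [dilate_dilate _ hτ0.ne' (two_pow_ne k)]
          have e : (2:ℝ) ^ k = 2 ^ i * 2 ^ ((k : ℝ) - i) := by
            rw [Real.rpow_sub (by norm_num), Real.rpow_natCast, Real.rpow_natCast]; field_simp
          have h1 : τ * 2 ^ k ≤ 2 * 2 ^ ((k : ℝ) - i) := by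
            rw [e, ← mul_assoc]
            gcongr
            exact (hτ τ hτm).2
          have h2 : (2:ℝ) ^ ((k : ℝ) - i) ≤ 1 := by
            refine Real.rpow_le_one_of_one_le_of_nonpos (by norm_num) ?_
            have : (k : ℝ) ≤ i := by exact_mod_cast hk
            linarith
          refine (hmo (dilate (Θ k) (2 ^ k)) (τ * 2 ^ k) (by positivity) (by linarith) (hS.TR k)).trans ?_
          rw [hδe, Real.rpow_mul (by norm_num), Real.rpow_natCast]
          calc _ ≤ Cm * (2 * 2 ^ ((k : ℝ) - i)) ^ S' * C N' := by
                gcongr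
                · exact pN_nonneg _ _
                · exact hS.bT N' k
            _ = (Cm * 2 ^ S' * C N') * (2 ^ ((k : ℝ) - i)) ^ S' := by rw [mul_pow]; ring
            _ ≤ _ := by
                gcongr
                rw [hW2]
                have : 0 ≤ D * (2 ^ (2 * (N' + B)) * pN (N' + B) ψ) := by positivity
                linarith)
      (by rintro _ ⟨τ, hτm, rfl⟩ k hk
          have hτ0 : 0 < τ := lt_of_lt_of_le ht0 hτm.1
          simp only
          refine (hdec φ Θ Υ hS (dilate ψ τ) i k hk).trans ?_
          rw [dilate_dilate _ hτ0.ne' (two_pow_ne i)]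
          have h1 := pN_dilate (N' + B) ψ (t := τ * 2 ^ i) (K := 2) (by positivity) (by norm_num) (hτ τ hτm).2
            (by rw [inv_le_comm₀ (by positivity) (by norm_num)]; have := (hτ τ hτm).1; norm_num at this ⊢; exact this)
          calc _ ≤ D * (((2:ℝ) ^ (k - i)) ^ B)⁻¹ * (2 ^ (2 * (N' + B)) * pN (N' + B) ψ) := by gcongr
            _ = (D * (2 ^ (2 * (N' + B)) * pN (N' + B) ψ)) * (((2:ℝ) ^ (k - i)) ^ B)⁻¹ := by ring
            _ ≤ _ := by
                gcongr
                rw [hW2]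
                have : 0 ≤ Cm * 2 ^ S' * C N' := by positivity
                linarith)
      (by intro x c hc
          refine iSup₂_le fun y hy => iSup₂_le fun τ hτm => ?_
          refine hc _ ⟨τ, hτm, rfl⟩ y (hy.trans ?_)
          gcongr
          exact ht.2)
    calc _ ≤ (2 ^ |s| * 2 ^ ((i : ℝ) * s)) * lpNormENN p (supLocal d ψ f t) :=
          mul_le_mul_left (ofReal_rpow_le s i ⟨ht.1.le, ht.2⟩) _
      _ ≤ _ := by
          rw [mul_assoc, mul_assoc ((2:ℝ≥0∞) ^ |s|)]
          exact mul_le_mul_right this _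
  have hA3 : contQ q (fun t => ENNReal.ofReal (t ^ (-s)) * lpNormENN p (supLocal d ψ f t)) ≤
      2 ^ |s| * (K * ENNReal.ofReal W2) * KS * lqSum q H := by
    refine (contQ_le hA2).trans ?_
    rw [lq_const hq, mul_assoc _ KS]
    exact mul_le_mul_right (hsch H) _
  rw [hbes, add_mul]
  exact add_le_add hA1 hA3

end BV

namespace BV

lemma quot (g ψ : Sch n) {R : ℝ} (hR : ∀ x, R < ‖x‖ → g x = 0) (h : ∀ x ∈ tsupport g, ψ x ≠ 0) :
    ∃ σ : Sch n, (∀ x, σ x * ψ x = g x) ∧ ∀ x, g x = 0 → σ x = 0 := by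
  have hc : HasCompactSupport fun x => g x / ψ x := by
    refine HasCompactSupport.intro (isCompact_closedBall (0 : Rn n) R) fun x hx => ?_
    rw [hR x (by simpa using hx), zero_div]
  have hs : ContDiff ℝ (⊤ : ℕ∞) fun x => g x / ψ x := by
    rw [contDiff_iff_contDiffAt]
    intro x
    by_cases hx : x ∈ tsupport g
    · simp only [div_eq_mul_inv]
      exact (g.smooth ⊤).contDiffAt.mul ((ψ.smooth ⊤).contDiffAt.inv (h x hx))
    · refine ContDiffAt.congr_of_eventuallyEq (contDiffAt_const (c := 0)) ?_
      filter_upwards [(isClosed_tsupport g).isOpen_compl.mem_nhds hx] with y hy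
      rw [image_eq_zero_of_notMem_tsupport hy, zero_div]
  refine ⟨hc.toSchwartzMap hs, fun x => ?_, fun x hx => ?_⟩
  · change g x / ψ x * ψ x = g x
    by_cases hx : x ∈ tsupport g
    · exact div_mul_cancel₀ _ (h x hx)
    · rw [image_eq_zero_of_notMem_tsupport hx]; simp
  · change g x / ψ x = 0
    rw [hx, zero_div]

lemma tsupp_sub (g : Sch n) {a b : ℝ} (h : ∀ x, g x ≠ 0 → a ≤ ‖x‖ ∧ ‖x‖ ≤ b) (x : Rn n) (hx : x ∈ tsupport g) : a ≤ ‖x‖ ∧ ‖x‖ ≤ b := by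
  have hcl : IsClosed {x : Rn n | a ≤ ‖x‖ ∧ ‖x‖ ≤ b} :=
    (isClosed_le continuous_const continuous_norm).inter (isClosed_le continuous_norm continuous_const)
  exact closure_minimal (fun y hy => h y hy) hcl hx

def LL (Ψ ψ : Sch n) (t : ℝ) (k : ℕ) : Sch n := if k = 0 then Ψ else dilate ψ (((2:ℝ) ^ k)⁻¹ * t)

lemma psi_sys {ε : ℝ} (hε : 0 < ε) (Ψ ψ : Sch n) (hΨ : ∀ x : Rn n, ‖x‖ < 2 * ε → 0 < ‖Ψ x‖)
    (hψ : ∀ x : Rn n, ε / 2 < ‖x‖ → ‖x‖ < 2 * ε → 0 < ‖ψ x‖) :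
    ∃ (C : ℕ → ℝ) (r R : ℝ), 0 < r ∧ ∀ t ∈ Icc (1:ℝ) 2, ∃ Θ Υ : ℕ → Sch n, Sys C r R (LL Ψ ψ t) Θ Υ := by
  obtain ⟨ρ₀, h1, h0⟩ := bump n (a := 5 * ε / 4) (b := 7 * ε / 4) (by positivity) (by linarith)
  obtain ⟨χ, c1, c0⟩ := bump n (a := 7 * ε / 4) (b := 15 * ε / 8) (by positivity) (by linarith)
  set ρ : Sch n := ρ₀ - dilate ρ₀ 2 with hρ
  have hρx : ∀ x, ρ x = ρ₀ x - ρ₀ ((2:ℝ) • x) := fun x => by rw [hρ, sub_apply, dilate_apply _ (by norm_num)]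
  have hn2 : ∀ x : Rn n, ‖(2:ℝ) • x‖ = 2 * ‖x‖ := fun x => by rw [norm_smul]; simp
  have hρa : ∀ x, ‖x‖ ≤ 5 * ε / 8 → ρ x = 0 := fun x hx => by
    rw [hρx, h1 x (by linarith), h1 _ (by rw [hn2]; linarith), sub_self]
  have hρb : ∀ x, 7 * ε / 4 ≤ ‖x‖ → ρ x = 0 := fun x hx => by
    rw [hρx, h0 x hx, h0 _ (by rw [hn2]; linarith), sub_self]
  obtain ⟨σ, hσ, hσ0⟩ := quot ρ ψ (R := 7 * ε / 4) (fun x hx => hρb x hx.le) (by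
    intro x hx
    have := tsupp_sub ρ (a := 5 * ε / 8) (b := 7 * ε / 4) (fun x hx => ⟨by
      by_contra hh; push Not at hh; exact hx (hρa x hh.le), by
      by_contra hh; push Not at hh; exact hx (hρb x hh.le)⟩) x hx
    exact norm_pos_iff.1 (hψ x (by linarith) (by linarith)))
  obtain ⟨σ₀, hσ₀, hσ₀0⟩ := quot χ Ψ (R := 15 * ε / 8) (fun x hx => c0 x hx.le) (by
    intro x hx
    have := tsupp_sub χ (a := 0) (b := 15 * ε / 8) (fun x hx => ⟨norm_nonneg x, by
      by_contra hh; push Not at hh; exact hx (c0 x hh.le)⟩) x hx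
    exact norm_pos_iff.1 (hΨ x (by linarith)))
  refine ⟨fun N => 2 ^ (2 * N) * (pN N ψ + pN N σ + pN N ρ₀) + pN N Ψ + 2 ^ N * (2 ^ (2 * N) * pN N ρ₀ * pN N σ₀),
    5 * ε / 16, 7 * ε / 4, by positivity, fun t ht => ?_⟩
  have ht0 : 0 < t := by linarith [ht.1]
  have hpd : ∀ N (b : Sch n), pN N (dilate b t) ≤ 2 ^ (2 * N) * pN N b := fun N b =>
    pN_dilate N b ht0 (by norm_num) ht.2 ((inv_le_one_of_one_le₀ ht.1).trans (by norm_num))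
  have hnt : ∀ x : Rn n, ‖t • x‖ = t * ‖x‖ := fun x => by rw [norm_smul, Real.norm_of_nonneg ht0.le]
  have hkt : ∀ k : ℕ, ((2:ℝ) ^ k)⁻¹ * t ≠ 0 := fun k => by positivity
  have hdd : ∀ (b : Sch n) (k : ℕ), dilate (dilate b (((2:ℝ) ^ k)⁻¹ * t)) (2 ^ k) = dilate b t := fun b k => by
    rw [dilate_dilate _ (hkt k) (two_pow_ne k)]
    congr 1; field_simp
  set Θ : ℕ → Sch n := fun k => if k = 0 then mS (dilate ρ₀ t) σ₀ else dilate σ (((2:ℝ) ^ k)⁻¹ * t) with hΘ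
  have hΘ0 : dilate (Θ 0) (2 ^ 0) = mS (dilate ρ₀ t) σ₀ := by simp [hΘ, dilate_one]
  have hΘk : ∀ k, k ≠ 0 → dilate (Θ k) (2 ^ k) = dilate σ t := fun k hk => by
    simp only [hΘ, if_neg hk]; exact hdd σ k
  have nn := fun N => (⟨pN_nonneg N ψ, pN_nonneg N σ, pN_nonneg N ρ₀, pN_nonneg N Ψ, pN_nonneg N σ₀⟩ :
    0 ≤ pN N ψ ∧ 0 ≤ pN N σ ∧ 0 ≤ pN N ρ₀ ∧ 0 ≤ pN N Ψ ∧ 0 ≤ pN N σ₀)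
  have hbig : ∀ N v, (v ≤ 2 ^ (2 * N) * pN N ψ ∨ v ≤ 2 ^ (2 * N) * pN N σ ∨ v ≤ 2 ^ (2 * N) * pN N ρ₀ ∨ v ≤ pN N Ψ ∨
      v ≤ 2 ^ N * (2 ^ (2 * N) * pN N ρ₀ * pN N σ₀)) →
      v ≤ 2 ^ (2 * N) * (pN N ψ + pN N σ + pN N ρ₀) + pN N Ψ + 2 ^ N * (2 ^ (2 * N) * pN N ρ₀ * pN N σ₀) := by
    intro N v hv
    obtain ⟨n1, n2, n3, n4, n5⟩ := nn N
    have m1 : (0:ℝ) ≤ 2 ^ (2 * N) * pN N ψ := by positivity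
    have m2 : (0:ℝ) ≤ 2 ^ (2 * N) * pN N σ := by positivity
    have m3 : (0:ℝ) ≤ 2 ^ (2 * N) * pN N ρ₀ := by positivity
    have m4 : (0:ℝ) ≤ 2 ^ N * (2 ^ (2 * N) * pN N ρ₀ * pN N σ₀) := by positivity
    rcases hv with hv | hv | hv | hv | hv <;> linarith
  have hTR : ∀ k x, 7 * ε / 4 < ‖x‖ → dilate (Θ k) (2 ^ k) x = 0 := by
    intro k x hx
    have h3 : 7 * ε / 4 ≤ ‖t • x‖ := by rw [hnt]; nlinarith [ht.1, norm_nonneg x]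
    rcases Nat.eq_zero_or_pos k with rfl | hk
    · rw [hΘ0, mS_apply, dilate_apply _ ht0.ne', h0 _ h3, zero_mul]
    · rw [hΘk k hk.ne', dilate_apply _ ht0.ne', hσ0 _ (hρb _ h3)]
  have hT0 : ∀ k, 1 ≤ k → ∀ x, ‖x‖ < 5 * ε / 16 → dilate (Θ k) (2 ^ k) x = 0 := by
    intro k hk x hx
    rw [hΘk k (by omega), dilate_apply _ ht0.ne', hσ0 _ (hρa _ _)]
    rw [hnt]; nlinarith [ht.2, norm_nonneg x]
  refine ⟨Θ, fun k => dilate ρ₀ (((2:ℝ) ^ k)⁻¹ * t), ?_, ?_, ?_, hT0, hTR, ?_, ?_⟩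
  · intro N k
    rcases Nat.eq_zero_or_pos k with rfl | hk
    · refine hbig N _ ?_
      simp [LL, dilate_one]
    · refine hbig N _ (Or.inl ?_)
      simp only [LL, if_neg hk.ne', hdd]
      exact hpd N ψ
  · intro N k
    rcases Nat.eq_zero_or_pos k with rfl | hk
    · refine hbig N _ (Or.inr (Or.inr (Or.inr (Or.inr ?_))))
      rw [hΘ0]
      refine (pN_mS N _ _).trans ?_
      have := (nn N).2.2.2.2
      gcongr
      exact hpd N ρ₀
    · refine hbig N _ (Or.inr (Or.inl ?_))
      rw [hΘk k hk.ne']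
      exact hpd N σ
  · intro N k
    refine hbig N _ (Or.inr (Or.inr (Or.inl ?_)))
    simp only [hdd]
    exact hpd N ρ₀
  · intro ξ
    have t0 : Θ 0 ξ * LL Ψ ψ t 0 ξ = ρ₀ (t • ξ) := by
      simp only [hΘ, LL, if_true, mS_apply]
      rw [mul_assoc, hσ₀, dilate_apply _ ht0.ne']
      by_cases hx : 7 * ε / 4 ≤ ‖t • ξ‖
      · rw [h0 _ hx, zero_mul]
      · push Not at hx
        rw [c1, mul_one]
        rw [hnt] at hx
        nlinarith [ht.1, norm_nonneg ξ]
    have tk : ∀ k : ℕ, Θ (k + 1) ξ * LL Ψ ψ t (k + 1) ξ = ρ₀ ((((2:ℝ) ^ (k + 1))⁻¹ * t) • ξ) - ρ₀ ((((2:ℝ) ^ k)⁻¹ * t) • ξ) := by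
      intro k
      simp only [hΘ, LL, Nat.add_one_ne_zero, if_false]
      rw [dilate_apply _ (hkt _), dilate_apply _ (hkt _), hσ, hρx, smul_smul]
      congr 3
      rw [pow_succ]; field_simp
    obtain ⟨K, hK⟩ := pow_unbounded_of_one_lt (t * ‖ξ‖ / (5 * ε / 8)) (by norm_num : (1:ℝ) < 2)
    rw [div_lt_iff₀ (by positivity)] at hK
    have hsm : ∀ k, K ≤ k → ‖(((2:ℝ) ^ k)⁻¹ * t) • ξ‖ ≤ 5 * ε / 8 := by
      intro k hk
      rw [norm_smul, Real.norm_of_nonneg (by positivity), mul_assoc, inv_mul_le_iff₀ (by positivity)]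
      refine hK.le.trans ?_
      gcongr
      norm_num
    have e : (1:ℂ) = ∑ k ∈ Finset.range (K + 1), Θ k ξ * LL Ψ ψ t k ξ := by
      rw [Finset.sum_range_succ', t0, Finset.sum_congr rfl fun k _ => tk k,
        Finset.sum_range_sub (fun k => ρ₀ ((((2:ℝ) ^ k)⁻¹ * t) • ξ)), h1 _ ((hsm K le_rfl).trans (by linarith))]
      simp
    rw [e]
    refine hasSum_sum_of_ne_finset_zero fun k hk => ?_
    have hk' : K + 1 ≤ k := by simpa using hk
    obtain ⟨k, rfl⟩ : ∃ k', k = k' + 1 := ⟨k - 1, by omega⟩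
    rw [tk, h1 _ ((hsm _ (by omega)).trans (by linarith)), h1 _ ((hsm _ (by omega)).trans (by linarith)), sub_self]
  · intro j k hkj ξ
    by_cases hx : 7 * ε / 4 < ‖((2:ℝ) ^ k)⁻¹ • ξ‖
    · have := hTR k _ hx
      rw [dilate_apply _ (two_pow_ne k), smul_smul, mul_inv_cancel₀ (two_pow_ne k), one_smul] at this
      rw [this, mul_zero]
    · push Not at hx
      have : dilate ρ₀ (((2:ℝ) ^ j)⁻¹ * t) ξ * Θ k ξ = Θ k ξ := by
        by_cases hz : Θ k ξ = 0
        · rw [hz, mul_zero]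
        have hy : ‖(((2:ℝ) ^ k)⁻¹ * t) • ξ‖ ≤ 7 * ε / 4 := by
          by_contra hh
          push Not at hh
          refine hz ?_
          rcases Nat.eq_zero_or_pos k with rfl | hk
          · simp only [hΘ, if_true, mS_apply]
            rw [dilate_apply _ ht0.ne', h0, zero_mul]
            simpa using hh.le
          · simp only [hΘ, if_neg hk.ne']
            rw [dilate_apply _ (hkt k), hσ0 _ (hρb _ hh.le)]
        rw [dilate_apply _ (hkt j), h1, one_mul]
        rw [norm_smul, Real.norm_of_nonneg (by positivity)] at hy ⊢
        have h5 : ((2:ℝ) ^ j)⁻¹ ≤ ((2:ℝ) ^ k)⁻¹ / 2 := by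
          have : (2:ℝ) ^ (k + 1) ≤ 2 ^ j := pow_le_pow_right₀ (by norm_num) hkj
          rw [div_eq_mul_inv, ← mul_inv, ← pow_succ]
          gcongr
        calc _ ≤ ((2:ℝ) ^ k)⁻¹ / 2 * t * ‖ξ‖ := by gcongr
          _ = (((2:ℝ) ^ k)⁻¹ * t * ‖ξ‖) / 2 := by ring
          _ ≤ _ := by linarith
      rw [mul_right_comm, one_sub_mul, this, sub_self, zero_mul]

theorem partB0 {p q : ℝ≥0∞} (hp : p ≠ 0) (hq : q ≠ 0) (s : ℝ) {ε : ℝ} (hε : 0 < ε) (Ψ ψ : Sch n) (hΨ : ∀ x : Rn n, ‖x‖ < 2 * ε → 0 < ‖Ψ x‖)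
    (hψ : ∀ x : Rn n, ε / 2 < ‖x‖ → ‖x‖ < 2 * ε → 0 < ‖ψ x‖) {φ : ℕ → Sch n} (hφ : SmoothResolution n φ) :
    ∃ K : ℝ≥0∞, K ≠ ∞ ∧ ∀ {E : Type*} [NormedAddCommGroup E] [NormedSpace ℂ E] (f : TDist n E), ∀ t ∈ Icc (1:ℝ) 2,
      besovNorm s p q φ f ≤ K * lqSum q fun l => (2:ℝ≥0∞) ^ ((l : ℝ) * s) * eLpNorm (mOp (LL Ψ ψ t l) f) p volume := by
  obtain ⟨C, r, R, hr, hsys⟩ := psi_sys hε Ψ ψ hΨ hψ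
  obtain ⟨Cφ, hCφ⟩ := phi_bd hφ
  obtain ⟨N', B, K, hK, hFC⟩ := FC (n := n) hp s one_pos C hr R (le_refl (0:ℝ))
  obtain ⟨D, hD, hdec⟩ := dec (n := n) N' B C hr R
  obtain ⟨KS, hKS, hsch⟩ := schur hq one_pos
  obtain ⟨L, hL⟩ := pow_unbounded_of_one_lt R (by norm_num : (1:ℝ) < 2)
  have hφ0 : ∀ N, 0 ≤ Cφ N := fun N => (pN_nonneg _ _).trans (hCφ N 0)
  have hC0 : ∀ N, 0 ≤ C N := fun N => by
    obtain ⟨Θ, Υ, hS⟩ := hsys 1 (by simp)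
    exact hS.C_nonneg N
  set W1 : ℝ := 2 ^ N' * (((2:ℝ) ^ L) ^ (2 * N') * Cφ N' * C N') * 2 ^ ((L : ℝ) * |s + 3 * 1|) with hW1
  set W2 : ℝ := D * Cφ (N' + B) with hW2
  have hW10 : 0 ≤ W1 := by have := hφ0 N'; have := hC0 N'; positivity
  have hW20 : 0 ≤ W2 := by have := hφ0 (N' + B); positivity
  refine ⟨K * ENNReal.ofReal (W1 + W2) * KS, ENNReal.mul_ne_top (ENNReal.mul_ne_top hK ENNReal.ofReal_ne_top) hKS, fun {E} _ _ f t ht => ?_⟩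
  obtain ⟨Θ, Υ, hS⟩ := hsys t ht
  have hmain : ∀ j : ℕ, (2:ℝ≥0∞) ^ ((j : ℝ) * s) * eLpNorm (mOp (φ j) f) p volume ≤ K * ENNReal.ofReal (W1 + W2) *
      ⨆ l : ℕ, kap 1 j l * ((2:ℝ≥0∞) ^ ((l : ℝ) * s) * eLpNorm (mOp (LL Ψ ψ t l) f) p volume) := by
    intro j
    simp only [eLp_eq hp]
    refine hFC _ Θ Υ hS f j {φ j} _ (W1 + W2) (by linarith) ?_ ?_ ?_
    · rintro m rfl k hk
      have hpos : (0:ℝ) < 2 ^ (((k : ℝ) - j) * (s + 3 * 1)) := by positivity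
      by_cases hjk : L + 1 ≤ j - k
      · have : mS (dilate (φ j) (2 ^ k)) (dilate (Θ k) (2 ^ k)) = 0 := by
          ext x
          rw [mS_apply, zero_apply]
          by_cases hx : R < ‖x‖
          · rw [hS.TR k x hx, mul_zero]
          · push Not at hx
            have hz : dilate (φ j) (2 ^ k) x = 0 := by
              rw [dilate_apply _ (two_pow_ne k)]
              by_contra hne
              have h1 := (hφ.suppj j (by omega) hne).1
              have hn : ‖(2:ℝ) ^ k • x‖ = 2 ^ k * ‖x‖ := by rw [norm_smul]; simp
              rw [hn, Real.rpow_sub (by norm_num), Real.rpow_natCast, Real.rpow_one] at h1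
              have h2 : (2:ℝ) ^ k * 2 ^ (L + 1) ≤ 2 ^ j := by
                rw [← pow_add]; exact pow_le_pow_right₀ (by norm_num) (by omega)
              have hk0 : (0:ℝ) < 2 ^ k := by positivity
              rw [pow_succ] at h2
              nlinarith
            rw [hz, zero_mul]
        rw [this, pN_zero]
        positivity
      · have hjk' : j - k ≤ L := by omega
        have e : dilate (φ j) (2 ^ k) = dilate (dilate (φ j) (2 ^ j)) (((2:ℝ) ^ (j - k))⁻¹) := by
          rw [dilate_dilate _ (two_pow_ne j) (inv_ne_zero (two_pow_ne _))]
          congr 1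
          rw [eq_mul_inv_iff_mul_eq₀ (two_pow_ne _), ← pow_add]; congr 1; omega
        have h1 : pN N' (dilate (φ j) (2 ^ k)) ≤ ((2:ℝ) ^ L) ^ (2 * N') * Cφ N' := by
          rw [e]
          refine (pN_dilate N' _ (K := 2 ^ L) (by positivity) (one_le_pow₀ (by norm_num))
            ((inv_le_one_of_one_le₀ (one_le_pow₀ (by norm_num))).trans (one_le_pow₀ (by norm_num))) ?_).trans ?_
          · rw [inv_inv]; exact pow_le_pow_right₀ (by norm_num) hjk'
          · gcongr; exact hCφ N' j
        have h2 : (1:ℝ) ≤ 2 ^ ((L : ℝ) * |s + 3 * 1|) * 2 ^ (((k : ℝ) - j) * (s + 3 * 1)) := by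
          rw [← Real.rpow_add (by norm_num)]
          refine Real.one_le_rpow (by norm_num) ?_
          have h3 : (j : ℝ) - k ≤ L := by rw [← Nat.cast_sub hk]; exact_mod_cast hjk'
          have h4 : (0:ℝ) ≤ (j : ℝ) - k := by rw [sub_nonneg]; exact_mod_cast hk
          have h5 := le_abs_self (s + 3 * 1)
          have h6 := abs_nonneg (s + 3 * 1)
          nlinarith [mul_le_mul_of_nonneg_left h5 h4, mul_le_mul_of_nonneg_right h3 h6]
        have hc1 := hφ0 N'
        have hc2 := hC0 N'
        calc _ ≤ 2 ^ N' * (((2:ℝ) ^ L) ^ (2 * N') * Cφ N' * C N') := by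
              refine (pN_mS _ _ _).trans ?_
              gcongr
              · exact pN_nonneg _ _
              · exact hS.bT N' k
          _ ≤ 2 ^ N' * (((2:ℝ) ^ L) ^ (2 * N') * Cφ N' * C N') * (2 ^ ((L : ℝ) * |s + 3 * 1|) * 2 ^ (((k : ℝ) - j) * (s + 3 * 1))) :=
              le_mul_of_one_le_right (by positivity) h2
          _ = W1 * 2 ^ (((k : ℝ) - j) * (s + 3 * 1)) := by rw [hW1]; ring
          _ ≤ _ := by gcongr; linarith
    · rintro m rfl k hk
      refine (hdec _ Θ Υ hS (φ j) j k hk).trans ?_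
      calc _ ≤ D * (((2:ℝ) ^ (k - j)) ^ B)⁻¹ * Cφ (N' + B) := by gcongr; exact hCφ _ j
        _ = W2 * (((2:ℝ) ^ (k - j)) ^ B)⁻¹ := by rw [hW2]; ring
        _ ≤ _ := by gcongr; linarith
    · intro x c hc
      exact hc (φ j) rfl x (by simp)
  refine (lq_mono q hmain).trans ?_
  rw [lq_const hq, mul_assoc _ KS]
  exact mul_le_mul_right (hsch _) _

end BV

namespace BV

lemma g_meas (p : ℝ≥0∞) (ψ : Sch n) (f : TDist n E) :
    Measurable fun t : ℝ => if 0 < t then eLpNorm (mOp (dilate ψ t) f) p volume else 0 := by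
  refine measurable_of_Iic fun c => ?_
  set A : Set ℝ := {t | 0 < t ∧ eLpNorm (mOp (dilate ψ t) f) p volume ≤ c} with hA
  have h : (fun t : ℝ => if 0 < t then eLpNorm (mOp (dilate ψ t) f) p volume else 0) ⁻¹' Iic c
      = Iic 0 ∪ (Ioi 0 ∩ closure A) := by
    ext t
    simp only [mem_preimage, mem_Iic, mem_union, mem_inter_iff, mem_Ioi]
    by_cases ht : 0 < t
    · rw [if_pos ht]
      constructor
      · intro h
        exact Or.inr ⟨ht, subset_closure ⟨ht, h⟩⟩
      · rintro (h | ⟨-, h⟩)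
        · exact absurd h (not_le.2 ht)
        · obtain ⟨u, hu, hut⟩ := mem_closure_iff_seq_limit.1 h
          refine Lp.eLpNorm_le_of_ae_tendsto (u := atTop) (f := fun k => mOp (dilate ψ (u k)) f)
            (Eventually.of_forall fun k => (hu k).2)
            (fun k => (mOp_cont _ f).aestronglyMeasurable) ?_
          exact Eventually.of_forall fun x => (mOp_dilate_tendsto ψ f x t ht).comp hut
    · rw [if_neg ht]
      simp [not_lt.1 ht]
  rw [h]
  exact measurableSet_Iic.union (measurableSet_Ioi.inter isClosed_closure.measurableSet)

lemma lint_scaleR {a : ℝ} (ha : 0 < a) {H : ℝ → ℝ≥0∞} (hH : Measurable H) :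
    ∫⁻ t in Ioc (1:ℝ) 2, H (a * t) = ENNReal.ofReal a⁻¹ * ∫⁻ u in Ioc a (a * 2), H u := by
  have h1 : ∫⁻ u, (Ioc a (a * 2)).indicator H u ∂(Measure.map (a * ·) volume)
      = ∫⁻ t, (Ioc a (a * 2)).indicator H (a * t) :=
    lintegral_map (hH.indicator measurableSet_Ioc) (measurable_const_mul a)
  rw [Real.map_volume_mul_left ha.ne', lintegral_smul_measure, abs_of_pos (inv_pos.2 ha),
    lintegral_indicator measurableSet_Ioc, smul_eq_mul] at h1
  rw [h1, ← lintegral_indicator measurableSet_Ioc]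
  congr 1
  ext t
  by_cases ht : t ∈ Ioc (1:ℝ) 2
  · rw [indicator_of_mem ht, indicator_of_mem]
    exact ⟨by nlinarith [ht.1], by nlinarith [ht.2]⟩
  · rw [indicator_of_notMem ht, indicator_of_notMem]
    intro h
    exact ht ⟨by nlinarith [h.1], by nlinarith [h.2]⟩

lemma dy_disj : Pairwise (Function.onFun Disjoint fun i : ℕ => Ioc ((2:ℝ) ^ (i + 1))⁻¹ ((2:ℝ) ^ i)⁻¹) := by
  have h : Antitone fun i : ℕ => ((2:ℝ) ^ i)⁻¹ := fun i j hij =>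
    inv_anti₀ (by positivity) (pow_le_pow_right₀ (by norm_num) hij)
  exact h.pairwise_disjoint_on_Ioc_succ

lemma dy_sum (H : ℝ → ℝ≥0∞) :
    ∑' i : ℕ, ∫⁻ u in Ioc ((2:ℝ) ^ (i + 1))⁻¹ ((2:ℝ) ^ i)⁻¹, H u ≤ ∫⁻ u in Ioc (0:ℝ) 1, H u := by
  rw [← lintegral_iUnion (fun i => measurableSet_Ioc) dy_disj]
  refine lintegral_mono_set (iUnion_subset fun i u hu => ⟨lt_of_le_of_lt (by positivity) hu.1, hu.2.trans ?_⟩)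
  exact inv_le_one_of_one_le₀ (one_le_pow₀ (by norm_num))

lemma dy_half (i : ℕ) : ((2:ℝ) ^ (i + 1))⁻¹ * 2 = ((2:ℝ) ^ i)⁻¹ := by
  rw [pow_succ]; field_simp

lemma dy_mem (i : ℕ) {t : ℝ} (ht : t ∈ Ioc (1:ℝ) 2) :
    ((2:ℝ) ^ (i + 1))⁻¹ * t ∈ Ioc ((2:ℝ) ^ (i + 1))⁻¹ ((2:ℝ) ^ i)⁻¹ := by
  have h : (0:ℝ) < ((2:ℝ) ^ (i + 1))⁻¹ := by positivity
  rw [← dy_half i]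
  exact ⟨by nlinarith [ht.1], by nlinarith [ht.2]⟩

lemma two_le_ofReal (s : ℝ) (i : ℕ) {u : ℝ} (hu : u ∈ Ioc ((2:ℝ) ^ (i + 1))⁻¹ ((2:ℝ) ^ i)⁻¹) :
    (2:ℝ≥0∞) ^ (((i + 1 : ℕ) : ℝ) * s) ≤ 2 ^ |s| * ENNReal.ofReal (u ^ (-s)) := by
  have hu0 : 0 < u := lt_of_le_of_lt (by positivity) hu.1
  rw [← ofReal_two_rpow, ← ofReal_two_rpow, ← ENNReal.ofReal_mul (by positivity)]
  refine ENNReal.ofReal_le_ofReal ?_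
  set a : ℝ := 2 ^ (i + 1) * u with ha
  have h1 : 1 ≤ a := by
    have := mul_le_mul_of_nonneg_left hu.1.le (by positivity : (0:ℝ) ≤ 2 ^ (i + 1))
    rwa [mul_inv_cancel₀ (by positivity)] at this
  have h2 : a ≤ 2 := by
    have := mul_le_mul_of_nonneg_left hu.2 (by positivity : (0:ℝ) ≤ 2 ^ (i + 1))
    refine this.trans ?_
    rw [pow_succ]; field_simp; norm_num
  have h3 : u = a * 2 ^ (-((i + 1 : ℕ) : ℝ)) := by
    rw [ha, Real.rpow_neg (by norm_num), Real.rpow_natCast]; field_simp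
  have h4 : u ^ (-s) = a ^ (-s) * 2 ^ (((i + 1 : ℕ) : ℝ) * s) := by
    rw [h3, Real.mul_rpow (by positivity) (by positivity), ← Real.rpow_mul (by norm_num)]
    congr 2; ring
  have h5 : (1:ℝ) ≤ 2 ^ |s| * a ^ (-s) := by
    have : a ^ s ≤ 2 ^ |s| :=
      (Real.rpow_le_rpow_of_exponent_le h1 (le_abs_self s)).trans (Real.rpow_le_rpow (by linarith) h2 (abs_nonneg s))
    rw [Real.rpow_neg (by linarith), ← div_eq_mul_inv, le_div_iff₀ (by positivity)]
    linarith
  rw [h4, ← mul_assoc]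
  exact le_mul_of_one_le_left (by positivity) h5

lemma cont_lower {q : ℝ≥0∞} (hq : q ≠ 0) (s : ℝ) : ∃ C : ℝ≥0∞, C ≠ ∞ ∧ ∀ (F : ℝ → ℝ≥0∞), Measurable F →
    ∀ (A B : ℝ≥0∞), (∀ t ∈ Ioc (1:ℝ) 2, B ≤ lqSum q fun l => if l = 0 then A else 2 ^ |s| * F (((2:ℝ) ^ l)⁻¹ * t)) →
    B ≤ C * (A + contQ q F) := by
  set c : ℝ≥0∞ := 2 ^ |s| with hc
  have hct : c ≠ ∞ := two_rpow_ne_top _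
  by_cases hqt : q = ∞
  · subst hqt
    refine ⟨1 + c, by simp [hct], fun F hF A B h => ?_⟩
    have hM : ∀ᵐ u : ℝ, u ∈ Ioc (0:ℝ) 1 → F u ≤ contQ ∞ F := by
      rw [← ae_restrict_iff' measurableSet_Ioc]
      simp only [contQ, if_true]
      exact ae_le_essSup
    have hall : ∀ᵐ t : ℝ, ∀ i : ℕ, ((2:ℝ) ^ (i + 1))⁻¹ * t ∈ Ioc (0:ℝ) 1 → F (((2:ℝ) ^ (i + 1))⁻¹ * t) ≤ contQ ∞ F := by
      rw [ae_all_iff]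
      intro i
      have hqm : Measure.QuasiMeasurePreserving (((2:ℝ) ^ (i + 1))⁻¹ * ·) volume volume := by
        refine ⟨measurable_const_mul _, ?_⟩
        rw [Real.map_volume_mul_left (by positivity)]
        exact Measure.smul_absolutelyContinuous
      exact hqm.ae hM
    have hne : (ae (volume.restrict (Ioc (1:ℝ) 2))).NeBot := by
      rw [ae_neBot, Ne, Measure.restrict_eq_zero]
      simp
    obtain ⟨t, ht1, ht2⟩ := ((ae_restrict_mem measurableSet_Ioc).and (ae_restrict_of_ae (s := Ioc (1:ℝ) 2) hall)).exists
    refine (h t ht1).trans ?_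
    simp only [lqSum, if_true]
    refine iSup_le fun l => ?_
    rcases l with _ | i
    · simp only [if_true]
      calc A ≤ 1 * (A + contQ ∞ F) := by rw [one_mul]; exact le_self_add
        _ ≤ _ := by gcongr; exact le_self_add
    · rw [if_neg (by omega)]
      have hm := dy_mem i ht1
      have := ht2 i ⟨lt_of_le_of_lt (by positivity) hm.1, hm.2.trans (inv_le_one_of_one_le₀ (one_le_pow₀ (by norm_num)))⟩
      calc c * F _ ≤ c * contQ ∞ F := by gcongr
        _ ≤ (1 + c) * (A + contQ ∞ F) := by gcongr <;> simp
  · set r := q.toReal with hr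
    have hr0 : 0 < r := ENNReal.toReal_pos hq hqt
    have hcr : c ^ r ≠ ∞ := ENNReal.rpow_ne_top_of_nonneg hr0.le hct
    refine ⟨(1 + 2 * c ^ r) ^ (1 / r), ENNReal.rpow_ne_top_of_nonneg (by positivity) ?_, fun F hF A B h => ?_⟩
    · exact ENNReal.add_ne_top.2 ⟨by simp, ENNReal.mul_ne_top (by simp) hcr⟩
    set H : ℝ → ℝ≥0∞ := fun u => F u ^ r * ENNReal.ofReal u⁻¹ with hH
    have hHm : Measurable H := (hF.pow_const r).mul (measurable_inv.ennreal_ofReal)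
    have hI : contQ q F ^ r = ∫⁻ u in Ioc (0:ℝ) 1, H u := by
      rw [contQ, if_neg hqt, ← ENNReal.rpow_mul, one_div_mul_cancel hr0.ne', ENNReal.rpow_one]
    have hpt : ∀ t ∈ Ioc (1:ℝ) 2, B ^ r ≤ A ^ r + ∑' i : ℕ, 2 * c ^ r * ENNReal.ofReal ((2:ℝ) ^ (i + 1))⁻¹ * H (((2:ℝ) ^ (i + 1))⁻¹ * t) := by
      intro t ht
      have h1 := ENNReal.rpow_le_rpow (h t ht) hr0.le
      rw [lqSum, if_neg hqt, ← ENNReal.rpow_mul, one_div_mul_cancel hr0.ne', ENNReal.rpow_one,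
        tsum_eq_zero_add' ENNReal.summable, if_pos rfl] at h1
      refine h1.trans (add_le_add le_rfl (ENNReal.tsum_le_tsum fun i => ?_))
      rw [if_neg (by omega), ENNReal.mul_rpow_of_nonneg _ _ hr0.le]
      set a : ℝ := ((2:ℝ) ^ (i + 1))⁻¹ with ha
      have ha0 : 0 < a := by positivity
      have hu0 : 0 < a * t := mul_pos ha0 (by linarith [ht.1])
      have h2 : (1:ℝ≥0∞) ≤ 2 * ENNReal.ofReal a * ENNReal.ofReal (a * t)⁻¹ := by
        rw [show (2:ℝ≥0∞) = ENNReal.ofReal 2 by simp, ← ENNReal.ofReal_mul (by norm_num), ← ENNReal.ofReal_mul (by positivity),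
          ENNReal.one_le_ofReal, ← div_eq_mul_inv, le_div_iff₀ hu0]
        nlinarith [ht.2]
      calc c ^ r * F (a * t) ^ r ≤ c ^ r * F (a * t) ^ r * (2 * ENNReal.ofReal a * ENNReal.ofReal (a * t)⁻¹) :=
            le_mul_of_one_le_right' h2
        _ = _ := by simp only [hH]; ring
    have hint : B ^ r ≤ A ^ r + 2 * c ^ r * contQ q F ^ r := by
      have h1 : ∫⁻ _ in Ioc (1:ℝ) 2, B ^ r = B ^ r := by
        rw [setLIntegral_const, Real.volume_Ioc]; norm_num
      have h1' : ∫⁻ _ in Ioc (1:ℝ) 2, A ^ r = A ^ r := by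
        rw [setLIntegral_const, Real.volume_Ioc]; norm_num
      rw [← h1]
      refine (setLIntegral_mono' measurableSet_Ioc hpt).trans ?_
      have hm : ∀ i : ℕ, Measurable fun t : ℝ => H (((2:ℝ) ^ (i + 1))⁻¹ * t) := fun i => hHm.comp (measurable_const_mul _)
      rw [lintegral_add_left measurable_const, h1', lintegral_tsum fun i => ((hm i).const_mul _).aemeasurable]
      refine add_le_add le_rfl ?_
      rw [hI]
      refine le_trans ?_ (mul_le_mul_right (dy_sum H) _)
      rw [← ENNReal.tsum_mul_left]
      refine ENNReal.tsum_le_tsum fun i => ?_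
      have ha0 : (0:ℝ) < ((2:ℝ) ^ (i + 1))⁻¹ := by positivity
      rw [lintegral_const_mul _ (hm i), lint_scaleR ha0 hHm, dy_half, ← mul_assoc, mul_assoc (2 * c ^ r), ← ENNReal.ofReal_mul ha0.le,
        mul_inv_cancel₀ ha0.ne', ENNReal.ofReal_one, mul_one]
    have hfin : B ^ r ≤ (1 + 2 * c ^ r) * (A + contQ q F) ^ r := by
      refine hint.trans ?_
      rw [add_mul, one_mul]
      gcongr <;> simp
    have := ENNReal.rpow_le_rpow hfin (by positivity : 0 ≤ 1 / r)
    have hinv : ∀ X : ℝ≥0∞, (X ^ r) ^ (1 / r) = X := fun X => by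
      rw [← ENNReal.rpow_mul, mul_one_div_cancel hr0.ne', ENNReal.rpow_one]
    rwa [ENNReal.mul_rpow_of_nonneg _ _ (by positivity), hinv, hinv] at this

theorem partB {p q : ℝ≥0∞} (hp : p ≠ 0) (hq : q ≠ 0) (s : ℝ) {ε : ℝ} (hε : 0 < ε) (Ψ ψ : Sch n) (hΨ : ∀ x : Rn n, ‖x‖ < 2 * ε → 0 < ‖Ψ x‖)
    (hψ : ∀ x : Rn n, ε / 2 < ‖x‖ → ‖x‖ < 2 * ε → 0 < ‖ψ x‖) {φ : ℕ → Sch n} (hφ : SmoothResolution n φ) :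
    ∃ K : ℝ≥0∞, K ≠ ∞ ∧ ∀ {E : Type*} [NormedAddCommGroup E] [NormedSpace ℂ E] (f : TDist n E),
      besovNorm s p q φ f ≤ K * besovContNormI s p q Ψ ψ f := by
  obtain ⟨K, hK, h⟩ := partB0 hp hq s hε Ψ ψ hΨ hψ hφ
  obtain ⟨C, hC, hc⟩ := cont_lower hq s
  refine ⟨K * C, ENNReal.mul_ne_top hK hC, fun {E} _ _ f => ?_⟩
  set g : ℝ → ℝ≥0∞ := fun t : ℝ => if 0 < t then eLpNorm (mOp (dilate ψ t) f) p volume else 0 with hg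
  have hgm : Measurable g := g_meas p ψ f
  have hFm : Measurable fun t : ℝ => ENNReal.ofReal (t ^ (-s)) * g t :=
    (measurable_id.pow_const (-s)).ennreal_ofReal.mul hgm
  set A := eLpNorm (mOp Ψ f) p volume with hA
  have hI : A + contQ q (fun t : ℝ => ENNReal.ofReal (t ^ (-s)) * g t) ≤ besovContNormI s p q Ψ ψ f := by
    refine add_le_add le_rfl (contQ_mono (F' := fun t => ENNReal.ofReal (t ^ (-s)) * eLpNorm (mOp (dilate ψ t) f) p volume) q fun t ht _ => ?_)
    simp only [hg, if_pos ht]; exact le_rfl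
  rw [mul_assoc]
  refine le_trans ?_ (mul_le_mul_right (mul_le_mul_right hI C) K)
  by_cases hK0 : K = 0
  · have := h f 1 (by simp)
    rw [hK0, zero_mul] at this
    rw [hK0, zero_mul]; exact this
  have key : K⁻¹ * besovNorm s p q φ f ≤ C * (A + contQ q fun t : ℝ => ENNReal.ofReal (t ^ (-s)) * g t) := by
    refine hc _ hFm A _ fun t ht => ?_
    have h1 := h f t ⟨ht.1.le, ht.2⟩
    calc K⁻¹ * besovNorm s p q φ f ≤ K⁻¹ * (K * lqSum q fun l => (2:ℝ≥0∞) ^ ((l : ℝ) * s) * eLpNorm (mOp (LL Ψ ψ t l) f) p volume) :=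
          mul_le_mul_right h1 _
      _ = lqSum q fun l => (2:ℝ≥0∞) ^ ((l : ℝ) * s) * eLpNorm (mOp (LL Ψ ψ t l) f) p volume := by
          rw [← mul_assoc, ENNReal.inv_mul_cancel hK0 hK, one_mul]
      _ ≤ _ := by
          refine lq_mono q fun l => ?_
          rcases l with _ | i
          · simp [LL, hA]
          · have hm := dy_mem i ht
            rw [if_neg (by omega), LL, if_neg (by omega)]
            have hpos : 0 < ((2:ℝ) ^ (i + 1))⁻¹ * t := lt_of_le_of_lt (by positivity) hm.1
            simp only [hg, if_pos hpos]
            rw [← mul_assoc]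
            exact mul_le_mul_left (two_le_ofReal s i hm) _
  calc besovNorm s p q φ f = K * (K⁻¹ * besovNorm s p q φ f) := by
        rw [← mul_assoc, ENNReal.mul_inv_cancel hK0 hK, one_mul]
    _ ≤ _ := mul_le_mul_right key _

end BV

/-- continuous versions of the `B^s_{p,q}(E)` characterizations. -/
theorem statement4 (n : ℕ) (E : Type*) [NormedAddCommGroup E] [NormedSpace ℂ E]
    [CompleteSpace E] (s : ℝ) (p q : ℝ≥0∞) (hp : 0 < p) (hq : 0 < q)
    (d : ℝ) (hd : 0 < d)
    (S : ℤ) (hS : -1 ≤ S) (hSs : ⌊s⌋ ≤ S)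
    (ε : ℝ) (hε : 0 < ε) (Ψ ψ : Sch n)
    (hΨ : ∀ x : Rn n, ‖x‖ < 2 * ε → 0 < ‖Ψ x‖)
    (hψ : ∀ x : Rn n, ε / 2 < ‖x‖ → ‖x‖ < 2 * ε → 0 < ‖ψ x‖)
    (hmom : ∀ α : Fin n → ℕ, (mdeg α : ℤ) ≤ S → mderiv α (fun y => ψ y) 0 = 0)
    (φ : ℕ → Sch n) (hφ : SmoothResolution n φ) :
    (∃ c₁ > (0 : ℝ), ∃ c₂ > (0 : ℝ), ∃ c₃ > (0 : ℝ), ∃ c₄ > (0 : ℝ),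
      ∀ f : TDist n E, besovNorm s p q φ f < ∞ →
        ENNReal.ofReal c₁ * besovNorm s p q φ f ≤ besovContNormI s p q Ψ ψ f ∧
        besovContNormI s p q Ψ ψ f ≤ ENNReal.ofReal c₂ * besovNorm s p q φ f ∧
        ENNReal.ofReal c₃ * besovNorm s p q φ f ≤ besovContNormSup s p q d Ψ ψ f ∧
        besovContNormSup s p q d Ψ ψ f ≤ ENNReal.ofReal c₄ * besovNorm s p q φ f) ∧
    (∀ f : TDist n E, besovNorm s p q φ f < ∞ ↔ besovContNormI s p q Ψ ψ f < ∞) ∧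
    ∀ f : TDist n E, besovNorm s p q φ f < ∞ ↔ besovContNormSup s p q d Ψ ψ f < ∞ := by
  have hp' : p ≠ 0 := hp.ne'
  have hq' : q ≠ 0 := hq.ne'
  have hS' : s < ((S + 1).toNat : ℝ) := by
    have h1 : s < ⌊s⌋ + 1 := Int.lt_floor_add_one s
    have h2 : ((⌊s⌋ : ℤ) : ℝ) ≤ (S : ℝ) := by exact_mod_cast hSs
    have h3 : (((S + 1).toNat : ℤ) : ℝ) = ((S + 1 : ℤ) : ℝ) := by rw [Int.toNat_of_nonneg (by omega)]
    push_cast at h3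
    linarith
  have hm : ∀ k < (S + 1).toNat, iteratedFDeriv ℝ k ψ 0 = 0 := by
    intro k hk
    have h := BV.norm_iFD_le_of_mderiv ψ k 0 0 fun α hα => by
      rw [hmom α (by rw [hα]; omega), norm_zero]
    rw [mul_zero] at h
    exact norm_le_zero_iff.1 h
  obtain ⟨KA, hKA, hA⟩ := BV.partA (n := n) (s := s) hp' hq' hd.le Ψ ψ _ hS' hm hφ
  obtain ⟨KB, hKB, hB⟩ := BV.partB (n := n) hp' hq' s hε Ψ ψ hΨ hψ hφ
  have hIS : ∀ f : TDist n E, besovContNormI s p q Ψ ψ f ≤ besovContNormSup s p q d Ψ ψ f := by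
    intro f
    refine add_le_add ?_ (BV.contQ_mono (F := fun t => ENNReal.ofReal (t ^ (-s)) * eLpNorm (mOp (dilate ψ t) f) p volume)
      (F' := fun t => ENNReal.ofReal (t ^ (-s)) * lpNormENN p (supLocal d ψ f t)) q fun t ht _ => ?_)
    · rw [BV.eLp_eq hp']
      refine BV.lp_mono p fun x => ?_
      exact le_iSup₂_of_le x (by simpa using hd.le) le_rfl
    · refine mul_le_mul_right ?_ _
      rw [BV.eLp_eq hp']
      refine BV.lp_mono p fun x => ?_
      refine le_iSup₂_of_le x (by rw [dist_self]; positivity) ?_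
      exact le_iSup₂_of_le t ⟨le_rfl, by linarith⟩ le_rfl
  have hA' : ∀ f : TDist n E, besovContNormSup s p q d Ψ ψ f ≤ ENNReal.ofReal (KA.toReal + 1) * besovNorm s p q φ f := by
    intro f
    refine (hA f).trans (mul_le_mul_left ?_ _)
    rw [← ENNReal.ofReal_toReal hKA]
    exact ENNReal.ofReal_le_ofReal (by simp)
  have hB' : ∀ f : TDist n E, ENNReal.ofReal (KB.toReal + 1)⁻¹ * besovNorm s p q φ f ≤ besovContNormI s p q Ψ ψ f := by
    intro f
    have hpos : 0 < KB.toReal + 1 := by positivity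
    have h1 : besovNorm s p q φ f ≤ ENNReal.ofReal (KB.toReal + 1) * besovContNormI s p q Ψ ψ f := by
      refine (hB f).trans (mul_le_mul_left ?_ _)
      rw [← ENNReal.ofReal_toReal hKB]
      exact ENNReal.ofReal_le_ofReal (by simp)
    refine (mul_le_mul_right h1 _).trans ?_
    rw [← mul_assoc, ← ENNReal.ofReal_mul (by positivity), inv_mul_cancel₀ hpos.ne', ENNReal.ofReal_one, one_mul]
  refine ⟨⟨(KB.toReal + 1)⁻¹, by positivity, KA.toReal + 1, by positivity, (KB.toReal + 1)⁻¹, by positivity,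
    KA.toReal + 1, by positivity, fun f _ => ⟨hB' f, (hIS f).trans (hA' f), (hB' f).trans (hIS f), hA' f⟩⟩, ?_, ?_⟩
  · intro f
    exact ⟨fun h => ((hIS f).trans (hA' f)).trans_lt (ENNReal.mul_lt_top ENNReal.ofReal_lt_top h),
      fun h => (hB f).trans_lt (ENNReal.mul_lt_top hKB.lt_top h)⟩
  · intro f
    exact ⟨fun h => (hA' f).trans_lt (ENNReal.mul_lt_top ENNReal.ofReal_lt_top h),
      fun h => (hB f).trans_lt (ENNReal.mul_lt_top hKB.lt_top ((hIS f).trans_lt h))⟩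

end
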